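/- Let R be a Noetherian ring, 𝔞 an ideal of R, and M a nonzero finitely generated R-module of finite dimension c with cd(𝔞, M) = c. Then Ann_R(H^c_𝔞(M)) = Ann_R(M) if and only if Ass_R(R/Ann_R(M)) = Att_R(H^c_𝔞(M)). -/

import Mathlib

open CategoryTheory

/-- `HasCD a M c` : the cohomological dimension of `M` with respect to `a` is `c`,
i.e. `H^c_a(M) ≠ 0` and `H^i_a(M) = 0` for all `i > c`. -/
def HasCD {R : Type} [CommRing R] (a : Ideal R) (M : ModuleCat R) (c : ℕ) : Prop :=
  Nontrivial ((localCohomology a c).obj M) ∧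
    ∀ i, c < i → Subsingleton ((localCohomology a i).obj M)

/-- The attached primes of an `R`-module `A`: primes of the form `Ann_R(A/B)`. -/
def attachedPrimes (R : Type) [CommRing R] (A : Type) [AddCommGroup A] [Module R A] :
    Set (Ideal R) :=
  {p | p.IsPrime ∧ ∃ B : Submodule R A, p = Module.annihilator R (A ⧸ B)}

section
open CategoryTheory Abelian

namespace LC

section basic
variable {R : Type} [CommRing R]

/-- The projection `R/I ⟶ R/J` for `I ≤ J`. -/
noncomputable def qm {I J : Ideal R} (h : I ≤ J) :
    ModuleCat.of R (R ⧸ I) ⟶ ModuleCat.of R (R ⧸ J) :=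
  ModuleCat.ofHom (Submodule.factor h)

lemma qm_comp {I J K : Ideal R} (h : I ≤ J) (h' : J ≤ K) :
    qm h ≫ qm h' = qm (h.trans h') := by
  unfold qm
  rw [← ModuleCat.ofHom_comp, Submodule.factor_comp]

lemma qm_id {I : Ideal R} (h : I ≤ I) : qm h = 𝟙 _ := by
  unfold qm
  ext
  simp

/-- `Ext^i(R/a^n, X)`. -/
abbrev EX (a : Ideal R) (i : ℕ) (X : Type) [AddCommGroup X] [Module R X] (n : ℕ) : Type :=
  Ext.{0} (ModuleCat.of R (R ⧸ a ^ n)) (ModuleCat.of R X) i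

noncomputable def tr (a : Ideal R) (i : ℕ) (X : Type) [AddCommGroup X] [Module R X] (n m : ℕ)
    (h : n ≤ m) : EX a i X n →ₗ[R] EX a i X m :=
  (Ext.mk₀ (qm (Ideal.pow_le_pow_right h))).precompOfLinear R _ (zero_add i)

lemma tr_apply (a : Ideal R) (i : ℕ) (X : Type) [AddCommGroup X] [Module R X] (n m : ℕ)
    (h : n ≤ m) (x : EX a i X n) :
    tr a i X n m h x = (Ext.mk₀ (qm (Ideal.pow_le_pow_right h))).comp x (zero_add i) := rfl

instance (a : Ideal R) (i : ℕ) (X : Type) [AddCommGroup X] [Module R X] :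
    DirectedSystem (EX a i X) (tr a i X · · ·) where
  map_self n x := by
    rw [tr_apply, qm_id, Ext.mk₀_id_comp]
  map_map := by
    intro k j i hij hjk x
    simp only [tr_apply]
    rw [Ext.mk₀_comp_mk₀_assoc, qm_comp]

/-- Local cohomology `H^i_a(X)`. -/
def HL (a : Ideal R) (i : ℕ) (X : Type) [AddCommGroup X] [Module R X] : Type :=
  Module.DirectLimit (EX a i X) (tr a i X)

noncomputable instance (a : Ideal R) (i : ℕ) (X : Type) [AddCommGroup X] [Module R X] :
    AddCommGroup (HL a i X) := inferInstanceAs (AddCommGroup (Module.DirectLimit _ _))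
noncomputable instance (a : Ideal R) (i : ℕ) (X : Type) [AddCommGroup X] [Module R X] :
    Module R (HL a i X) := inferInstanceAs (Module R (Module.DirectLimit _ _))

variable (a : Ideal R) (i : ℕ) (X : Type) [AddCommGroup X] [Module R X]
variable {Y : Type} [AddCommGroup Y] [Module R Y] {Z : Type} [AddCommGroup Z] [Module R Z]

noncomputable def ofE (n : ℕ) : EX a i X n →ₗ[R] HL a i X :=
  Module.DirectLimit.of R ℕ (EX a i X) (tr a i X) n

variable {a i X}

lemma ofE_tr {n m : ℕ} (h : n ≤ m) (x : EX a i X n) :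
    ofE a i X m (tr a i X n m h x) = ofE a i X n x := Module.DirectLimit.of_f

lemma ofE_tr' {n m : ℕ} (h : n ≤ m) (x : EX a i X n) :
    ofE a i X m ((Ext.mk₀ (qm (Ideal.pow_le_pow_right h))).comp x (zero_add i)) = ofE a i X n x :=
  ofE_tr h x

lemma exists_ofE (h : HL a i X) : ∃ n x, ofE a i X n x = h := Module.DirectLimit.exists_of h

lemma ofE_eq_zero {n : ℕ} {x : EX a i X n} (h : ofE a i X n x = 0) :
    ∃ m, ∃ hm : n ≤ m, (Ext.mk₀ (qm (Ideal.pow_le_pow_right hm))).comp x (zero_add i) = 0 := 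
  Module.DirectLimit.of.zero_exact h

variable (a) in
/-- Generic map induced by composing with an `Ext` class. -/
noncomputable def post {j k : ℕ} (β : Ext.{0} (ModuleCat.of R X) (ModuleCat.of R Y) j) (h : i + j = k) :
    HL a i X →ₗ[R] HL a k Y :=
  Module.DirectLimit.lift R ℕ (EX a i X) (tr a i X)
    (fun n => ofE a k Y n ∘ₗ β.postcompOfLinear R _ h) (by
      intro n m hnm x
      simp only [LinearMap.comp_apply]
      rw [← ofE_tr hnm]
      congr 1
      simp only [tr_apply, LinearMap.flip_apply, Ext.bilinearCompOfLinear_apply_apply]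
      exact Ext.comp_assoc _ _ _ _ _ (by omega))

lemma post_ofE {j k : ℕ} (β : Ext.{0} (ModuleCat.of R X) (ModuleCat.of R Y) j) (h : i + j = k)
    (n : ℕ) (x : EX a i X n) : post a β h (ofE a i X n x) = ofE a k Y n (x.comp β h) :=
  Module.DirectLimit.lift_of _ _ _

variable (a i) in
/-- Functoriality. -/
noncomputable def map (f : X →ₗ[R] Y) : HL a i X →ₗ[R] HL a i Y :=
  post a (Ext.mk₀ (ModuleCat.ofHom f)) (add_zero i)

lemma map_ofE (f : X →ₗ[R] Y) (n : ℕ) (x : EX a i X n) :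
    map a i f (ofE a i X n x) = ofE a i Y n (x.comp (Ext.mk₀ (ModuleCat.ofHom f)) (add_zero i)) :=
  post_ofE _ _ _ _

lemma map_id (h : HL a i X) : map a i LinearMap.id h = h := by
  obtain ⟨n, x, rfl⟩ := exists_ofE h
  rw [map_ofE, ModuleCat.ofHom_id, Ext.comp_mk₀_id]

lemma map_comp (g : Y →ₗ[R] Z) (f : X →ₗ[R] Y) (h : HL a i X) :
    map a i (g ∘ₗ f) h = map a i g (map a i f h) := by
  obtain ⟨n, x, rfl⟩ := exists_ofE h
  rw [map_ofE, map_ofE, map_ofE, ModuleCat.ofHom_comp, ← Ext.mk₀_comp_mk₀]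
  congr 1
  exact (Ext.comp_assoc _ _ _ _ _ (by omega)).symm

lemma map_add (f g : X →ₗ[R] Y) (h : HL a i X) :
    map a i (f + g) h = map a i f h + map a i g h := by
  obtain ⟨n, x, rfl⟩ := exists_ofE h
  rw [map_ofE, map_ofE, map_ofE, ModuleCat.ofHom_add, Ext.mk₀_add, Ext.comp_add, _root_.map_add]

lemma map_smul (r : R) (f : X →ₗ[R] Y) (h : HL a i X) :
    map a i (r • f) h = r • map a i f h := by
  obtain ⟨n, x, rfl⟩ := exists_ofE h
  rw [map_ofE, map_ofE, ← _root_.map_smul, ← Ext.comp_smul, ← Ext.mk₀_smul]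
  rfl

lemma map_zero (h : HL a i X) : map a i (0 : X →ₗ[R] Y) h = 0 := by
  have := map_smul (0 : R) (0 : X →ₗ[R] Y) h
  simpa using this

lemma map_lsmul (r : R) (h : HL a i X) : map a i (LinearMap.lsmul R X r) h = r • h := by
  have : LinearMap.lsmul R X r = r • LinearMap.id := by ext; simp
  rw [this, map_smul, map_id]

/-- short complex from exact sequence -/
noncomputable abbrev SC {f : X →ₗ[R] Y} {g : Y →ₗ[R] Z} (hfg : Function.Exact f g) :
    ShortComplex (ModuleCat.{0} R) :=
  ShortComplex.mk (ModuleCat.ofHom f) (ModuleCat.ofHom g) (by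
    rw [← ModuleCat.ofHom_comp, hfg.linearMap_comp_eq_zero]; rfl)

lemma SC_shortExact {f : X →ₗ[R] Y} {g : Y →ₗ[R] Z} (hf : Function.Injective f)
    (hfg : Function.Exact f g) (hg : Function.Surjective g) : (SC hfg).ShortExact where
  exact := by
    rw [ShortComplex.moduleCat_exact_iff]
    intro x hx
    exact (hfg x).1 hx
  mono_f := by rw [ModuleCat.mono_iff_injective]; exact hf
  epi_g := by rw [ModuleCat.epi_iff_surjective]; exact hg

section LES
variable {f : X →ₗ[R] Y} {g : Y →ₗ[R] Z}
variable (a i)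

/-- connecting map -/
noncomputable def delta (hf : Function.Injective f)
    (hfg : Function.Exact f g) (hg : Function.Surjective g) : HL a i Z →ₗ[R] HL a (i+1) X :=
  post a (SC_shortExact hf hfg hg).extClass rfl

lemma delta_ofE (hf : Function.Injective f)
    (hfg : Function.Exact f g) (hg : Function.Surjective g)
    (n : ℕ) (x : EX a i Z n) : delta a i hf hfg hg (ofE a i Z n x) =
    ofE a (i+1) X n (x.comp (SC_shortExact hf hfg hg).extClass rfl) := post_ofE _ _ _ _

lemma exact_mid (hf : Function.Injective f)
    (hfg : Function.Exact f g) (hg : Function.Surjective g) : Function.Exact (map a i f) (map a i g) := by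
  intro y
  constructor
  · intro hy
    obtain ⟨n, x, rfl⟩ := exists_ofE y
    rw [map_ofE] at hy
    obtain ⟨m, hm, h0⟩ := ofE_eq_zero hy
    rw [← ofE_tr' hm]
    set x' := (Ext.mk₀ (qm (Ideal.pow_le_pow_right hm))).comp x (zero_add i)
    have : x'.comp (Ext.mk₀ (ModuleCat.ofHom g)) (add_zero i) = 0 := by
      rw [← h0]; exact Ext.comp_assoc _ _ _ _ _ (by omega)
    obtain ⟨z, hz⟩ := Ext.covariant_sequence_exact₂ _ (SC_shortExact hf hfg hg) x' this
    exact ⟨ofE a i X m z, by rw [map_ofE, ← hz]⟩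
  · rintro ⟨x, rfl⟩
    rw [← map_comp, hfg.linearMap_comp_eq_zero, map_zero]

lemma exact_right (hf : Function.Injective f)
    (hfg : Function.Exact f g) (hg : Function.Surjective g) : Function.Exact (map a i g) (delta a i hf hfg hg) := by
  intro y
  constructor
  · intro hy
    obtain ⟨n, x, rfl⟩ := exists_ofE y
    rw [delta_ofE] at hy
    obtain ⟨m, hm, h0⟩ := ofE_eq_zero hy
    rw [← ofE_tr' hm]
    set x' := (Ext.mk₀ (qm (Ideal.pow_le_pow_right hm))).comp x (zero_add i)
    have : x'.comp (SC_shortExact hf hfg hg).extClass rfl = 0 := by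
      rw [← h0]; exact Ext.comp_assoc _ _ _ _ _ (by omega)
    obtain ⟨z, hz⟩ := Ext.covariant_sequence_exact₃ _ (SC_shortExact hf hfg hg) x' rfl this
    exact ⟨ofE a i Y m z, by rw [map_ofE, ← hz]⟩
  · rintro ⟨x, rfl⟩
    obtain ⟨n, x, rfl⟩ := exists_ofE x
    rw [map_ofE, delta_ofE]
    have h1 := Ext.comp_assoc x (Ext.mk₀ (ModuleCat.ofHom g)) (SC_shortExact hf hfg hg).extClass
      (add_zero i) (zero_add 1) (by omega : i + 0 + 1 = i + 1)
    have h2 := (SC_shortExact hf hfg hg).comp_extClass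
    dsimp only at h2
    rw [h2, Ext.comp_zero] at h1
    rw [h1, _root_.map_zero]

lemma exact_left (hf : Function.Injective f)
    (hfg : Function.Exact f g) (hg : Function.Surjective g) : Function.Exact (delta a i hf hfg hg) (map a (i+1) f) := by
  intro y
  constructor
  · intro hy
    obtain ⟨n, x, rfl⟩ := exists_ofE y
    rw [map_ofE] at hy
    obtain ⟨m, hm, h0⟩ := ofE_eq_zero hy
    rw [← ofE_tr' hm]
    set x' := (Ext.mk₀ (qm (Ideal.pow_le_pow_right hm))).comp x (zero_add (i+1))
    have : x'.comp (Ext.mk₀ (ModuleCat.ofHom f)) (add_zero _) = 0 := by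
      rw [← h0]; exact Ext.comp_assoc _ _ _ _ _ (by omega)
    obtain ⟨z, hz⟩ := Ext.covariant_sequence_exact₁ _ (SC_shortExact hf hfg hg) x' this rfl
    exact ⟨ofE a i Z m z, by rw [delta_ofE, ← hz]⟩
  · rintro ⟨x, rfl⟩
    obtain ⟨n, x, rfl⟩ := exists_ofE x
    rw [delta_ofE, map_ofE]
    have h1 := Ext.comp_assoc x (SC_shortExact hf hfg hg).extClass (Ext.mk₀ (ModuleCat.ofHom f))
      rfl (add_zero 1) (by omega : i + 1 + 0 = i + 1)
    have h2 := (SC_shortExact hf hfg hg).extClass_comp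
    dsimp only at h2
    rw [h2, Ext.comp_zero] at h1
    rw [h1, _root_.map_zero]

end LES

/-- vanishing on injectives -/
lemma HL_injective (a : Ideal R) (i : ℕ) (X : Type) [AddCommGroup X] [Module R X]
    [Injective (ModuleCat.of R X)] : Subsingleton (HL a (i+1) X) := by
  refine subsingleton_of_forall_eq 0 fun h => ?_
  obtain ⟨n, x, rfl⟩ := exists_ofE h
  rw [Ext.eq_zero_of_injective x, _root_.map_zero]

section theta
variable {b : Ideal R} (hab : a ≤ b)
variable (i X)

/-- `H^i_b ⟶ H^i_a` for `a ≤ b`. -/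
noncomputable def theta : HL b i X →ₗ[R] HL a i X :=
  Module.DirectLimit.lift R ℕ (EX b i X) (tr b i X)
    (fun n => ofE a i X n ∘ₗ
      (Ext.mk₀ (qm (Ideal.pow_right_mono hab n))).precompOfLinear R _ (zero_add i)) (by
      intro n m hnm x
      simp only [LinearMap.comp_apply]
      rw [← ofE_tr hnm]
      congr 1
      simp only [tr_apply, Ext.bilinearCompOfLinear_apply_apply]
      rw [Ext.mk₀_comp_mk₀_assoc, Ext.mk₀_comp_mk₀_assoc, qm_comp, qm_comp])

lemma theta_ofE (n : ℕ) (x : EX b i X n) : theta i X hab (ofE b i X n x) =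
    ofE a i X n ((Ext.mk₀ (qm (Ideal.pow_right_mono hab n))).comp x (zero_add i)) :=
  Module.DirectLimit.lift_of _ _ _

variable {i X}
lemma theta_post {j k : ℕ} (β : Ext.{0} (ModuleCat.of R X) (ModuleCat.of R Y) j) (hk : i + j = k)
    (h : HL b i X) : theta k Y hab (post b β hk h) = post a β hk (theta i X hab h) := by
  obtain ⟨n, x, rfl⟩ := exists_ofE h
  rw [post_ofE, theta_ofE, theta_ofE, post_ofE]
  congr 1
  exact (Ext.comp_assoc _ _ _ _ _ (by omega)).symm

lemma theta_map (f : X →ₗ[R] Y) (h : HL b i X) :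
    theta i Y hab (map b i f h) = map a i f (theta i X hab h) := theta_post _ _ _ _

lemma theta_delta {f : X →ₗ[R] Y} {g : Y →ₗ[R] Z} (hf : Function.Injective f)
    (hfg : Function.Exact f g) (hg : Function.Surjective g) (h : HL b i Z) :
    theta (i+1) X hab (delta b i hf hfg hg h) = delta a i hf hfg hg (theta i Z hab h) :=
  theta_post _ _ _ _

lemma theta_theta {e : Ideal R} (hbe : b ≤ e) (h : HL e i X) :
    theta i X hab (theta i X hbe h) = theta i X (hab.trans hbe) h := by
  obtain ⟨n, x, rfl⟩ := exists_ofE h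
  rw [theta_ofE, theta_ofE, theta_ofE, Ext.mk₀_comp_mk₀_assoc, qm_comp]

lemma theta_self (hbe : a ≤ a) (h : HL a i X) : theta i X hbe h = h := by
  obtain ⟨n, x, rfl⟩ := exists_ofE h
  rw [theta_ofE, qm_id, Ext.mk₀_id_comp]

end theta

/-- torsion -/
lemma HL_torsion (h : HL a i X) : ∃ n, ∀ r ∈ a ^ n, r • h = 0 := by
  obtain ⟨n, x, rfl⟩ := exists_ofE h
  refine ⟨n, fun r hr => ?_⟩
  rw [← _root_.map_smul]
  have : r • x = (Ext.mk₀ (r • 𝟙 (ModuleCat.of R (R ⧸ a ^ n)))).comp x (zero_add i) := by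
    rw [Ext.mk₀_smul, Ext.smul_comp, Ext.mk₀_id_comp]
  have h0 : r • 𝟙 (ModuleCat.of R (R ⧸ a ^ n)) = 0 := by
    ext
    change r • (Submodule.Quotient.mk (p := (a^n : Ideal R)) 1) = 0
    rw [← Submodule.Quotient.mk_smul, Submodule.Quotient.mk_eq_zero]
    simpa using hr
  rw [this, h0, Ext.mk₀_zero, Ext.zero_comp, _root_.map_zero]

/-- evaluation at one on `Ext^0` -/
noncomputable def ev0 (a : Ideal R) (X : Type) [AddCommGroup X] [Module R X] (n : ℕ) :
    EX a 0 X n →ₗ[R] X where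
  toFun := fun x => (Ext.linearEquiv₀ (R := R) x).hom (Submodule.Quotient.mk 1)
  map_add' := by intros; simp
  map_smul' := by intros; simp

lemma ev0_mk₀ (n : ℕ) (f : ModuleCat.of R (R ⧸ a ^ n) ⟶ ModuleCat.of R X) :
    ev0 a X n (Ext.mk₀ f) = f.hom (Submodule.Quotient.mk 1) := by
  have : Ext.linearEquiv₀ (R := R) (Ext.mk₀ f) = f :=
    (Ext.linearEquiv₀ (R := R)).apply_symm_apply f
  change (Ext.linearEquiv₀ (R := R) (Ext.mk₀ f)).hom _ = _
  rw [this]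

lemma ext0_surj {A B : ModuleCat.{0} R} (x : Ext.{0} A B 0) : ∃ f, x = Ext.mk₀ f :=
  ⟨_, (Ext.mk₀_linearEquiv₀_apply (R := R) x).symm⟩

/-- degree zero -/
noncomputable def z0 (a : Ideal R) (X : Type) [AddCommGroup X] [Module R X] : HL a 0 X →ₗ[R] X :=
  Module.DirectLimit.lift R ℕ (EX a 0 X) (tr a 0 X) (ev0 a X) (by
      intro n m hnm x
      obtain ⟨y, rfl⟩ := ext0_surj x
      rw [tr_apply, Ext.mk₀_comp_mk₀, ev0_mk₀, ev0_mk₀]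
      rfl)

lemma z0_ofE (n : ℕ) (f : ModuleCat.of R (R ⧸ a ^ n) ⟶ ModuleCat.of R X) :
    z0 a X (ofE a 0 X n (Ext.mk₀ f)) = f.hom (Submodule.Quotient.mk 1) := by
  rw [← ev0_mk₀]
  exact Module.DirectLimit.lift_of _ _ _

lemma exists_ofE0 (h : HL a 0 X) : ∃ n f, ofE a 0 X n (Ext.mk₀ f) = h := by
  obtain ⟨n, x, rfl⟩ := exists_ofE h
  obtain ⟨y, rfl⟩ := ext0_surj x
  exact ⟨n, y, rfl⟩

lemma z0_map (f : X →ₗ[R] Y) (h : HL a 0 X) : z0 a Y (map a 0 f h) = f (z0 a X h) := by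
  obtain ⟨n, x, rfl⟩ := exists_ofE0 h
  rw [map_ofE, Ext.mk₀_comp_mk₀, z0_ofE, z0_ofE]
  rfl

lemma z0_theta {b : Ideal R} (hab : a ≤ b) (h : HL b 0 X) : z0 a X (theta 0 X hab h) = z0 b X h := by
  obtain ⟨n, x, rfl⟩ := exists_ofE0 h
  rw [theta_ofE, Ext.mk₀_comp_mk₀, z0_ofE, z0_ofE]
  rfl

lemma z0_inj : Function.Injective (z0 a X) := by
  rw [injective_iff_map_eq_zero]
  intro h hh
  obtain ⟨n, x, rfl⟩ := exists_ofE0 h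
  rw [z0_ofE] at hh
  have : x = 0 := by
    ext
    exact hh
  rw [this, Ext.mk₀_zero, _root_.map_zero]

lemma exists_z0 {x : X} {n : ℕ} (hx : ∀ r ∈ a ^ n, r • x = 0) : ∃ h, z0 a X h = x := by
  let f : (R ⧸ a ^ n) →ₗ[R] X := (a ^ n : Ideal R).liftQ (LinearMap.toSpanSingleton R X x) (by
    intro r hr
    simpa using hx r hr)
  refine ⟨ofE a 0 X n (Ext.mk₀ (ModuleCat.ofHom f)), ?_⟩
  rw [z0_ofE]
  change LinearMap.toSpanSingleton R X x 1 = x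
  simp

lemma z0_tors (h : HL a 0 X) : ∃ n, ∀ r ∈ a ^ n, r • z0 a X h = 0 := by
  obtain ⟨n, hn⟩ := HL_torsion h
  exact ⟨n, fun r hr => by rw [← _root_.map_smul, hn r hr, _root_.map_zero]⟩

lemma map0_inj {f : X →ₗ[R] Y} (hf : Function.Injective f) : Function.Injective (map a 0 f) := by
  rw [injective_iff_map_eq_zero]
  intro h hh
  apply z0_inj
  apply hf
  rw [← z0_map, hh]
  simp

end basic
end LC

end

section
open CategoryTheory Abelian Limits Opposite

namespace LC

section compare
variable {R : Type} [CommRing R]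

section res
variable {X Y : ModuleCat.{0} R} (P : ProjectiveResolution X) (n : ℕ)

lemma extMk_smul (r : R) (f : P.complex.X n ⟶ Y) (hf : P.complex.d (n+1) n ≫ f = 0) :
    P.extMk (r • f) (n+1) rfl (by rw [Linear.comp_smul, hf, smul_zero]) =
      r • P.extMk f (n+1) rfl hf := by
  rw [Ext.smul_eq_comp_mk₀, P.extMk_comp_mk₀]
  congr 1

lemma extMk_zero_inj (f : P.complex.X 0 ⟶ Y) (hf : P.complex.d 1 0 ≫ f = 0) 
    (h : P.extMk f 1 rfl hf = 0) : f = 0 := by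
  open CochainComplex HomComplex in
  simp only [← P.extEquivCohomologyClass.apply_eq_iff_eq,
    ProjectiveResolution.extEquivCohomologyClass_extMk, ProjectiveResolution.extEquivCohomologyClass_zero,
    CohomologyClass.mk_eq_zero_iff] at h
  rw [CochainComplex.HomComplex.Cocycle.toSingleMk_mem_coboundaries_iff _ _ _ _ _ 1 (by simp)] at h
  obtain ⟨g, hg⟩ := h
  have : IsZero (P.cochainComplex.X 1) := by
    exact P.cochainComplex.isZero_of_isStrictlyLE 0 1 
  rw [this.eq_of_src g 0, comp_zero] at hg
  rw [← cancel_epi (P.cochainComplexXIso (-(0:ℕ)) 0 rfl).hom, comp_zero]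
  exact hg.symm

variable (Y) in
/-- the complex `Hom(P, Y)` in the opposite category -/
noncomputable abbrev KC (P : ProjectiveResolution X) : ChainComplex (ModuleCat.{0} R)ᵒᵖ ℕ :=
  ((((linearYoneda R (ModuleCat.{0} R)).obj Y).rightOp).mapHomologicalComplex _).obj P.complex

/-- cocycles to maps -/
noncomputable def iotaC : ((KC Y P).opcycles n).unop →ₗ[R] (P.complex.X n ⟶ Y) :=
  ((KC Y P).pOpcycles n).unop.hom

lemma iotaC_inj : Function.Injective (iotaC (Y := Y) P n) := by
  have : Mono ((KC Y P).pOpcycles n).unop := inferInstance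
  exact (ModuleCat.mono_iff_injective _).1 this

lemma iotaC_range (f : P.complex.X n ⟶ Y) :
    (∃ u, iotaC (Y := Y) P n u = f) ↔ P.complex.d (n+1) n ≫ f = 0 := by
  have h := (ShortComplex.exact_of_g_is_cokernel
    (ShortComplex.mk ((KC Y P).d (n+1) n) ((KC Y P).pOpcycles n) ((KC Y P).d_pOpcycles (n+1) n))
    ((KC Y P).opcyclesIsCokernel (n+1) n (by simp))).unop
  have h2 := (ShortComplex.ShortExact.moduleCat_exact_iff_function_exact _).1 h
  exact (h2 f).symm

lemma iotaC_cocycle (u) : P.complex.d (n+1) n ≫ iotaC (Y := Y) P n u = 0 :=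
  (iotaC_range P n _).1 ⟨u, rfl⟩

/-- old Ext -/
noncomputable abbrev OE (n : ℕ) (X Y : ModuleCat.{0} R) : ModuleCat.{0} R :=
  ((_root_.Ext R (ModuleCat.{0} R) n).obj (op X)).obj Y

variable (Y) in
/-- derived functor comparison -/
noncomputable def isoLD :
    (((linearYoneda R (ModuleCat.{0} R)).obj Y).rightOp.leftDerived n).obj X ≅ (KC Y P).homology n :=
  P.isoLeftDerivedObj ((linearYoneda R (ModuleCat.{0} R)).obj Y).rightOp n

/-- cocycles to old Ext -/
noncomputable def sig : ((KC Y P).opcycles n).unop →ₗ[R] OE n X Y :=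
  ((isoLD Y P n).hom ≫
    (KC Y P).homologyι n).unop.hom

lemma sig_surj : Function.Surjective (sig (Y := Y) P n) := by
  have : Mono ((isoLD Y P n).hom ≫
    (KC Y P).homologyι n) := mono_comp _ _
  have : Epi ((isoLD Y P n).hom ≫
    (KC Y P).homologyι n).unop := inferInstance
  exact (ModuleCat.epi_iff_surjective _).1 this

lemma isoLD_inj : Function.Injective
   (isoLD Y P n).hom.unop.hom :=
  (ModuleCat.mono_iff_injective _).1 inferInstance

lemma sig_ker_succ (u) : sig (Y := Y) P (n+1) u = 0 ↔
    ∃ g : P.complex.X n ⟶ Y, P.complex.d (n+1) n ≫ g = iotaC P (n+1) u := by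
  have h := (ShortComplex.exact_of_f_is_kernel
    (ShortComplex.mk ((KC Y P).homologyι (n+1)) ((KC Y P).fromOpcycles (n+1) n)
      ((KC Y P).homologyι_comp_fromOpcycles (n+1) n))
    ((KC Y P).homologyIsKernel (n+1) n (by simp))).unop
  have h2 := (ShortComplex.ShortExact.moduleCat_exact_iff_function_exact _).1 h u
  have h3 : sig (Y := Y) P (n+1) u = 0 ↔ ((KC Y P).homologyι (n+1)).unop.hom u = 0 := by
    rw [← map_eq_zero_iff _ (isoLD_inj (Y := Y) P (n+1))]
    rfl
  rw [h3]
  refine h2.trans ?_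
  constructor
  · rintro ⟨g, rfl⟩
    refine ⟨g, ?_⟩
    have := congrArg (fun q => q.unop.hom g) ((KC Y P).p_fromOpcycles (n+1) n)
    exact this.symm
  · rintro ⟨g, hg⟩
    refine ⟨g, iotaC_inj P (n+1) ?_⟩
    rw [← hg]
    have := congrArg (fun q => q.unop.hom g) ((KC Y P).p_fromOpcycles (n+1) n)
    exact this

lemma sig_ker_zero (u) (h : sig (Y := Y) P 0 u = 0) : u = 0 := by
  have : IsIso ((KC Y P).homologyι 0) :=
    (KC Y P).isIso_homologyι 0 _ rfl (HomologicalComplex.shape _ _ _ (by simp))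
  have h2 : Mono ((KC Y P).homologyι 0).unop := inferInstance
  have h3 := (ModuleCat.mono_iff_injective _).1 h2
  apply h3
  apply isoLD_inj (Y := Y) P 0
  refine Eq.trans h ?_
  rw [_root_.map_zero, _root_.map_zero]
  rfl

/-- new Ext class -/
noncomputable def nuC : ((KC Y P).opcycles n).unop →ₗ[R] Ext.{0} X Y n where
  toFun u := P.extMk (iotaC P n u) (n+1) rfl (iotaC_cocycle P n u)
  map_add' u v := by
    rw [P.add_extMk]
    congr 1
    rw [_root_.map_add]
  map_smul' r u := by
    rw [RingHom.id_apply, ← extMk_smul]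
    congr 1
    rw [_root_.map_smul]

lemma nuC_surj : Function.Surjective (nuC (Y := Y) P n) := by
  intro α
  obtain ⟨f, hf, rfl⟩ := P.extMk_surjective α (n+1) rfl
  obtain ⟨u, rfl⟩ := (iotaC_range P n f).2 hf
  exact ⟨u, rfl⟩

lemma ker_eq : LinearMap.ker (nuC (Y := Y) P n) = LinearMap.ker (sig (Y := Y) P n) := by
  ext u
  rw [LinearMap.mem_ker, LinearMap.mem_ker]
  cases n with
  | zero =>
    constructor
    · intro h
      have : u = 0 := iotaC_inj P 0 (by
        rw [_root_.map_zero]; exact extMk_zero_inj P _ (iotaC_cocycle P 0 u) h)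
      rw [this, _root_.map_zero]
    · intro h
      rw [sig_ker_zero P u h, _root_.map_zero]
  | succ n =>
    rw [sig_ker_succ]
    exact P.extMk_eq_zero_iff (iotaC P (n+1) u) (n+1+1) rfl (iotaC_cocycle P _ u) n rfl

/-- comparison -/
noncomputable def cmpE : OE n X Y ≃ₗ[R] Ext.{0} X Y n :=
  ((sig (Y := Y) P n).quotKerEquivOfSurjective (sig_surj P n)).symm ≪≫ₗ
    (Submodule.quotEquivOfEq _ _ (ker_eq P n).symm) ≪≫ₗ
    ((nuC (Y := Y) P n).quotKerEquivOfSurjective (nuC_surj P n))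

lemma cmpE_sig (u) : cmpE P n (sig (Y := Y) P n u) = nuC P n u := by
  unfold cmpE
  simp only [LinearEquiv.trans_apply]
  have : ((sig (Y := Y) P n).quotKerEquivOfSurjective (sig_surj P n)).symm (sig P n u) =
    Submodule.Quotient.mk u := by
    rw [LinearEquiv.symm_apply_eq]; rfl
  rw [this]
  rfl

end res

section nat
variable {X X' Y : ModuleCat.{0} R} (P : ProjectiveResolution X) (P' : ProjectiveResolution X')
  (n : ℕ) (g : X' ⟶ X)

lemma cmpE_nat (z : OE n X Y) : cmpE P' n ((((_root_.Ext R (ModuleCat.{0} R) n).map g.op).app Y).hom z) =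
    (Ext.mk₀ g).comp (cmpE P n z) (zero_add n) := by
  obtain ⟨u, rfl⟩ := sig_surj P n z
  let φ : ProjectiveResolution.Hom P' P g :=
    ⟨ProjectiveResolution.lift g P' P,
      (ProjectiveResolution.lift_commutes_zero g P' P).trans (by simp)⟩
  let F := ((linearYoneda R (ModuleCat.{0} R)).obj Y).rightOp
  let Φ := (F.mapHomologicalComplex (ComplexShape.down ℕ)).map φ.hom
  have h1 : (F.leftDerived n).map g ≫ (isoLD Y P n).hom =
      (isoLD Y P' n).hom ≫ HomologicalComplex.homologyMap Φ n :=
    ProjectiveResolution.isoLeftDerivedObj_hom_naturality g P' P φ.hom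
      (ProjectiveResolution.lift_commutes_zero g P' P) F n
  have h2 := HomologicalComplex.homologyι_naturality Φ n
  have h3 := HomologicalComplex.p_opcyclesMap Φ n
  have e1 : (((_root_.Ext R (ModuleCat.{0} R) n).map g.op).app Y).hom (sig P n u) =
      sig P' n ((HomologicalComplex.opcyclesMap Φ n).unop.hom u) := by
    have : (F.leftDerived n).map g ≫ (isoLD Y P n).hom ≫ (KC Y P).homologyι n =
      ((isoLD Y P' n).hom ≫ (KC Y P').homologyι n) ≫ 
        HomologicalComplex.opcyclesMap Φ n := by
      rw [reassoc_of% h1, Category.assoc, ← h2]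
    exact congrArg (fun q => q.unop.hom u) this
  have e2 : iotaC P' n ((HomologicalComplex.opcyclesMap Φ n).unop.hom u) =
      φ.hom.f n ≫ iotaC P n u := congrArg (fun q => q.unop.hom u) h3
  rw [e1, cmpE_sig, cmpE_sig]
  have e3 := ProjectiveResolution.mk₀_comp_extMk (iotaC P n u) (n+1) rfl (iotaC_cocycle P n u) φ
  refine Eq.trans ?_ e3.symm
  change P'.extMk _ _ rfl (iotaC_cocycle P' n _) = _
  congr 1

end nat
end compare
end LC

end

section
open CategoryTheory Abelian Limits Opposite

namespace LC

section compare2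
variable {R : Type} [CommRing R] (a : Ideal R) (i : ℕ) (M : ModuleCat.{0} R)

/-- The Mathlib diagram. -/
noncomputable abbrev DG : ℕᵒᵖᵒᵖ ⥤ ModuleCat.{0} R ⥤ ModuleCat.{0} R :=
  localCohomology.diagram (localCohomology.idealPowersDiagram a) i

/-- Mathlib's local cohomology is a colimit of the evaluated diagram. -/
noncomputable def lcColim : IsColimit (((evaluation _ _).obj M).mapCocone (colimit.cocone (DG a i))) :=
  isColimitOfPreserves _ (colimit.isColimit (DG a i))

/-- legs -/
noncomputable def leg (n : ℕ) : OE i (ModuleCat.of R (R ⧸ a ^ n)) M →ₗ[R] (localCohomology a i).obj M :=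
  ((((evaluation _ _).obj M).mapCocone (colimit.cocone (DG a i))).ι.app (op (op n))).hom

lemma diag_map {n m : ℕ} (h : n ≤ m) :
    (localCohomology.ringModIdeals (localCohomology.idealPowersDiagram a)).map (homOfLE h).op
      = qm (Ideal.pow_le_pow_right h) := by
  ext
  rfl

/-- The transition in the old system. -/
noncomputable def otr {n m : ℕ} (h : n ≤ m) : OE i (ModuleCat.of R (R ⧸ a ^ n)) M →ₗ[R]
    OE i (ModuleCat.of R (R ⧸ a ^ m)) M :=
  (((_root_.Ext R (ModuleCat.{0} R) i).map (qm (Ideal.pow_le_pow_right h)).op).app M).hom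

lemma otr_eq {n m : ℕ} (f : op (op n) ⟶ op (op m)) :
    ∃ h : n ≤ m, ((DG a i ⋙ (evaluation _ _).obj M).map f).hom = otr a i M h := by
  have h : n ≤ m := leOfHom f.unop.unop
  exact ⟨h, rfl⟩

lemma leg_otr {n m : ℕ} (h : n ≤ m) (x) : leg a i M m (otr a i M h x) = leg a i M n x := by
  have := (((evaluation _ _).obj M).mapCocone (colimit.cocone (DG a i))).w (homOfLE h).op.op
  exact congrArg (fun q => q.hom x) this

lemma leg_surj (z : (localCohomology a i).obj M) : ∃ n x, leg a i M n x = z := by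
  obtain ⟨⟨⟨n⟩⟩, x, hx⟩ := Concrete.isColimit_exists_rep _ (lcColim a i M) z
  exact ⟨n, x, hx⟩

lemma leg_zero {n : ℕ} (x) (hx : leg a i M n x = 0) : ∃ m, ∃ h : n ≤ m, otr a i M h x = 0 := by
  obtain ⟨⟨⟨m⟩⟩, f, g, h⟩ := Concrete.isColimit_exists_of_rep_eq _ (lcColim a i M)
    (i := op (op n)) (j := op (op n)) x (0 : OE i (ModuleCat.of R (R ⧸ a ^ n)) M) (by
      refine Eq.trans hx ?_
      exact ((leg a i M n).map_zero).symm)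
  obtain ⟨h1, h1'⟩ := otr_eq a i M f
  obtain ⟨h2, h2'⟩ := otr_eq a i M g
  refine ⟨m, h1, ?_⟩
  change ((DG a i ⋙ (evaluation _ _).obj M).map f).hom x = ((DG a i ⋙ (evaluation _ _).obj M).map g).hom 0 at h
  rw [h1', h2'] at h
  exact h.trans (otr a i M h2).map_zero

/-- chosen comparison -/
noncomputable def ce (n : ℕ) : OE i (ModuleCat.of R (R ⧸ a ^ n)) M ≃ₗ[R] EX a i M n :=
  cmpE (projectiveResolution _) i

lemma ce_otr {n m : ℕ} (h : n ≤ m) (x) : ce a i M m (otr a i M h x) = tr a i M n m h (ce a i M n x) :=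
  cmpE_nat _ _ _ _ _

/-- the map from `HL` -/
noncomputable def toLC : HL a i M →ₗ[R] (localCohomology a i).obj M :=
  Module.DirectLimit.lift R ℕ (EX a i M) (tr a i M)
    (fun n => leg a i M n ∘ₗ (ce a i M n).symm.toLinearMap) (by
      intro n m h x
      obtain ⟨x, rfl⟩ := (ce a i M n).surjective x
      rw [← ce_otr]
      simp [leg_otr])

lemma toLC_ofE (n : ℕ) (x) : toLC a i M (ofE a i M n x) = leg a i M n ((ce a i M n).symm x) :=
  Module.DirectLimit.lift_of _ _ _

lemma toLC_bij : Function.Bijective (toLC a i M) := by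
  constructor
  · rw [injective_iff_map_eq_zero]
    intro h hh
    obtain ⟨n, x, rfl⟩ := exists_ofE h
    rw [toLC_ofE] at hh
    obtain ⟨m, h, h0⟩ := leg_zero a i M _ hh
    rw [← ofE_tr h]
    have := ce_otr a i M h ((ce a i M n).symm x)
    rw [h0] at this
    simp only [LinearEquiv.apply_symm_apply, _root_.map_zero] at this
    rw [← this, _root_.map_zero]
  · intro z
    obtain ⟨n, x, rfl⟩ := leg_surj a i M z
    exact ⟨ofE a i M n (ce a i M n x), by rw [toLC_ofE]; simp⟩

/-- Mathlib's local cohomology agrees with `HL`. -/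
noncomputable def lcEquiv : HL a i M ≃ₗ[R] (localCohomology a i).obj M :=
  LinearEquiv.ofBijective (toLC a i M) (toLC_bij a i M)

end compare2
end LC

end

section
open CategoryTheory Abelian

namespace LC

section noeth
variable {R : Type} [CommRing R]

/-- extension through a map with small kernel -/
lemma inj_ext {X Y I : Type} [AddCommGroup X] [Module R X] [AddCommGroup Y] [Module R Y]
    [AddCommGroup I] [Module R I] [hI : Module.Injective R I] (f : X →ₗ[R] Y) (g : X →ₗ[R] I)
    (h : LinearMap.ker f ≤ LinearMap.ker g) : ∃ e : Y →ₗ[R] I, ∀ x, e (f x) = g x := by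
  obtain ⟨e, he⟩ := hI.out ((LinearMap.ker f).liftQ f le_rfl)
    (LinearMap.ker_eq_bot.1 (Submodule.ker_liftQ_eq_bot _ _ _ le_rfl)) ((LinearMap.ker f).liftQ g h)
  exact ⟨e, fun x => he (Submodule.Quotient.mk x)⟩

/-- every module embeds in an injective one -/
lemma exists_inj (X : Type) [AddCommGroup X] [Module R X] :
    ∃ (I : Type) (_ : AddCommGroup I) (_ : Module R I) (f : X →ₗ[R] I),
      Module.Injective R I ∧ Function.Injective f := by
  let J := Injective.under (ModuleCat.of R X)
  refine ⟨J, inferInstance, inferInstance, (Injective.ι (ModuleCat.of R X)).hom, ?_, ?_⟩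
  · have : Injective J := inferInstance
    rw [Module.injective_iff_injective_object]
    exact this
  · exact (ModuleCat.mono_iff_injective _).1 inferInstance

lemma HL_inj (a : Ideal R) (i : ℕ) (X : Type) [AddCommGroup X] [Module R X]
    [h : Module.Injective R X] : Subsingleton (HL a (i+1) X) := by
  have : Injective (ModuleCat.of R X) := (Module.injective_iff_injective_object R X).1 h
  exact HL_injective a i X

/-- torsion submodule -/
def tors (a : Ideal R) (X : Type) [AddCommGroup X] [Module R X] : Submodule R X where
  carrier := {x | ∃ n, ∀ r ∈ a ^ n, r • x = 0}
  add_mem' := by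
    rintro x y ⟨n, hn⟩ ⟨m, hm⟩
    refine ⟨n + m, fun r hr => ?_⟩
    rw [smul_add, hn r (Ideal.pow_le_pow_right (by omega) hr),
      hm r (Ideal.pow_le_pow_right (by omega) hr), add_zero]
  zero_mem' := ⟨0, fun r _ => smul_zero r⟩
  smul_mem' := by
    rintro s x ⟨n, hn⟩
    exact ⟨n, fun r hr => by rw [smul_comm, hn r hr, smul_zero]⟩

variable {a : Ideal R} {X : Type} [AddCommGroup X] [Module R X]

lemma mem_tors {x : X} : x ∈ tors a X ↔ ∃ n, ∀ r ∈ a ^ n, r • x = 0 := Iff.rfl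

lemma tors_map {Y : Type} [AddCommGroup Y] [Module R Y] (f : X →ₗ[R] Y) {x : X} (h : x ∈ tors a X) :
    f x ∈ tors a Y := by
  obtain ⟨n, hn⟩ := h
  exact ⟨n, fun r hr => by rw [← _root_.map_smul, hn r hr, _root_.map_zero]⟩

lemma z0_mem_tors (h : HL a 0 X) : z0 a X h ∈ tors a X := z0_tors h

lemma exists_z0' {x : X} (hx : x ∈ tors a X) : ∃ h, z0 a X h = x := by
  obtain ⟨n, hn⟩ := hx
  exact exists_z0 hn

lemma tors_sup {y : R} {x : X} (hx : x ∈ tors a X) {k : ℕ} (hy : y ^ k • x = 0) :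
    x ∈ tors (a ⊔ Ideal.span {y}) X := by
  obtain ⟨n, hn⟩ := hx
  refine ⟨n + k, fun r hr => ?_⟩
  have := Ideal.sup_pow_add_le_pow_sup_pow hr
  rw [Ideal.span_singleton_pow, Submodule.mem_sup] at this
  obtain ⟨u, hu, v, hv, rfl⟩ := this
  obtain ⟨w, rfl⟩ := Ideal.mem_span_singleton'.1 hv
  rw [add_smul, hn u hu, mul_smul, hy, smul_zero, add_zero]

variable [IsNoetherianRing R]

lemma inj_tors {I : Type} [AddCommGroup I] [Module R I] [Module.Injective R I] (a : Ideal R) :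
    Module.Injective R (tors a I) := by
  classical
  apply Module.Baer.injective
  intro J g
  -- uniform exponent
  obtain ⟨n, hn⟩ : ∃ n, ∀ j : J, ∀ r ∈ a ^ n, r • g j = 0 := by
    have hfg : (⊤ : Submodule R J).FG := Module.Finite.fg_top
    obtain ⟨S, hS⟩ := hfg
    have h1 : ∀ T : Finset J, ∃ n, ∀ j ∈ Submodule.span R (T : Set J), ∀ r ∈ a ^ n, r • g j = 0 := by
      intro T
      induction T using Finset.induction with
      | empty =>
        refine ⟨0, fun j hj r _ => ?_⟩
        simp at hj
        simp [hj]
      | insert t T ht ih =>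
        obtain ⟨n, hn⟩ := ih
        obtain ⟨m, hm⟩ := (g t).2
        refine ⟨n + m, fun j hj r hr => ?_⟩
        rw [Finset.coe_insert, Submodule.mem_span_insert] at hj
        obtain ⟨c, z, hz, rfl⟩ := hj
        rw [_root_.map_add, smul_add, hn z hz r (Ideal.pow_le_pow_right (by omega) hr), add_zero,
          _root_.map_smul, smul_comm]
        have : r • g t = 0 := Subtype.ext (hm r (Ideal.pow_le_pow_right (by omega) hr))
        rw [this, smul_zero]
    obtain ⟨n, hn⟩ := h1 S
    exact ⟨n, fun j => hn j (by rw [hS]; trivial)⟩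
  obtain ⟨k, hk⟩ := Ideal.exists_pow_inf_eq_pow_smul a (M := R) J
  have hm : ∀ j : J, (j : R) ∈ a ^ (n + k) → g j = 0 := by
    intro j hj
    have h2 := hk (n + k) (by omega)
    have h3 : (j : R) ∈ a ^ n • J := by
      have : (j : R) ∈ a ^ (n + k) • (⊤ : Submodule R R) ⊓ J := ⟨by simpa using hj, j.2⟩
      rw [h2, Nat.add_sub_cancel] at this
      exact Submodule.smul_mono le_rfl inf_le_right this
    have h4 : ∀ x : R, x ∈ a ^ n • J → ∀ hx : x ∈ J, g ⟨x, hx⟩ = 0 := by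
      intro x hx
      refine Submodule.smul_induction_on' (p := fun x _ => ∀ hx : x ∈ J, g ⟨x, hx⟩ = 0) hx ?_ ?_
      · intro r hr j hj hx
        have : (⟨r • j, hx⟩ : J) = r • ⟨j, hj⟩ := rfl
        rw [this, _root_.map_smul]
        exact hn _ r hr
      · intro x hx y hy h1 h2 hxy
        have hx' := Submodule.smul_le_right hx
        have hy' := Submodule.smul_le_right hy
        have : (⟨x + y, hxy⟩ : J) = ⟨x, hx'⟩ + ⟨y, hy'⟩ := rfl
        rw [this, _root_.map_add, h1, h2, add_zero]
    exact h4 _ h3 j.2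
  obtain ⟨e, he⟩ := inj_ext (I := I) ((a ^ (n + k) : Ideal R).mkQ ∘ₗ J.subtype)
    ((tors a I).subtype ∘ₗ g) (by
      intro j hj
      rw [LinearMap.mem_ker, LinearMap.comp_apply, Submodule.mkQ_apply,
        Submodule.Quotient.mk_eq_zero] at hj
      rw [LinearMap.mem_ker, LinearMap.comp_apply, hm j hj, _root_.map_zero])
  have h1 : e (Submodule.Quotient.mk 1) ∈ tors a I := by
    refine ⟨n + k, fun r hr => ?_⟩
    rw [← _root_.map_smul, ← Submodule.Quotient.mk_smul, (Submodule.Quotient.mk_eq_zero _).2,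
      _root_.map_zero]
    simpa using hr
  refine ⟨LinearMap.toSpanSingleton R _ ⟨_, h1⟩, fun x hx => ?_⟩
  apply Subtype.ext
  have := he ⟨x, hx⟩
  simp only [LinearMap.comp_apply, Submodule.subtype_apply, Submodule.mkQ_apply] at this
  rw [← this]
  change x • e (Submodule.Quotient.mk 1) = _
  rw [← _root_.map_smul, ← Submodule.Quotient.mk_smul]
  simp

/-- localization surjectivity for injectives -/
lemma inj_div {I : Type} [AddCommGroup I] [Module R I] [Module.Injective R I] (y : R) (j : I) (k : ℕ) :
    ∃ (z : I) (l : ℕ), y ^ (l + k) • z = y ^ l • j := by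
  have : ∃ l, ∀ r : R, y ^ (l + k) * r = 0 → y ^ l * r = 0 := by
    let F : ℕ →o Submodule R R :=
      ⟨fun n => LinearMap.ker (LinearMap.lsmul R R (y ^ n)), by
        intro n m h r hr
        obtain ⟨d, rfl⟩ := Nat.exists_eq_add_of_le h
        simp only [LinearMap.mem_ker, LinearMap.lsmul_apply, smul_eq_mul] at hr ⊢
        rw [add_comm, pow_add, mul_assoc, hr, mul_zero]⟩
    obtain ⟨l, hl⟩ := monotone_stabilizes_iff_noetherian.2 (inferInstance : IsNoetherian R R) F
    refine ⟨l, fun r hr => ?_⟩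
    have : r ∈ F (l + k) := by
      change r ∈ LinearMap.ker (LinearMap.lsmul R R (y ^ (l + k)))
      simpa using hr
    rw [← hl (l+k) (by omega)] at this
    have h' : r ∈ LinearMap.ker (LinearMap.lsmul R R (y ^ l)) := this
    simpa using h'
  obtain ⟨l, hl⟩ := this
  obtain ⟨e, he⟩ := inj_ext (I := I) (LinearMap.lsmul R R (y ^ (l + k)))
    (LinearMap.toSpanSingleton R I (y ^ l • j)) (by
      intro r hr
      have := hl r (by simpa using hr)
      rw [LinearMap.mem_ker, LinearMap.toSpanSingleton_apply, smul_smul, mul_comm, this, zero_smul])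
  refine ⟨e 1, l, ?_⟩
  have := he 1
  simp only [LinearMap.lsmul_apply, LinearMap.toSpanSingleton_apply, one_smul, _root_.map_smul] at this
  exact this

/-- torsion modules have no higher local cohomology -/
lemma HL_of_tors (i : ℕ) : ∀ (X : Type) [AddCommGroup X] [Module R X], tors a X = ⊤ →
    Subsingleton (HL a (i+1) X) := by
  induction i with
  | zero =>
    intro X _ _ hX
    obtain ⟨I, _, _, f, hI, hf⟩ := exists_inj (R := R) X
    have := inj_tors (I := I) a
    let f' : X →ₗ[R] tors a I := f.codRestrict _ fun x => tors_map f (by rw [hX]; trivial)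
    have hf' : Function.Injective f' := fun x y h => hf (congrArg Subtype.val h)
    have hex : Function.Exact f' (LinearMap.range f').mkQ := LinearMap.exact_map_mkQ_range f'
    have hs := Submodule.mkQ_surjective (LinearMap.range f')
    have h1 := exact_left a 0 hf' hex hs
    have h2 := exact_right a 0 hf' hex hs
    have := HL_inj a 0 (tors a I)
    refine subsingleton_of_forall_eq 0 fun h => ?_
    obtain ⟨u, rfl⟩ := (h1 h).1 (Subsingleton.elim _ _)
    rw [h2]
    obtain ⟨e, he⟩ := hs (z0 a _ u)
    obtain ⟨v, rfl⟩ := exists_z0' (a := a) (x := e) (by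
      obtain ⟨n, hn⟩ := e.2
      exact ⟨n, fun r hr => Subtype.ext (hn r hr)⟩)
    exact ⟨v, z0_inj (by rw [z0_map, he])⟩
  | succ i ih =>
    intro X _ _ hX
    obtain ⟨I, _, _, f, hI, hf⟩ := exists_inj (R := R) X
    have := inj_tors (I := I) a
    let f' : X →ₗ[R] tors a I := f.codRestrict _ fun x => tors_map f (by rw [hX]; trivial)
    have hf' : Function.Injective f' := fun x y h => hf (congrArg Subtype.val h)
    have hex : Function.Exact f' (LinearMap.range f').mkQ := LinearMap.exact_map_mkQ_range f'
    have hs := Submodule.mkQ_surjective (LinearMap.range f')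
    have h1 := exact_left a (i+1) hf' hex hs
    have := HL_inj a (i+1) (tors a I)
    have := ih (tors a I ⧸ LinearMap.range f') (by
      rw [eq_top_iff]
      intro x _
      obtain ⟨e, rfl⟩ := hs x
      apply tors_map
      obtain ⟨n, hn⟩ := e.2
      exact ⟨n, fun r hr => Subtype.ext (hn r hr)⟩)
    refine subsingleton_of_forall_eq 0 fun h => ?_
    obtain ⟨u, rfl⟩ := (h1 h).1 (Subsingleton.elim _ _)
    rw [Subsingleton.elim u 0, _root_.map_zero]

end noeth
end LC

end

section
open CategoryTheory Abelian

namespace LC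
set_option linter.unusedSectionVars false

section thetalem
variable {R : Type} [CommRing R] [IsNoetherianRing R]

lemma pow_tors_sup {a : Ideal R} {y : R} {X : Type} [AddCommGroup X] [Module R X] {x : X}
    (hx : x ∈ tors (a ⊔ Ideal.span {y}) X) : ∃ k, y ^ k • x = 0 := by
  obtain ⟨n, hn⟩ := hx
  exact ⟨n, hn _ (Ideal.pow_mem_pow (Ideal.mem_sup_right (Ideal.mem_span_singleton_self y)) n)⟩

lemma tors_mono {a b : Ideal R} (hab : a ≤ b) {X : Type} [AddCommGroup X] [Module R X] {x : X}
    (hx : x ∈ tors b X) : x ∈ tors a X := by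
  obtain ⟨n, hn⟩ := hx
  exact ⟨n, fun r hr => hn r (Ideal.pow_right_mono hab n hr)⟩

lemma pow_shift {X : Type} [AddCommGroup X] [Module R X] {y : R} {x : X} {k : ℕ} (h : y ^ k • x = 0)
    (m : ℕ) : y ^ (m + k) • x = 0 := by rw [pow_add, mul_smul, h, smul_zero]

lemma delta_surj (b : Ideal R) (i : ℕ) {X I Z : Type} [AddCommGroup X] [Module R X]
    [AddCommGroup I] [Module R I] [AddCommGroup Z] [Module R Z] [Module.Injective R I]
    {f : X →ₗ[R] I} {g : I →ₗ[R] Z} (hf : Function.Injective f) (hfg : Function.Exact f g)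
    (hg : Function.Surjective g) : Function.Surjective (delta b i hf hfg hg) := by
  intro h
  have := HL_inj b i I
  exact (exact_left b i hf hfg hg h).1 (Subsingleton.elim _ _)

lemma delta_inj (b : Ideal R) (i : ℕ) {X I Z : Type} [AddCommGroup X] [Module R X]
    [AddCommGroup I] [Module R I] [AddCommGroup Z] [Module R Z] [Module.Injective R I]
    {f : X →ₗ[R] I} {g : I →ₗ[R] Z} (hf : Function.Injective f) (hfg : Function.Exact f g)
    (hg : Function.Surjective g) : Function.Injective (delta b (i+1) hf hfg hg) := by
  have := HL_inj b i I
  rw [injective_iff_map_eq_zero]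
  intro h hh
  obtain ⟨w, rfl⟩ := (exact_right b (i+1) hf hfg hg h).1 hh
  rw [Subsingleton.elim w 0, _root_.map_zero]

/-- elements of the injective module map to boundaries -/
lemma delta_zero_of (b : Ideal R) {X I Z : Type} [AddCommGroup X] [Module R X]
    [AddCommGroup I] [Module R I] [AddCommGroup Z] [Module R Z]
    {f : X →ₗ[R] I} {g : I →ₗ[R] Z} (hf : Function.Injective f) (hfg : Function.Exact f g)
    (hg : Function.Surjective g) {v : HL b 0 Z} {e : I} (he : e ∈ tors b I) (hv : g e = z0 b Z v) :
    delta b 0 hf hfg hg v = 0 := by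
  obtain ⟨w, rfl⟩ := exists_z0' he
  rw [exact_right b 0 hf hfg hg]
  exact ⟨w, z0_inj (by rw [z0_map, hv])⟩

variable (a : Ideal R) (y : R)

lemma theta_r (i : ℕ) : ∀ (X : Type) [AddCommGroup X] [Module R X] (h : HL a i X) (k : ℕ),
    y ^ k • h = 0 → ∃ h', theta i X (le_sup_left : a ≤ a ⊔ Ideal.span {y}) h' = h := by
  have i0 : ∀ (X : Type) [AddCommGroup X] [Module R X] (h : HL a 0 X) (k : ℕ),
    y ^ k • h = 0 → ∃ h', theta 0 X (le_sup_left : a ≤ a ⊔ Ideal.span {y}) h' = h := by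
    intro X _ _ h k hk
    have := tors_sup (z0_mem_tors h) (y := y) (k := k) (by
      rw [← _root_.map_smul, hk, _root_.map_zero])
    obtain ⟨h', hh'⟩ := exists_z0' this
    exact ⟨h', z0_inj (by rw [z0_theta, hh'])⟩
  induction i with
  | zero => exact i0
  | succ i ih =>
    intro X _ _ h k hk
    obtain ⟨I, _, _, f, hI, hf⟩ := exists_inj (R := R) X
    have hex : Function.Exact f (LinearMap.range f).mkQ := LinearMap.exact_map_mkQ_range f
    have hs := Submodule.mkQ_surjective (LinearMap.range f)
    obtain ⟨u, rfl⟩ := delta_surj a i hf hex hs h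
    rcases i with _ | i
    · rw [← _root_.map_smul, exact_right a 0 hf hex hs] at hk
      obtain ⟨w, hw⟩ := hk
      have hI' := inj_tors (I := I) a
      obtain ⟨⟨z, hz⟩, l, hl⟩ := inj_div (I := tors a I) y ⟨z0 a I w, z0_mem_tors w⟩ k
      replace hl : y ^ (l + k) • z = y ^ l • z0 a I w := congrArg Subtype.val hl
      obtain ⟨w', rfl⟩ := exists_z0' hz
      obtain ⟨v, hv⟩ := i0 _ (u - map a 0 (LinearMap.range f).mkQ w') (l + k) (by
        apply z0_inj
        rw [smul_sub, pow_add, mul_smul, ← hw, ← _root_.map_smul, ← _root_.map_smul, ← _root_.map_sub,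
          z0_map, _root_.map_sub, _root_.map_smul, _root_.map_smul, ← pow_add, hl, sub_self,
          _root_.map_zero, _root_.map_zero])
      refine ⟨delta _ 0 hf hex hs v, ?_⟩
      rw [theta_delta, hv, _root_.map_sub, sub_eq_self]
      exact (exact_right a 0 hf hex hs).apply_apply_eq_zero w'
    · rw [← _root_.map_smul] at hk
      have := delta_inj a i hf hex hs (hk.trans (_root_.map_zero _).symm)
      obtain ⟨v, hv⟩ := ih _ u k this
      exact ⟨delta _ (i+1) hf hex hs v, by rw [theta_delta, hv]⟩

lemma theta_k (i : ℕ) : ∀ (X : Type) [AddCommGroup X] [Module R X]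
    (h : HL (a ⊔ Ideal.span {y}) i X),
    theta i X (le_sup_left : a ≤ a ⊔ Ideal.span {y}) h = 0 →
    ∃ K : Submodule R (HL (a ⊔ Ideal.span {y}) i X), h ∈ K ∧
      K ≤ LinearMap.ker (theta i X (le_sup_left : a ≤ a ⊔ Ideal.span {y})) ∧
      (∃ n, ∀ r ∈ a ^ n, ∀ x ∈ K, r • x = 0) ∧ ∀ x ∈ K, ∃ x' ∈ K, y • x' = x := by
  induction i with
  | zero =>
    intro X _ _ h hh
    have : h = 0 := by
      apply z0_inj
      rw [← z0_theta (le_sup_left : a ≤ a ⊔ Ideal.span {y}), hh]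
      simp
    subst this
    refine ⟨⊥, by simp, by simp, ⟨0, by simp⟩, fun x hx => ⟨0, by simp, ?_⟩⟩
    rw [(Submodule.mem_bot R).1 hx, smul_zero]
  | succ i ih =>
    intro X _ _ h hh
    obtain ⟨I, _, _, f, hI, hf⟩ := exists_inj (R := R) X
    have hex : Function.Exact f (LinearMap.range f).mkQ := LinearMap.exact_map_mkQ_range f
    have hs := Submodule.mkQ_surjective (LinearMap.range f)
    obtain ⟨u, rfl⟩ := delta_surj (a ⊔ Ideal.span {y}) i hf hex hs h
    rw [theta_delta] at hh
    rcases i with _ | i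
    · rw [exact_right a 0 hf hex hs] at hh
      obtain ⟨w, hw⟩ := hh
      obtain ⟨n, hn⟩ := z0_mem_tors w
      let P : HL (a ⊔ Ideal.span {y}) 0 (I ⧸ LinearMap.range f) → I → Prop := fun v e =>
        (LinearMap.range f).mkQ e = z0 (a ⊔ Ideal.span {y}) _ v ∧ e ∈ tors a I ∧ ∃ k, ∀ r ∈ a ^ n, y ^ k • r • e = 0
      let K : Submodule R (HL (a ⊔ Ideal.span {y}) 1 X) :=
        { carrier := {x | ∃ v e, x = delta (a ⊔ Ideal.span {y}) 0 hf hex hs v ∧ P v e}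
          zero_mem' := ⟨0, 0, by simp, by simp, by simp, 0, by simp⟩
          add_mem' := by
            rintro _ _ ⟨v, e, rfl, h1, h2, k, hk⟩ ⟨v', e', rfl, h1', h2', k', hk'⟩
            refine ⟨v + v', e + e', by rw [_root_.map_add], by rw [_root_.map_add, _root_.map_add, h1, h1'],
              add_mem h2 h2', k + k', fun r hr => ?_⟩
            rw [smul_add, smul_add, pow_shift (hk' r hr), add_comm k k', pow_shift (hk r hr), add_zero]
          smul_mem' := by
            rintro s _ ⟨v, e, rfl, h1, h2, k, hk⟩
            refine ⟨s • v, s • e, by rw [_root_.map_smul], by rw [_root_.map_smul, _root_.map_smul, h1],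
              Submodule.smul_mem _ _ h2, k, fun r hr => ?_⟩
            rw [smul_comm r, smul_comm _ s, hk r hr, smul_zero] }
      refine ⟨K, ⟨u, z0 a I w, rfl, ?_, z0_mem_tors w, 0, ?_⟩, ?_, ⟨n, ?_⟩, ?_⟩
      · rw [← z0_map, hw, z0_theta]
      · intro r hr
        rw [hn r hr, smul_zero]
      · rintro _ ⟨v, e, rfl, h1, h2, k, hk⟩
        rw [LinearMap.mem_ker, theta_delta]
        exact delta_zero_of a hf hex hs h2 (by rw [h1, z0_theta])
      · rintro r hr _ ⟨v, e, rfl, h1, h2, k, hk⟩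
        rw [← _root_.map_smul]
        exact delta_zero_of (a ⊔ Ideal.span {y}) hf hex hs (e := r • e) (tors_sup (Submodule.smul_mem _ _ h2) (hk r hr))
          (by rw [_root_.map_smul, _root_.map_smul, h1])
      · rintro _ ⟨v, e, rfl, h1, h2, k, hk⟩
        have hI' := inj_tors (I := I) a
        obtain ⟨⟨z, hz⟩, l, hl⟩ := inj_div (I := tors a I) y ⟨e, h2⟩ 1
        replace hl : y ^ (l + 1) • z = y ^ l • e := congrArg Subtype.val hl
        obtain ⟨k', hk'⟩ := pow_tors_sup (z0_mem_tors v)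
        have hgz : (LinearMap.range f).mkQ z ∈ tors (a ⊔ Ideal.span {y}) (I ⧸ LinearMap.range f) := by
          refine tors_sup (tors_map _ hz) (y := y) (k := k' + (l + 1)) ?_
          rw [pow_add, mul_smul, ← _root_.map_smul, hl, _root_.map_smul, h1, smul_comm, hk', smul_zero]
        obtain ⟨v', hv'⟩ := exists_z0' hgz
        refine ⟨delta (a ⊔ Ideal.span {y}) 0 hf hex hs v', ⟨v', z, rfl, hv'.symm, hz, k + (l + 1), fun r hr => ?_⟩, ?_⟩
        · rw [pow_add, mul_smul, smul_comm _ r, hl, ← smul_comm _ r, smul_comm, hk r hr, smul_zero]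
        · rw [← sub_eq_zero, ← _root_.map_smul, ← _root_.map_sub]
          refine delta_zero_of (a ⊔ Ideal.span {y}) hf hex hs (e := y • z - e) (tors_sup (sub_mem (Submodule.smul_mem _ _ hz) h2)
            (y := y) (k := l) ?_) ?_
          · rw [smul_sub, ← hl, smul_smul, ← pow_succ, sub_self]
          · rw [_root_.map_sub, _root_.map_sub, _root_.map_smul, _root_.map_smul, h1, hv']
    · have := delta_inj a i hf hex hs (hh.trans (_root_.map_zero _).symm)
      obtain ⟨K, h1, h2, ⟨n, hn⟩, h3⟩ := ih _ u this
      refine ⟨K.map (delta (a ⊔ Ideal.span {y}) (i+1) hf hex hs), ⟨u, h1, rfl⟩, ?_, ⟨n, ?_⟩, ?_⟩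
      · rintro _ ⟨v, hv, rfl⟩
        rw [LinearMap.mem_ker, theta_delta, LinearMap.mem_ker.1 (h2 hv), _root_.map_zero]
      · rintro r hr _ ⟨v, hv, rfl⟩
        rw [← _root_.map_smul, hn r hr v hv, _root_.map_zero]
      · rintro _ ⟨v, hv, rfl⟩
        obtain ⟨v', hv', rfl⟩ := h3 v hv
        exact ⟨_, ⟨v', hv', rfl⟩, by rw [_root_.map_smul]⟩

end thetalem
end LC

end

section
open CategoryTheory Abelian

namespace LC
set_option linter.unusedSectionVars false
set_option linter.unusedVariables false

section vanish
variable {R : Type} [CommRing R] [IsNoetherianRing R]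

/-- all primes in the support have coheight `< i` -/
def SD (R : Type) [CommRing R] (i : ℕ) (X : Type) [AddCommGroup X] [Module R X] : Prop :=
  ∀ p ∈ Module.support R X, Order.coheight p < (i : ℕ∞)

variable {X Y Z : Type} [AddCommGroup X] [Module R X] [AddCommGroup Y] [Module R Y]
  [AddCommGroup Z] [Module R Z]

lemma SD.inj {i : ℕ} (h : SD R i Y) (f : X →ₗ[R] Y) (hf : Function.Injective f) : SD R i X :=
  fun p hp => h p (Module.support_subset_of_injective f hf hp)

lemma SD.surj {i : ℕ} (h : SD R i X) (f : X →ₗ[R] Y) (hf : Function.Surjective f) : SD R i Y :=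
  fun p hp => h p (Module.support_subset_of_surjective f hf hp)

lemma SD.sub {i : ℕ} (h : SD R i X) (N : Submodule R X) : SD R i N :=
  h.inj N.subtype N.subtype_injective

lemma SD.quot {i : ℕ} (h : SD R i X) (N : Submodule R X) : SD R i (X ⧸ N) :=
  h.surj N.mkQ N.mkQ_surjective

lemma SD.mono {i j : ℕ} (hij : i ≤ j) (h : SD R i X) : SD R j X :=
  fun p hp => (h p hp).trans_le (by exact_mod_cast hij)

lemma SD.of_ann [Module.Finite R X] [Module.Finite R Y] {i : ℕ} (h : SD R i X)
    (hle : Module.annihilator R X ≤ Module.annihilator R Y) : SD R i Y := by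
  intro p hp
  rw [Module.mem_support_iff_of_finite] at hp
  exact h p (by rw [Module.mem_support_iff_of_finite]; exact hle.trans hp)

lemma SD.drop [Module.Finite R X] [Module.Finite R Y] {i : ℕ} (h : SD R (i+1) X)
    (hq : (Module.annihilator R X).IsPrime) {t : R} (ht : t ∉ Module.annihilator R X)
    (hle : Module.annihilator R X ≤ Module.annihilator R Y) (ht' : t ∈ Module.annihilator R Y) :
    SD R i Y := by
  intro p hp
  rw [Module.mem_support_iff_of_finite] at hp
  let q : PrimeSpectrum R := ⟨_, hq⟩
  have hqs : q ∈ Module.support R X := by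
    rw [Module.mem_support_iff_of_finite]
  have hqp : q < p := by
    refine lt_of_le_of_ne (hle.trans hp) ?_
    rintro rfl
    exact ht (hp ht')
  have h1 := Order.coheight_add_one_le hqp
  have h2 := h q hqs
  have h3 : Order.coheight p + 1 < (i : ℕ∞) + 1 := lt_of_le_of_lt h1 (by exact_mod_cast h2)
  exact lt_of_add_lt_add_right h3

lemma mem_supp_quot (I : Ideal R) (q : PrimeSpectrum R) :
    q ∈ Module.support R (R ⧸ I) ↔ I ≤ q.asIdeal := by
  rw [Module.mem_support_iff_of_finite, Ideal.annihilator_quotient]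

lemma devissage (P : ∀ (X : Type) [AddCommGroup X] [Module R X], Prop) (S : Set (PrimeSpectrum R))
    (h0 : ∀ (X : Type) [AddCommGroup X] [Module R X], Subsingleton X → P X)
    (hp : ∀ p ∈ S, P (R ⧸ p.asIdeal))
    (hex : ∀ (X Y Z : Type) [AddCommGroup X] [Module R X] [AddCommGroup Y] [Module R Y]
      [AddCommGroup Z] [Module R Z] [Module.Finite R X] [Module.Finite R Y] [Module.Finite R Z]
      (f : X →ₗ[R] Y) (g : Y →ₗ[R] Z),
      Function.Injective f → Function.Exact f g → Function.Surjective g →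
      Module.support R Y ⊆ S → P X → P Z → P Y)
    (X : Type) [AddCommGroup X] [Module R X] [hX : Module.Finite R X] (hS : Module.support R X ⊆ S) :
    P X := by
  revert hS
  refine IsNoetherianRing.induction_on_isQuotientEquivQuotientPrime R hX
    (motive := fun N _ _ _ => Module.support R N ⊆ S → P N) ?_ ?_ ?_
  · intro N _ _ _ _ _
    exact h0 N inferInstance
  · intro N _ _ _ p e hS
    have hpS : p ∈ S := by
      apply hS
      rw [e.support_eq, mem_supp_quot]
    exact hex (R ⧸ p.asIdeal) N PUnit e.symm.toLinearMap 0 e.symm.injective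
      ((LinearMap.exact_zero_iff_surjective _ _).2 e.symm.surjective)
      (Function.surjective_to_subsingleton _) hS (hp p hpS) (h0 _ inferInstance)
  · intro N₁ _ _ _ N₂ _ _ _ N₃ _ _ _ f g hf hg hfg h1 h3 hS
    exact hex _ _ _ f g hf hfg hg hS (h1 ((Module.support_subset_of_injective f hf).trans hS))
      (h3 ((Module.support_subset_of_surjective g hg).trans hS))

variable (a : Ideal R)

lemma HL_subs (i : ℕ) (h : Subsingleton X) : Subsingleton (HL a i X) := by
  refine subsingleton_of_forall_eq 0 fun u => ?_
  rw [← map_id u, Subsingleton.elim (LinearMap.id : X →ₗ[R] X) 0, map_zero]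

lemma HL_ext (i : ℕ) {f : X →ₗ[R] Y} {g : Y →ₗ[R] Z} (hf : Function.Injective f)
    (hfg : Function.Exact f g) (hg : Function.Surjective g) (h1 : Subsingleton (HL a i X))
    (h2 : Subsingleton (HL a i Z)) : Subsingleton (HL a i Y) := by
  refine subsingleton_of_forall_eq 0 fun u => ?_
  obtain ⟨v, rfl⟩ := (exact_mid a i hf hfg hg u).1 (Subsingleton.elim _ _)
  rw [Subsingleton.elim v 0, _root_.map_zero]

/-- vanishing from primes -/
lemma HL_of_primes (i : ℕ) [Module.Finite R X]
    (h : ∀ p ∈ Module.support R X, Subsingleton (HL a i (R ⧸ p.asIdeal))) :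
    Subsingleton (HL a i X) :=
  devissage (fun X _ _ => Subsingleton (HL a i X)) {p | Subsingleton (HL a i (R ⧸ p.asIdeal))}
    (fun X _ _ hX => HL_subs a i hX) (fun p hp => hp)
    (fun X Y Z _ _ _ _ _ _ _ _ _ f g hf hfg hg _ h1 h3 => HL_ext a i hf hfg hg h1 h3) X h

lemma tker {i : ℕ} {t : R} (hf : Function.Injective (LinearMap.lsmul R X t)) :
    Function.Exact (delta a i hf (LinearMap.exact_map_mkQ_range _) (Submodule.mkQ_surjective _))
      (LinearMap.lsmul R (HL a (i+1) X) t) := by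
  intro u
  rw [← exact_left a i hf (LinearMap.exact_map_mkQ_range _) (Submodule.mkQ_surjective _) u,
    map_lsmul]
  rfl

lemma HL_pow_tors {i : ℕ} {t : R} (ht : t ∈ a) (h : HL a i X) : ∃ n, t ^ n • h = 0 := by
  obtain ⟨n, hn⟩ := HL_torsion h
  exact ⟨n, hn _ (Ideal.pow_mem_pow ht n)⟩

lemma eq_zero_of_tors {V : Type} [AddCommGroup V] [Module R V] {t : R}
    (h0 : ∀ v : V, t • v = 0 → v = 0) {v : V} {n : ℕ} (h : t ^ n • v = 0) : v = 0 := by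
  induction n with
  | zero => simpa using h
  | succ n ih => exact ih (h0 _ (by rw [smul_smul, ← pow_succ', h]))

lemma HL_of_quot {i : ℕ} {t : R} (ht : t ∈ a) (hf : Function.Injective (LinearMap.lsmul R X t))
    (h : Subsingleton (HL a i (X ⧸ LinearMap.range (LinearMap.lsmul R X t)))) :
    Subsingleton (HL a (i+1) X) := by
  refine subsingleton_of_forall_eq 0 fun u => ?_
  obtain ⟨n, hn⟩ := HL_pow_tors a ht u
  refine eq_zero_of_tors (t := t) (fun v hv => ?_) hn
  obtain ⟨w, rfl⟩ := (tker a hf v).1 hv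
  rw [Subsingleton.elim w 0, _root_.map_zero]

lemma ann_quot_prime (p : PrimeSpectrum R) : Module.annihilator R (R ⧸ p.asIdeal) = p.asIdeal :=
  Ideal.annihilator_quotient

lemma lsmul_inj_prime {p : Ideal R} (hp : p.IsPrime) {t : R} (ht : t ∉ p) :
    Function.Injective (LinearMap.lsmul R (R ⧸ p) t) := by
  rw [injective_iff_map_eq_zero]
  intro x hx
  obtain ⟨r, rfl⟩ := Ideal.Quotient.mk_surjective x
  have : Ideal.Quotient.mk p (t * r) = 0 := hx
  rw [Ideal.Quotient.eq_zero_iff_mem] at this ⊢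
  exact (hp.mem_or_mem this).resolve_left ht

lemma t_ann_quot (t : R) : t ∈ Module.annihilator R (X ⧸ LinearMap.range (LinearMap.lsmul R X t)) := by
  rw [Module.mem_annihilator]
  intro x
  obtain ⟨x, rfl⟩ := Submodule.mkQ_surjective _ x
  rw [← _root_.map_smul, Submodule.mkQ_apply, Submodule.Quotient.mk_eq_zero]
  exact ⟨x, rfl⟩

lemma ann_le_quot (N : Submodule R X) : Module.annihilator R X ≤ Module.annihilator R (X ⧸ N) :=
  N.mkQ.annihilator_le_of_surjective N.mkQ_surjective

lemma SD.prime_drop {i : ℕ} {p : PrimeSpectrum R} (h : SD R (i+1) (R ⧸ p.asIdeal)) {t : R}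
    (ht : t ∉ p.asIdeal) :
    SD R i ((R ⧸ p.asIdeal) ⧸ LinearMap.range (LinearMap.lsmul R (R ⧸ p.asIdeal) t)) := by
  refine SD.drop h ?_ (t := t) ?_ (ann_le_quot _) (t_ann_quot t)
  · rw [ann_quot_prime]; exact p.2
  · rwa [ann_quot_prime]

lemma SD.of_mem {i : ℕ} (h : SD R i X) {p : PrimeSpectrum R} (hp : p ∈ Module.support R X) :
    SD R i (R ⧸ p.asIdeal) := by
  intro q hq
  refine h q (Module.mem_support_mono ?_ hp)
  rw [mem_supp_quot] at hq
  exact hq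

lemma SD.sub_zero (h : SD R 0 X) : Subsingleton X := by
  rw [← Module.support_eq_empty_iff (R := R), Set.eq_empty_iff_forall_notMem]
  intro p hp
  simpa using h p hp

lemma tors_top_of_ann (h : a ≤ Module.annihilator R X) : tors a X = ⊤ := by
  rw [eq_top_iff]
  intro x _
  refine ⟨1, fun r hr => Module.mem_annihilator.1 (h (by simpa using hr)) x⟩

lemma vanish (i : ℕ) : ∀ (X : Type) [AddCommGroup X] [Module R X] [Module.Finite R X], SD R i X →
    Subsingleton (HL a i X) := by
  induction i with
  | zero =>
    intro X _ _ _ h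
    exact HL_subs a 0 h.sub_zero
  | succ i ih =>
    intro X _ _ _ h
    refine HL_of_primes a (i+1) fun p hp => ?_
    by_cases hap : a ≤ p.asIdeal
    · refine HL_of_tors i _ (tors_top_of_ann a ?_)
      rwa [ann_quot_prime]
    · obtain ⟨t, hta, htp⟩ := Set.not_subset.1 hap
      refine HL_of_quot a hta (lsmul_inj_prime p.2 htp) (ih _ ?_)
      exact (h.of_mem hp).prime_drop htp

lemma map_surj (c : ℕ) [Module.Finite R Y] (h : SD R (c+1) Y) {g : Y →ₗ[R] Z}
    (hg : Function.Surjective g) : Function.Surjective (map a c g) := by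
  have hex : Function.Exact (LinearMap.ker g).subtype g := LinearMap.exact_subtype_ker_map g
  have := vanish a (c+1) (LinearMap.ker g) (h.sub _)
  intro z
  exact (exact_right a c (Submodule.subtype_injective _) hex hg z).1 (Subsingleton.elim _ _)

end vanish
end LC

end

section
open CategoryTheory Abelian

namespace LC
set_option linter.unusedSectionVars false
set_option linter.unusedVariables false

section serre
variable {R : Type} [CommRing R]

/-- Serre classes of modules -/
structure Serre (P : ∀ (V : Type) [AddCommGroup V] [Module R V], Prop) : Prop where
  inj : ∀ {X Y : Type} [AddCommGroup X] [Module R X] [AddCommGroup Y] [Module R Y] (f : X →ₗ[R] Y),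
    Function.Injective f → P Y → P X
  surj : ∀ {X Y : Type} [AddCommGroup X] [Module R X] [AddCommGroup Y] [Module R Y] (f : X →ₗ[R] Y),
    Function.Surjective f → P X → P Y
  ext : ∀ {X Y Z : Type} [AddCommGroup X] [Module R X] [AddCommGroup Y] [Module R Y] [AddCommGroup Z]
    [Module R Z] (f : X →ₗ[R] Y) (g : Y →ₗ[R] Z), Function.Injective f → Function.Exact f g →
    Function.Surjective g → P X → P Z → P Y
  zero : ∀ (X : Type) [AddCommGroup X] [Module R X], Subsingleton X → P X

variable {P : ∀ (V : Type) [AddCommGroup V] [Module R V], Prop}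
variable {X Y Z : Type} [AddCommGroup X] [Module R X] [AddCommGroup Y] [Module R Y]
  [AddCommGroup Z] [Module R Z]

lemma Serre.mid (hP : Serre (R := R) P) (f : X →ₗ[R] Y) (g : Y →ₗ[R] Z) (h : Function.Exact f g) (hX : P X)
    (hZ : P Z) : P Y := by
  refine hP.ext (LinearMap.range f).subtype g.rangeRestrict (Submodule.subtype_injective _) ?_
    g.surjective_rangeRestrict (hP.surj f.rangeRestrict f.surjective_rangeRestrict hX)
    (hP.inj (LinearMap.range g).subtype (Submodule.subtype_injective _) hZ)
  intro y
  rw [Submodule.coe_subtype, Subtype.range_coe, ← Subtype.coe_inj]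
  exact h y

lemma Serre.sup (hP : Serre (R := R) P) (f : X →ₗ[R] Z) (g : Y →ₗ[R] Z)
    (h : ∀ z, ∃ x y, f x + g y = z) (hX : P X) (hY : P Y) : P Z := by
  refine hP.mid f (LinearMap.range f).mkQ (LinearMap.exact_map_mkQ_range f) hX
    (hP.surj ((LinearMap.range f).mkQ ∘ₗ g) ?_ hY)
  intro q
  obtain ⟨z, rfl⟩ := Submodule.mkQ_surjective _ q
  obtain ⟨x, y, rfl⟩ := h z
  refine ⟨y, ?_⟩
  rw [LinearMap.comp_apply, _root_.map_add, right_eq_add, Submodule.mkQ_apply,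
    Submodule.Quotient.mk_eq_zero]
  exact ⟨x, rfl⟩

lemma Serre.sub (hP : Serre (R := R) P) (U : Submodule R X) (h : P X) : P U :=
  hP.inj U.subtype U.subtype_injective h

lemma Serre.quot (hP : Serre (R := R) P) (U : Submodule R X) (h : P X) : P (X ⧸ U) :=
  hP.surj U.mkQ U.mkQ_surjective h

lemma Serre.le (hP : Serre (R := R) P) {U V : Submodule R X} (hUV : U ≤ V) (h : P V) : P U :=
  hP.inj (Submodule.inclusion hUV) (Submodule.inclusion_injective hUV) h

lemma Serre.quot_le (hP : Serre (R := R) P) {U V : Submodule R X} (hUV : U ≤ V) (h : P (X ⧸ U)) : P (X ⧸ V) :=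
  hP.surj (Submodule.factor hUV) (Submodule.factor_surjective hUV) h

lemma Serre.kerpow (hP : Serre (R := R) P) (φ : Module.End R X) (h : P (LinearMap.ker φ)) (n : ℕ) :
    P (LinearMap.ker (φ ^ n)) := by
  induction n with
  | zero =>
    apply hP.zero
    rw [pow_zero, Module.End.one_eq_id, LinearMap.ker_id]
    infer_instance
  | succ n ih =>
    refine hP.mid (Submodule.inclusion (p := LinearMap.ker φ) (p' := LinearMap.ker (φ ^ (n+1))) ?_)
      (φ.restrict (p := LinearMap.ker (φ ^ (n+1))) (q := LinearMap.ker (φ ^ n)) ?_) ?_ h ih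
    · intro x hx
      rw [LinearMap.mem_ker] at hx ⊢
      rw [pow_succ, Module.End.mul_apply, hx, _root_.map_zero]
    · intro x hx
      rw [LinearMap.mem_ker] at hx ⊢
      rwa [pow_succ, Module.End.mul_apply] at hx
    · intro x
      constructor
      · intro hx
        exact ⟨⟨x, congrArg Subtype.val hx⟩, rfl⟩
      · rintro ⟨y, rfl⟩
        exact Subtype.ext y.2

/-- kernel of multiplication -/
abbrev kt (t : R) (V : Type) [AddCommGroup V] [Module R V] : Submodule R V :=
  LinearMap.ker (LinearMap.lsmul R V t)

lemma mem_kt {t : R} {x : X} : x ∈ kt t X ↔ t • x = 0 := Iff.rfl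

lemma lsmul_pow (t : R) (n : ℕ) : (LinearMap.lsmul R X t) ^ n = LinearMap.lsmul R X (t ^ n) := by
  induction n with
  | zero => ext; simp
  | succ n ih =>
    ext x
    rw [pow_succ, Module.End.mul_apply, ih]
    simp only [LinearMap.lsmul_apply, smul_smul, pow_succ]

lemma Serre.ktpow (hP : Serre (R := R) P) (t : R) (h : P (kt t X)) (n : ℕ) : P (kt (t ^ n) X) := by
  have := hP.kerpow _ h n
  rwa [lsmul_pow] at this

/-- elements killed by a set -/
def sk (S : Set R) (V : Type) [AddCommGroup V] [Module R V] : Submodule R V where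
  carrier := {v | ∀ r ∈ S, r • v = 0}
  add_mem' := by
    intro x y hx hy r hr
    rw [smul_add, hx r hr, hy r hr, add_zero]
  zero_mem' := fun r _ => smul_zero r
  smul_mem' := by
    intro s x hx r hr
    rw [smul_comm, hx r hr, smul_zero]

lemma mem_sk {S : Set R} {x : X} : x ∈ sk S X ↔ ∀ r ∈ S, r • x = 0 := Iff.rfl

lemma sk_anti {S T : Set R} (h : S ⊆ T) : sk T X ≤ sk S X := fun x hx r hr => hx r (h hr)

lemma sk_span (S : Set R) : sk ((Ideal.span S : Ideal R) : Set R) X = sk S X := by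
  refine le_antisymm (sk_anti Submodule.subset_span) fun x hx r hr => ?_
  have : S ⊆ ((Submodule.span R {x}).annihilator : Set R) := by
    intro r hr
    rw [SetLike.mem_coe, Submodule.mem_annihilator_span_singleton]
    exact hx r hr
  have := Ideal.span_le.2 this hr
  rwa [Submodule.mem_annihilator_span_singleton] at this

lemma serre_noeth : Serre (R := R) (fun V _ _ => IsNoetherian R V) where
  inj f hf h := isNoetherian_of_injective f hf
  surj f hf h := isNoetherian_of_surjective f (LinearMap.range_eq_top.2 hf)
  ext f g hf hfg hg h1 h2 := isNoetherian_of_range_eq_ker f g (LinearMap.exact_iff.1 hfg).symm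
  zero X _ _ h := inferInstance

lemma serre_art : Serre (R := R) (fun V _ _ => IsArtinian R V) where
  inj f hf h := isArtinian_of_injective f hf
  surj f hf h := isArtinian_of_surjective _ f hf
  ext f g hf hfg hg h1 h2 := isArtinian_of_range_eq_ker f g (LinearMap.exact_iff.1 hfg).symm
  zero X _ _ h := inferInstance

/-- iterated images stabilize -/
def ti (t : R) (U : Submodule R X) : Submodule R X := ⨅ k : ℕ, U.map (LinearMap.lsmul R X (t ^ k))

lemma map_pow_anti (t : R) (U : Submodule R X) {k l : ℕ} (h : k ≤ l) :
    U.map (LinearMap.lsmul R X (t ^ l)) ≤ U.map (LinearMap.lsmul R X (t ^ k)) := by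
  rintro _ ⟨u, hu, rfl⟩
  obtain ⟨d, rfl⟩ := Nat.exists_eq_add_of_le h
  exact ⟨t ^ d • u, U.smul_mem _ hu, by simp only [LinearMap.lsmul_apply, smul_smul, pow_add]⟩

lemma ti_le (t : R) (U : Submodule R X) : ti t U ≤ U := by
  refine (iInf_le _ 0).trans ?_
  rintro _ ⟨u, hu, rfl⟩
  simpa using hu

lemma ti_mono (t : R) {U V : Submodule R X} (h : U ≤ V) : ti t U ≤ ti t V :=
  iInf_mono fun _ => Submodule.map_mono h

lemma ti_eq [IsArtinian R X] (t : R) (U : Submodule R X) : ∃ k, ∀ l, k ≤ l →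
    ti t U = U.map (LinearMap.lsmul R X (t ^ l)) := by
  obtain ⟨n, hn⟩ := IsArtinian.monotone_stabilizes (R := R) (M := X)
    ⟨fun k => OrderDual.toDual (U.map (LinearMap.lsmul R X (t ^ k))), fun k l h => map_pow_anti t U h⟩
  have hn' : ∀ m, n ≤ m → U.map (LinearMap.lsmul R X (t ^ n)) = U.map (LinearMap.lsmul R X (t ^ m)) :=
    fun m hm => hn m hm
  refine ⟨n, fun l hl => ?_⟩
  refine le_antisymm (iInf_le _ l) (le_iInf fun k => ?_)
  rw [← hn' l hl]
  rcases le_total n k with h | h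
  · rw [hn' k h]
  · exact map_pow_anti t U h

lemma ti_div [IsArtinian R X] (t : R) (U : Submodule R X) {x : X} (hx : x ∈ ti t U) :
    ∃ x' ∈ ti t U, t • x' = x := by
  obtain ⟨k, hk⟩ := ti_eq t U
  rw [hk (k+1) (by omega)] at hx
  obtain ⟨u, hu, rfl⟩ := hx
  refine ⟨t ^ k • u, ?_, by simp [pow_succ', mul_smul]⟩
  rw [hk k le_rfl]
  exact ⟨u, hu, rfl⟩

lemma ti_div_pow [IsArtinian R X] (t : R) (U : Submodule R X) (n : ℕ) : ∀ {x : X}, x ∈ ti t U →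
    ∃ x' ∈ ti t U, t ^ n • x' = x := by
  induction n with
  | zero => intro x hx; exact ⟨x, hx, by simp⟩
  | succ n ih =>
    intro x hx
    obtain ⟨x', hx', rfl⟩ := ti_div t U hx
    obtain ⟨x'', hx'', rfl⟩ := ih hx'
    exact ⟨x'', hx'', by rw [smul_smul, ← pow_succ']⟩

lemma fitting [IsArtinian R X] (t : R) (U : Submodule R X) : ∃ k, ∀ u ∈ U,
    ∃ v ∈ ti t U, ∃ w ∈ U, t ^ k • w = 0 ∧ u = v + w := by
  obtain ⟨k, hk⟩ := ti_eq t U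
  refine ⟨k, fun u hu => ?_⟩
  have h1 : t ^ k • u ∈ ti t U := by rw [hk k le_rfl]; exact ⟨u, hu, rfl⟩
  obtain ⟨v, hv, h2⟩ := ti_div_pow t U k h1
  exact ⟨v, hv, u - v, U.sub_mem hu (ti_le t U hv), by rw [smul_sub, h2, sub_self], by abel⟩

/-- Melkersson's lemma -/
lemma melkersson (t : R) (ht : ∀ x : X, ∃ n : ℕ, t ^ n • x = 0) (h : IsArtinian R (kt t X)) :
    IsArtinian R X := by
  rw [← monotone_stabilizes_iff_artinian]
  intro U
  let V : ℕ → Submodule R X := fun n => OrderDual.ofDual (U n)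
  have hV : ∀ {m n}, m ≤ n → V n ≤ V m := fun h => U.monotone h
  let I : ℕ → ℕ → Submodule R (kt t X) := fun k j =>
    ((V j).map (LinearMap.lsmul R X (t ^ k))).comap (kt t X).subtype
  have hI : ∀ {k k' j j'}, k ≤ k' → j ≤ j' → I k' j' ≤ I k j := by
    intro k k' j j' hk hj
    exact Submodule.comap_mono ((Submodule.map_mono (hV hj)).trans (map_pow_anti t _ hk))
  obtain ⟨_, ⟨⟨k0, j0⟩, rfl⟩, hmin⟩ := IsArtinian.set_has_minimal
    (Set.range fun q : ℕ × ℕ => I q.1 q.2) ⟨_, ⟨(0, 0), rfl⟩⟩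
  have h1 : ∀ k j, k0 ≤ k → j0 ≤ j → I k j = I k0 j0 := by
    intro k j hk hj
    by_contra hne
    exact hmin _ ⟨(k, j), rfl⟩ (lt_of_le_of_ne (hI hk hj) hne)
  have h2 : ∀ k, ∃ n, ∀ m, n ≤ m → I k n = I k m := fun k =>
    IsArtinian.monotone_stabilizes (R := R) (M := kt t X)
      ⟨fun j => OrderDual.toDual (I k j), fun j j' h => hI le_rfl h⟩
  choose n hn using h2
  let N := max j0 ((Finset.range k0).sup n)
  have h3 : ∀ k j, N ≤ j → I k N = I k j := by
    intro k j hj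
    rcases le_or_gt k0 k with h | h
    · rw [h1 k N h (le_max_left _ _), h1 k j h ((le_max_left _ _).trans hj)]
    · have : n k ≤ N := (Finset.le_sup (f := n) (Finset.mem_range.2 h)).trans (le_max_right _ _)
      rw [← hn k N this, ← hn k j (this.trans hj)]
  refine ⟨N, fun j hj => ?_⟩
  change V N = V j
  refine le_antisymm ?_ (hV hj)
  have key : ∀ m, ∀ u ∈ V N, t ^ m • u = 0 → u ∈ V j := by
    intro m
    induction m with
    | zero =>
      intro u hu h0
      rw [pow_zero, one_smul] at h0
      rw [h0]; exact zero_mem _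
    | succ m ih =>
      intro u hu h0
      have h4 : (⟨t ^ m • u, by rw [mem_kt, smul_smul, ← pow_succ', h0]⟩ : kt t X) ∈ I m N := ⟨u, hu, rfl⟩
      rw [h3 m j hj] at h4
      obtain ⟨u', hu', h5⟩ := h4
      have h6 := ih (u - u') (sub_mem hu (hV hj hu')) (by
        rw [smul_sub, sub_eq_zero]; exact h5.symm)
      simpa using add_mem h6 hu'
  intro u hu
  obtain ⟨m, hm⟩ := ht u
  exact key m u hu hm

/-- quotient lemma for cofiniteness -/
lemma sk_quot (S : Finset R) : ∀ (Z W : Type) [AddCommGroup Z] [Module R Z] [AddCommGroup W] [Module R W]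
    [IsArtinian R Z] (g : Z →ₗ[R] W), Function.Surjective g → IsNoetherian R (sk (S : Set R) Z) →
    IsNoetherian R (sk (S : Set R) W) := by
  classical
  induction S using Finset.induction with
  | empty =>
    intro Z W _ _ _ _ _ g hg h
    have h1 : IsNoetherian R Z := serre_noeth.inj
      (LinearMap.id.codRestrict (sk ((∅ : Finset R) : Set R) Z) (fun x r hr => by simp at hr))
      (fun x y h => congrArg Subtype.val h) h
    exact serre_noeth.sub _ (serre_noeth.surj g hg h1)
  | insert b T hb ih =>
    intro Z W _ _ _ _ _ g hg h
    obtain ⟨k, hk⟩ := fitting b (LinearMap.ker g)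
    let Z1 := kt (b ^ (k+1)) Z
    have hN : IsNoetherian R (sk (T : Set R) Z1) := by
      have h1 : IsNoetherian R (kt b (sk (T : Set R) Z1)) := by
        refine serre_noeth.inj (X := kt b (sk (T : Set R) Z1)) (Y := sk ((insert b T : Finset R) : Set R) Z)
          ((Z1.subtype ∘ₗ (sk (T : Set R) Z1).subtype ∘ₗ (kt b (sk (T : Set R) Z1)).subtype).codRestrict
            (sk ((insert b T : Finset R) : Set R) Z) ?_) ?_ h
        · intro x r hr
          rw [Finset.coe_insert] at hr
          rcases hr with rfl | hr
          · exact congrArg (fun z => ((z : Z1) : Z)) (congrArg Subtype.val x.2)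
          · exact congrArg Subtype.val (x.1.2 r hr)
        · intro x y h
          apply Subtype.ext
          apply Subtype.ext
          have h' := congrArg Subtype.val h
          exact Subtype.ext h'
      have h2 := serre_noeth.ktpow b h1 (k+1)
      refine serre_noeth.inj (X := sk (T : Set R) Z1) (Y := kt (b ^ (k+1)) (sk (T : Set R) Z1))
        (LinearMap.id.codRestrict (kt (b ^ (k+1)) (sk (T : Set R) Z1)) ?_)
        (fun x y h => congrArg Subtype.val h) h2
      intro x
      exact Subtype.ext (Subtype.ext x.1.2)
    have := ih Z1 (Z1.map g) (g.submoduleMap Z1) (g.submoduleMap_surjective Z1) hN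
    have hmem : ∀ w : sk ((insert b T : Finset R) : Set R) W, (w : W) ∈ Z1.map g := by
      rintro ⟨w, hw⟩
      obtain ⟨z, rfl⟩ := hg w
      have h1 : b • z ∈ LinearMap.ker g := by
        rw [LinearMap.mem_ker, _root_.map_smul]; exact hw b (by simp)
      obtain ⟨v, hv, w, hw, h2, h3⟩ := hk _ h1
      obtain ⟨v', hv', rfl⟩ := ti_div b _ hv
      refine ⟨z - v', ?_, ?_⟩
      · rw [SetLike.mem_coe, mem_kt, pow_succ, mul_smul, smul_sub, h3, add_sub_cancel_left, h2]
      · rw [_root_.map_sub, LinearMap.mem_ker.1 (ti_le _ _ hv'), sub_zero]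
    refine serre_noeth.inj
      ((((sk ((insert b T : Finset R) : Set R) W).subtype.codRestrict (Z1.map g) hmem)).codRestrict
        (sk (T : Set R) (Z1.map g)) ?_) ?_ this
    · intro w r hr
      exact Subtype.ext (w.2 r (by simp [hr]))
    · intro x y h
      exact Subtype.ext (congrArg (fun z => ((z : sk (T : Set R) (Z1.map g)) : Z1.map g).1) h)

/-- cofinite Artinian modules -/
def Cof (a : Ideal R) (V : Type) [AddCommGroup V] [Module R V] : Prop :=
  IsArtinian R V ∧ IsNoetherian R (sk (a : Set R) V)

lemma serre_cof [IsNoetherianRing R] (a : Ideal R) : Serre (R := R) (fun V _ _ => Cof a V) where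
  inj f hf h := by
    refine ⟨serre_art.inj f hf h.1, serre_noeth.inj
      (f.restrict (p := sk (a : Set R) _) (q := sk (a : Set R) _) ?_) ?_ h.2⟩
    · intro x hx r hr
      rw [← _root_.map_smul, hx r hr, _root_.map_zero]
    · intro x y h
      exact Subtype.ext (hf (congrArg Subtype.val h))
  surj f hf h := by
    refine ⟨serre_art.surj f hf h.1, ?_⟩
    obtain ⟨S, hS⟩ := (isNoetherianRing_iff_ideal_fg R).1 inferInstance a
    have h2 := h.2
    subst hS
    change IsNoetherian R (sk ((Ideal.span (S : Set R) : Ideal R) : Set R) _) at h2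
    change IsNoetherian R (sk ((Ideal.span (S : Set R) : Ideal R) : Set R) _)
    rw [sk_span] at h2 ⊢
    have := h.1
    exact sk_quot S _ _ f hf h2
  ext {X Y Z} _ _ _ _ _ _ f g hf hfg hg h1 h2 := by
    refine ⟨serre_art.ext f g hf hfg hg h1.1 h2.1, serre_noeth.mid
      (f.restrict (p := sk (a : Set R) X) (q := sk (a : Set R) Y) ?_)
      (g.restrict (p := sk (a : Set R) Y) (q := sk (a : Set R) Z) ?_) ?_ h1.2 h2.2⟩
    · intro x hx r hr
      rw [← _root_.map_smul, hx r hr, _root_.map_zero]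
    · intro x hx r hr
      rw [← _root_.map_smul, hx r hr, _root_.map_zero]
    · intro y
      constructor
      · intro hy
        obtain ⟨x, hx⟩ := (hfg y).1 (congrArg Subtype.val hy)
        refine ⟨⟨x, fun r hr => hf ?_⟩, Subtype.ext hx⟩
        rw [_root_.map_smul, hx, y.2 r hr, _root_.map_zero]
      · rintro ⟨x, rfl⟩
        exact Subtype.ext (hfg.apply_apply_eq_zero x.1)
  zero X _ _ h := ⟨inferInstance, inferInstance⟩

end serre
end LC

end

section
open CategoryTheory Abelian

namespace LC
set_option linter.unusedSectionVars false
set_option linter.unusedVariables false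

section nd
variable {R : Type} [CommRing R]
variable {X Y Z : Type} [AddCommGroup X] [Module R X] [AddCommGroup Y] [Module R Y]
  [AddCommGroup Z] [Module R Z]

/-- subquotient -/
abbrev sq (U V : Submodule R X) : Type := V ⧸ U.comap V.subtype

/-- map on subquotients -/
def sqm (f : X →ₗ[R] Y) {U V : Submodule R X} {U' V' : Submodule R Y} (hU : U ≤ U'.comap f)
    (hV : V ≤ V'.comap f) : sq U V →ₗ[R] sq U' V' :=
  Submodule.mapQ _ _ (f.restrict (p := V) (q := V') hV) (fun x hx => hU hx)

lemma sqm_mk (f : X →ₗ[R] Y) {U V : Submodule R X} {U' V' : Submodule R Y} (hU : U ≤ U'.comap f)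
    (hV : V ≤ V'.comap f) (x : V) :
    sqm f hU hV (Submodule.Quotient.mk x) = Submodule.Quotient.mk ⟨f x, hV x.2⟩ := rfl

/-- dual Krull dimension less than `d` -/
def ND (R : Type) [CommRing R] : ℕ → ∀ (V : Type) [AddCommGroup V] [Module R V], Prop
  | 0 => fun V _ _ => Subsingleton V
  | d + 1 => fun V _ _ => ∀ f : ℕ → Submodule R V, Monotone f → ∃ n, ∀ m, n ≤ m →
      ND R d (sq (f m) (f (m+1)))

lemma serre_nd (d : ℕ) : Serre (R := R) (fun V _ _ => ND R d V) := by
  induction d with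
  | zero =>
    refine ⟨?_, ?_, ?_, ?_⟩
    · intro X Y _ _ _ _ f hf h
      have : Subsingleton Y := h
      exact hf.subsingleton
    · intro X Y _ _ _ _ f hf h
      have : Subsingleton X := h
      exact hf.subsingleton
    · intro X Y Z _ _ _ _ _ _ f g hf hfg hg h1 h2
      have : Subsingleton X := h1
      have : Subsingleton Z := h2
      refine subsingleton_of_forall_eq 0 fun y => ?_
      obtain ⟨x, rfl⟩ := (hfg y).1 (Subsingleton.elim _ _)
      rw [Subsingleton.elim x 0, _root_.map_zero]
    · intro X _ _ h
      exact h
  | succ d ih =>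
    refine ⟨?_, ?_, ?_, ?_⟩
    · intro X Y _ _ _ _ f hf h A hA
      obtain ⟨n, hn⟩ := h (fun m => (A m).map f) (fun m m' h => Submodule.map_mono (hA h))
      refine ⟨n, fun m hm => ih.inj (sqm f (Submodule.le_comap_map f _) (Submodule.le_comap_map f _)) ?_
        (hn m hm)⟩
      rw [injective_iff_map_eq_zero]
      intro x hx
      obtain ⟨x, rfl⟩ := Submodule.mkQ_surjective _ x
      rw [Submodule.mkQ_apply, sqm_mk, Submodule.Quotient.mk_eq_zero] at hx
      obtain ⟨x', hx', h2⟩ := hx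
      rw [Submodule.mkQ_apply, Submodule.Quotient.mk_eq_zero]
      have := hf h2
      change (x : X) ∈ A m
      rw [← this]
      exact hx'
    · intro X Y _ _ _ _ f hf h A hA
      obtain ⟨n, hn⟩ := h (fun m => (A m).comap f) (fun m m' h => Submodule.comap_mono (hA h))
      refine ⟨n, fun m hm => ih.surj (sqm f le_rfl le_rfl) ?_ (hn m hm)⟩
      intro y
      obtain ⟨⟨y, hy⟩, rfl⟩ := Submodule.mkQ_surjective _ y
      obtain ⟨x, rfl⟩ := hf y
      exact ⟨Submodule.Quotient.mk ⟨x, hy⟩, rfl⟩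
    · intro X Y Z _ _ _ _ _ _ f g hf hfg hg h1 h2 A hA
      obtain ⟨n, hn⟩ := h1 (fun m => (A m).comap f) (fun m m' h => Submodule.comap_mono (hA h))
      obtain ⟨n', hn'⟩ := h2 (fun m => (A m).map g) (fun m m' h => Submodule.map_mono (hA h))
      refine ⟨max n n', fun m hm => ih.mid (sqm f le_rfl le_rfl)
        (sqm g (Submodule.le_comap_map g _) (Submodule.le_comap_map g _)) ?_
        (hn m ((le_max_left _ _).trans hm)) (hn' m ((le_max_right _ _).trans hm))⟩
      intro y
      constructor
      · intro hy
        obtain ⟨⟨y, hy1⟩, rfl⟩ := Submodule.mkQ_surjective _ y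
        rw [Submodule.mkQ_apply, sqm_mk, Submodule.Quotient.mk_eq_zero] at hy
        obtain ⟨y', hy', h3⟩ := hy
        obtain ⟨x, hx⟩ := (hfg (y - y')).1 (by rw [_root_.map_sub, sub_eq_zero]; exact h3.symm)
        have hx1 : f x ∈ A (m+1) := by
          rw [hx]; exact sub_mem hy1 (hA (Nat.le_succ m) hy')
        refine ⟨Submodule.Quotient.mk ⟨x, hx1⟩, ?_⟩
        rw [sqm_mk, Submodule.mkQ_apply, Submodule.Quotient.eq]
        change f x - y ∈ A m
        rw [hx]
        simpa using hy'
      · rintro ⟨x, rfl⟩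
        obtain ⟨⟨x, hx1⟩, rfl⟩ := Submodule.mkQ_surjective _ x
        rw [Submodule.mkQ_apply, sqm_mk, sqm_mk, Submodule.Quotient.mk_eq_zero]
        change g (f x) ∈ (A m).map g
        rw [hfg.apply_apply_eq_zero]
        exact zero_mem _
    · intro X _ _ h A hA
      refine ⟨0, fun m _ => ih.zero _ ?_⟩
      have : Subsingleton (A (m+1)) := inferInstance
      exact (Submodule.mkQ_surjective _).subsingleton

lemma nd_one_of_noeth (h : IsNoetherian R X) : ND R 1 X := by
  intro A hA
  obtain ⟨n, hn⟩ := monotone_stabilizes_iff_noetherian.2 h ⟨A, hA⟩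
  have hn' : ∀ m, n ≤ m → A n = A m := hn
  refine ⟨n, fun m hm => ?_⟩
  change Subsingleton _
  rw [Submodule.Quotient.subsingleton_iff, eq_top_iff]
  rintro ⟨x, hx⟩ _
  change x ∈ A m
  rwa [← hn' m hm, hn' (m+1) (by omega)]

lemma ND.succ {d : ℕ} : ∀ {X : Type} [AddCommGroup X] [Module R X], ND R d X → ND R (d+1) X := by
  induction d with
  | zero =>
    intro X _ _ h
    exact (serre_nd 1).zero X h
  | succ d ih =>
    intro X _ _ h A hA
    obtain ⟨n, hn⟩ := h A hA
    exact ⟨n, fun m hm => ih (hn m hm)⟩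

lemma ND.mono {d e : ℕ} (hde : d ≤ e) (h : ND R d X) : ND R e X := by
  induction hde with
  | refl => exact h
  | step _ ih => exact ih.succ

lemma nd_ker {d : ℕ} (h : ND R (d+1) X) (φ : Module.End R X) (hφ : Function.Surjective φ) :
    ND R d (LinearMap.ker φ) := by
  have hmono : Monotone (fun n => LinearMap.ker (φ ^ n)) := by
    refine monotone_nat_of_le_succ fun n x hx => ?_
    rw [LinearMap.mem_ker] at hx ⊢
    rw [pow_succ', Module.End.mul_apply, hx, _root_.map_zero]
  obtain ⟨n, hn⟩ := h _ hmono
  have hm : ∀ x ∈ LinearMap.ker (φ ^ (n+1)), (φ ^ n) x ∈ LinearMap.ker φ := by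
    intro x hx
    rw [LinearMap.mem_ker] at hx ⊢
    rwa [pow_succ', Module.End.mul_apply] at hx
  refine (serre_nd d).surj (Submodule.liftQ _ ((φ ^ n).restrict hm) ?_) ?_ (hn n le_rfl)
  · intro x hx
    exact Subtype.ext hx
  · rintro ⟨y, hy⟩
    have hs : Function.Surjective (φ ^ n) := by
      rw [Module.End.coe_pow]; exact hφ.iterate n
    obtain ⟨x, rfl⟩ := hs y
    refine ⟨Submodule.Quotient.mk ⟨x, ?_⟩, rfl⟩
    rw [LinearMap.mem_ker] at hy ⊢
    rwa [pow_succ', Module.End.mul_apply]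

lemma nd_tors [IsNoetherianRing R] (t : R) (d : ℕ) : ∀ (W : Type) [AddCommGroup W] [Module R W], IsArtinian R W →
    (∀ x : W, ∃ n : ℕ, t ^ n • x = 0) → ND R d (kt t W) → ND R (d+1) W := by
  induction d with
  | zero =>
    intro W _ _ _ ht h
    refine (serre_nd 1).zero W (subsingleton_of_forall_eq 0 fun x => ?_)
    obtain ⟨n, hn⟩ := ht x
    have : Subsingleton (kt t W) := h
    refine eq_zero_of_tors (t := t) (fun v hv => ?_) hn
    exact congrArg Subtype.val (Subsingleton.elim (⟨v, hv⟩ : kt t W) 0)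
  | succ d ih =>
    intro W _ _ hart ht h A hA
    have hL : Monotone fun j => (ti t (A j)).comap (kt t W).subtype :=
      fun i j hij => Submodule.comap_mono (ti_mono t (hA hij))
    obtain ⟨n, hn⟩ := h _ hL
    refine ⟨n, fun m hm => ?_⟩
    have hnm := hn m hm
    set U := A (m+1) with hU
    set V := A m with hV
    have hVU : V ≤ U := hA (Nat.le_succ m)
    -- the divisible part
    have hY : ND R (d+1) (sq (ti t V) (ti t U)) := by
      refine ih _ (serre_art.quot _ (serre_art.sub _ hart)) ?_ ?_
      · intro y
        obtain ⟨⟨y, hy⟩, rfl⟩ := Submodule.mkQ_surjective _ y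
        obtain ⟨n, hn⟩ := ht y
        refine ⟨n, ?_⟩
        rw [← _root_.map_smul]
        have : t ^ n • (⟨y, hy⟩ : ti t U) = 0 := Subtype.ext hn
        rw [this, _root_.map_zero]
      · let L : Submodule R W → Submodule R (kt t W) := fun V => (ti t V).comap (kt t W).subtype
        let F : sq (L V) (L U) →ₗ[R] sq (ti t V) (ti t U) :=
          sqm (kt t W).subtype le_rfl le_rfl
        refine (serre_nd d).surj (X := sq (L V) (L U)) (F.codRestrict (kt t (sq (ti t V) (ti t U))) ?_) ?_ hnm
        · intro x
          obtain ⟨⟨⟨x, hx⟩, hx1⟩, rfl⟩ := Submodule.mkQ_surjective _ x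
          rw [mem_kt, ← _root_.map_smul, ← _root_.map_smul]
          have : t • (⟨⟨x, hx⟩, hx1⟩ : L U) = 0 := Subtype.ext (Subtype.ext hx)
          rw [this, _root_.map_zero, _root_.map_zero]
        · rintro ⟨y, hy⟩
          obtain ⟨⟨y, hy1⟩, rfl⟩ := Submodule.mkQ_surjective _ y
          rw [mem_kt, ← _root_.map_smul, Submodule.mkQ_apply, Submodule.Quotient.mk_eq_zero] at hy
          change t • y ∈ ti t V at hy
          obtain ⟨z, hz, hzy⟩ := ti_div t V hy
          have h1 : y - z ∈ kt t W := by rw [mem_kt, smul_sub, hzy, sub_self]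
          have h2 : (⟨y - z, h1⟩ : kt t W) ∈ L U := sub_mem hy1 (ti_mono t hVU hz)
          refine ⟨Submodule.Quotient.mk ⟨⟨y - z, h1⟩, h2⟩, Subtype.ext ?_⟩
          change (Submodule.Quotient.mk (⟨y - z, _⟩ : ti t U) : sq (ti t V) (ti t U)) = Submodule.Quotient.mk _
          rw [Submodule.Quotient.eq]
          change y - z - y ∈ ti t V
          simpa using hz
    obtain ⟨k, hk⟩ := fitting t U
    have hK : ND R (d+1) (kt (t ^ k) U) := by
      refine (serre_nd (d+1)).inj (X := kt (t ^ k) U) (Y := kt (t ^ k) W)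
        (U.subtype.restrict (p := kt (t ^ k) U) (q := kt (t ^ k) W) ?_) ?_
        ((serre_nd (d+1)).ktpow t h k)
      · intro x hx
        exact congrArg Subtype.val hx
      · intro x y hxy
        have h' := congrArg Subtype.val hxy
        exact Subtype.ext (Subtype.ext h')
    have hfin : ∀ z : sq V U, ∃ (x : sq (ti t V) (ti t U)) (y : kt (t ^ k) U),
        sqm (LinearMap.id) (ti_le t V) (ti_le t U) x +
          ((V.comap U.subtype).mkQ ∘ₗ (kt (t ^ k) U).subtype) y = z := by
      intro z
      obtain ⟨⟨u, hu⟩, rfl⟩ := Submodule.mkQ_surjective _ z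
      obtain ⟨v, hv, w, hw, h0, h1⟩ := hk u hu
      refine ⟨Submodule.Quotient.mk ⟨v, hv⟩, ⟨⟨w, hw⟩, Subtype.ext h0⟩, ?_⟩
      have : (⟨u, hu⟩ : U) = ⟨v, ti_le t U hv⟩ + ⟨w, hw⟩ := Subtype.ext h1
      rw [this, _root_.map_add]
      rfl
    exact (serre_nd (d+1)).sup _ _ hfin hY hK

end nd
end LC

end

section
open CategoryTheory Abelian

namespace LC
set_option linter.unusedSectionVars false
set_option linter.unusedVariables false

section fin
variable {R : Type} [CommRing R] [IsNoetherianRing R]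
variable {X Y Z : Type} [AddCommGroup X] [Module R X] [AddCommGroup Y] [Module R Y]
  [AddCommGroup Z] [Module R Z]

lemma art_of_SD (X : Type) [AddCommGroup X] [Module R X] [Module.Finite R X] (h : SD R 1 X) :
    IsArtinian R X := by
  refine devissage (R := R) (fun X _ _ => IsArtinian R X) {p | Order.coheight p < ((1 : ℕ) : ℕ∞)} ?_ ?_ ?_ X h
  · intro X _ _ h
    infer_instance
  · intro p hp
    have h0 : Order.coheight p = 0 := by
      have : Order.coheight p < 1 := by exact_mod_cast hp
      simpa using this
    rw [Order.coheight_eq_zero, PrimeSpectrum.isMax_iff] at h0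
    have : IsSimpleModule R (R ⧸ p.asIdeal) := by
      rw [isSimpleModule_iff_isCoatom]
      exact h0.out
    infer_instance
  · intro X Y Z _ _ _ _ _ _ _ _ _ f g hf hfg hg _ h1 h2
    exact serre_art.ext f g hf hfg hg h1 h2

lemma max_of_pow_le {m : Ideal R} (hm : m.IsMaximal) {p : PrimeSpectrum R} {n : ℕ} (h : m ^ n ≤ p.asIdeal) :
    p.asIdeal = m := (hm.eq_of_le p.2.ne_top (p.2.le_of_pow_le h)).symm

lemma tors_fg {a : Ideal R} [IsNoetherian R X] (h : tors a X = ⊤) : ∃ n, a ^ n ≤ Module.annihilator R X := by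
  obtain ⟨n, hn⟩ := monotone_stabilizes_iff_noetherian.2 (inferInstance : IsNoetherian R X)
    ⟨fun n => sk ((a ^ n : Ideal R) : Set R) X, fun n m h => sk_anti (Ideal.pow_le_pow_right h)⟩
  have hn' : ∀ m, n ≤ m → sk ((a ^ n : Ideal R) : Set R) X = sk ((a ^ m : Ideal R) : Set R) X := hn
  refine ⟨n, fun r hr => Module.mem_annihilator.2 fun x => ?_⟩
  have hx : x ∈ tors a X := by rw [h]; trivial
  obtain ⟨k, hk⟩ := hx
  have : x ∈ sk ((a ^ (n + k) : Ideal R) : Set R) X := fun r hr =>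
    hk r (Ideal.pow_le_pow_right (by omega) hr)
  rw [← hn' (n+k) (by omega)] at this
  exact this r hr

lemma art_of_noeth_tors {m : Ideal R} (hm : m.IsMaximal) [IsNoetherian R X] (h : tors m X = ⊤) :
    IsArtinian R X := by
  obtain ⟨n, hn⟩ := tors_fg h
  refine art_of_SD X fun p hp => ?_
  rw [Module.mem_support_iff_of_finite] at hp
  have hpm := max_of_pow_le hm (hn.trans hp)
  have : Order.coheight p = 0 := by
    rw [Order.coheight_eq_zero, PrimeSpectrum.isMax_iff, hpm]; exact hm
  rw [this]
  simp

lemma noeth_of_art_max {m : Ideal R} (hm : m.IsMaximal) [IsArtinian R X] (h : ∀ r ∈ m, ∀ x : X, r • x = 0) :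
    IsNoetherian R X := by
  have ht : Module.IsTorsionBySet R X (m : Set R) := fun x r => h r.1 r.2 x
  letI : Module (R ⧸ m) X := ht.module
  letI : Field (R ⧸ m) := Ideal.Quotient.field m
  have : IsScalarTower R (R ⧸ m) X := Module.IsTorsionBySet.isScalarTower ht
  have h1 : IsArtinian (R ⧸ m) X := isArtinian_of_tower R inferInstance
  have h2 : IsNoetherian (R ⧸ m) X := by
    have : Module.Finite (R ⧸ m) X := by
      have := (IsSemisimpleModule.finite_tfae (R := R ⧸ m) (M := X)).out 0 2
      exact this.2 h1
    infer_instance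
  have h3 : Function.Surjective (Ideal.Quotient.mk m) := Ideal.Quotient.mk_surjective
  refine ⟨fun N => ?_⟩
  let N' : Submodule (R ⧸ m) X :=
    { N with
      smul_mem' := by
        intro c x hx
        obtain ⟨r, rfl⟩ := h3 c
        exact N.smul_mem r hx }
  obtain ⟨S, hS⟩ := h2.noetherian N'
  refine ⟨S, le_antisymm (Submodule.span_le.2 ?_) ?_⟩
  · intro x hx
    have : x ∈ N' := by rw [← hS]; exact Submodule.subset_span hx
    exact this
  · intro x hx
    have h4 : x ∈ N' := hx
    rw [← hS] at h4
    induction h4 using Submodule.span_induction with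
    | mem x h => exact Submodule.subset_span h
    | zero => exact zero_mem _
    | add x y hx' hy' h1 h2 =>
      have hx' : x ∈ N' := by rw [← hS]; exact hx'
      have hy' : y ∈ N' := by rw [← hS]; exact hy'
      exact add_mem (h1 hx') (h2 hy')
    | smul c x hx' h1 =>
      have hx' : x ∈ N' := by rw [← hS]; exact hx'
      obtain ⟨r, rfl⟩ := h3 c
      exact Submodule.smul_mem _ r (h1 hx')

lemma noeth_of_art_pow {m : Ideal R} (hm : m.IsMaximal) (n : ℕ) : ∀ (X : Type) [AddCommGroup X] [Module R X],
    IsArtinian R X → (∀ r ∈ m ^ n, ∀ x : X, r • x = 0) → IsNoetherian R X := by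
  induction n with
  | zero =>
    intro X _ _ _ h
    have : Subsingleton X := subsingleton_of_forall_eq 0 fun x => by
      simpa using h 1 (by simp) x
    infer_instance
  | succ n ih =>
    intro X _ _ hX h
    let U : Submodule R X := m • ⊤
    refine serre_noeth.ext U.subtype U.mkQ U.subtype_injective (LinearMap.exact_subtype_mkQ U)
      U.mkQ_surjective (ih U inferInstance ?_) (noeth_of_art_max hm ?_)
    · rintro r hr ⟨x, hx⟩
      apply Subtype.ext
      change r • x = 0
      induction hx using Submodule.smul_induction_on' with
      | smul s hs x hx =>
        rw [smul_smul]
        exact h _ (by rw [pow_succ]; exact Ideal.mul_mem_mul hr hs) x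
      | add x hx y hy h1 h2 => rw [smul_add, h1, h2, add_zero]
    · intro r hr x
      obtain ⟨x, rfl⟩ := U.mkQ_surjective x
      rw [← _root_.map_smul, Submodule.mkQ_apply, Submodule.Quotient.mk_eq_zero]
      exact Submodule.smul_mem_smul hr trivial

variable (a : Ideal R)

/-- auxiliary predicate -/
def CP (c : ℕ) (X : Type) [AddCommGroup X] [Module R X] : Prop := Cof a (HL a c X)

/-- auxiliary predicate -/
def MP (c : ℕ) (X : Type) [AddCommGroup X] [Module R X] : Prop :=
  IsArtinian R (HL a c X) ∧ ND R (c+1) (HL a c X)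

lemma HL_cof (c : ℕ) : ∀ (X : Type) [AddCommGroup X] [Module R X] [Module.Finite R X], SD R (c+1) X →
    Cof a (HL a c X) := by
  induction c with
  | zero =>
    intro X _ _ _ h
    have := art_of_SD X h
    have h1 : IsArtinian R (HL a 0 X) := isArtinian_of_injective (z0 a X) z0_inj
    have h2 : IsNoetherian R (HL a 0 X) := isNoetherian_of_injective (z0 a X) z0_inj
    exact ⟨h1, inferInstance⟩
  | succ c ih =>
    intro X _ _ _ h
    refine devissage (R := R) (fun X _ _ => CP a (c+1) X) {p | Order.coheight p < ((c+1+1 : ℕ) : ℕ∞)}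
      ?_ ?_ ?_ X h
    · intro X _ _ h
      exact (serre_cof a).zero _ (HL_subs a _ h)
    · intro p hp
      by_cases hap : a ≤ p.asIdeal
      · refine (serre_cof a).zero _ (HL_of_tors c _ (tors_top_of_ann a ?_))
        rwa [ann_quot_prime]
      · obtain ⟨t, hta, htp⟩ := Set.not_subset.1 hap
        have hSD : SD R (c+1+1) (R ⧸ p.asIdeal) := by
          intro q hq
          rw [mem_supp_quot] at hq
          exact lt_of_le_of_lt (Order.coheight_anti (a := p) (b := q) hq) hp
        have hinj := lsmul_inj_prime p.2 htp
        have h1 := ih _ (hSD.prime_drop htp)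
        have h2 : Cof a (kt t (HL a (c+1) (R ⧸ p.asIdeal))) := by
          have h3 := (serre_cof a).surj _ (LinearMap.surjective_rangeRestrict
            (delta a c hinj (LinearMap.exact_map_mkQ_range _) (Submodule.mkQ_surjective _))) h1
          rwa [← LinearMap.exact_iff.1 (tker a hinj)] at h3
        refine ⟨melkersson t (HL_pow_tors a hta) h2.1, ?_⟩
        have hle : ∀ x ∈ sk (a : Set R) (HL a (c+1) (R ⧸ p.asIdeal)),
          x ∈ kt t (HL a (c+1) (R ⧸ p.asIdeal)) := fun x hx => hx t hta
        refine serre_noeth.inj (Y := sk (a : Set R) (kt t (HL a (c+1) (R ⧸ p.asIdeal))))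
          ((Submodule.inclusion hle).codRestrict _ ?_) ?_ h2.2
        · intro x r hr
          exact Subtype.ext (x.2 r hr)
        · intro x y hxy
          have h' := congrArg Subtype.val hxy
          exact Submodule.inclusion_injective hle h'
    · intro X Y Z _ _ _ _ _ _ _ _ _ f g hf hfg hg _ h1 h2
      exact (serre_cof a).mid _ _ (exact_mid a (c+1) hf hfg hg) h1 h2

lemma HL_max {m : Ideal R} (hm : m.IsMaximal) (i : ℕ) : ∀ (X : Type) [AddCommGroup X] [Module R X]
    [Module.Finite R X], IsArtinian R (HL m i X) ∧ ND R (i+1) (HL m i X) := by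
  induction i with
  | zero =>
    intro X _ _ _
    have h1 : IsNoetherian R (HL m 0 X) := isNoetherian_of_injective (z0 m X) z0_inj
    refine ⟨art_of_noeth_tors hm ?_, nd_one_of_noeth h1⟩
    rw [eq_top_iff]
    intro x _
    exact HL_torsion x
  | succ i ih =>
    intro X _ _ _
    refine devissage (R := R) (fun X _ _ => MP m (i+1) X) Set.univ
      ?_ ?_ ?_ X (Set.subset_univ _)
    · intro X _ _ h
      exact ⟨serre_art.zero _ (HL_subs m _ h), (serre_nd _).zero _ (HL_subs m _ h)⟩
    · intro p hp
      by_cases hap : m ≤ p.asIdeal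
      · have : Subsingleton (HL m (i+1) (R ⧸ p.asIdeal)) := HL_of_tors i _ (tors_top_of_ann m (by
          rwa [ann_quot_prime]))
        exact ⟨serre_art.zero _ this, (serre_nd _).zero _ this⟩
      · obtain ⟨t, hta, htp⟩ := Set.not_subset.1 hap
        have hinj := lsmul_inj_prime p.2 htp
        have h1 := ih ((R ⧸ p.asIdeal) ⧸ LinearMap.range (LinearMap.lsmul R (R ⧸ p.asIdeal) t))
        have hex := LinearMap.exact_iff.1 (tker m (i := i) hinj)
        have h2 := serre_art.surj _ (LinearMap.surjective_rangeRestrict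
            (delta m i hinj (LinearMap.exact_map_mkQ_range _) (Submodule.mkQ_surjective _))) h1.1
        have h3 := (serre_nd _).surj _ (LinearMap.surjective_rangeRestrict
            (delta m i hinj (LinearMap.exact_map_mkQ_range _) (Submodule.mkQ_surjective _))) h1.2
        rw [← hex] at h2 h3
        have h4 := melkersson t (HL_pow_tors m hta) h2
        exact ⟨h4, nd_tors t _ _ h4 (HL_pow_tors m hta) h3⟩
    · intro X Y Z _ _ _ _ _ _ _ _ _ f g hf hfg hg _ h1 h2
      exact ⟨serre_art.mid _ _ (exact_mid m (i+1) hf hfg hg) h1.1 h2.1,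
        (serre_nd _).mid _ _ (exact_mid m (i+1) hf hfg hg) h1.2 h2.2⟩

lemma decomp {m : Ideal R} (hm : m.IsMaximal) [IsArtinian R X] (x : X) :
    ∃ u w : X, x = u + w ∧ u ∈ tors m X ∧ ∃ s ∉ m, s • w = 0 := by
  let N : ℕ → Submodule R X := fun k => m ^ k • Submodule.span R {x}
  have hN : ∀ {k l}, k ≤ l → N l ≤ N k := fun h => Submodule.smul_mono_left (Ideal.pow_le_pow_right h)
  obtain ⟨k, hk⟩ := IsArtinian.monotone_stabilizes (R := R) (M := X)
    ⟨fun k => OrderDual.toDual (N k), fun k l h => hN h⟩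
  have hk' : N k = N (k+1) := hk (k+1) (by omega)
  have hfg : (N k).FG := Submodule.FG.smul ((isNoetherianRing_iff_ideal_fg R).1 inferInstance _)
    (Submodule.fg_span_singleton x)
  obtain ⟨r, hr, h1⟩ := Submodule.exists_sub_one_mem_and_smul_eq_zero_of_fg_of_le_smul m (N k) hfg (by
    rw [hk']
    change m ^ (k+1) • Submodule.span R {x} ≤ m • (m ^ (k+1) • Submodule.span R {x})
    have h2 : m ^ (k+1) • Submodule.span R {x} = m ^ k • Submodule.span R {x} := hk'.symm
    conv_rhs => rw [h2]
    rw [← mul_smul, ← pow_succ'])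
  have hrm : r ∉ m := by
    intro h
    exact hm.ne_top ((Ideal.eq_top_iff_one _).2 (by simpa using sub_mem h hr))
  have hco : Ideal.span {r} ⊔ m ^ k = ⊤ := by
    have : Ideal.span {r} ⊔ m = ⊤ := by
      refine hm.1.2 _ (lt_of_le_of_ne le_sup_right ?_)
      intro h
      apply hrm
      rw [h]
      exact Ideal.mem_sup_left (Ideal.mem_span_singleton_self r)
    exact Ideal.sup_pow_eq_top this
  obtain ⟨_, hα, β, hβ, h3⟩ := Submodule.mem_sup.1 ((Ideal.eq_top_iff_one _).1 hco)
  obtain ⟨α, rfl⟩ := Ideal.mem_span_singleton'.1 hα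
  have hx : ∀ c ∈ m ^ k, r • c • x = 0 := fun c hc =>
    h1 _ (Submodule.smul_mem_smul hc (Submodule.mem_span_singleton_self x))
  refine ⟨(α * r) • x, β • x, by rw [← add_smul, h3, one_smul], ⟨k, fun c hc => ?_⟩, r, hrm, hx β hβ⟩
  rw [mul_smul, smul_comm, smul_comm c, hx c hc, smul_zero]

/-- unit-like behaviour on torsion elements -/
lemma tors_unit {m : Ideal R} (hm : m.IsMaximal) {x : X} (hx : x ∈ tors m X) {s : R} (hs : s ∉ m) :
    ∃ α : R, (α * s) • x = x := by
  obtain ⟨k, hk⟩ := hx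
  have hco : Ideal.span {s} ⊔ m ^ k = ⊤ := by
    have : Ideal.span {s} ⊔ m = ⊤ := by
      refine hm.1.2 _ (lt_of_le_of_ne le_sup_right ?_)
      intro h
      apply hs
      rw [h]
      exact Ideal.mem_sup_left (Ideal.mem_span_singleton_self s)
    exact Ideal.sup_pow_eq_top this
  obtain ⟨_, hα, β, hβ, h3⟩ := Submodule.mem_sup.1 ((Ideal.eq_top_iff_one _).1 hco)
  obtain ⟨α, rfl⟩ := Ideal.mem_span_singleton'.1 hα
  refine ⟨α, ?_⟩
  have := congrArg (· • x) h3
  simpa [add_smul, hk β hβ] using this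

lemma tors_zero {m : Ideal R} (hm : m.IsMaximal) {x : X} (hx : x ∈ tors m X) {s : R} (hs : s ∉ m)
    (h : s • x = 0) : x = 0 := by
  obtain ⟨α, hα⟩ := tors_unit hm hx hs
  rw [← hα, mul_smul, h, smul_zero]

lemma exists_max [IsArtinian R X] [Nontrivial X] : ∃ m : Ideal R, m.IsMaximal ∧ ∃ x : X, x ≠ 0 ∧
    ∀ r ∈ m, r • x = 0 := by
  obtain ⟨S, hS, _⟩ := (eq_bot_or_exists_atom_le (⊤ : Submodule R X)).resolve_left top_ne_bot
  have : IsSimpleModule R S := isSimpleModule_iff_isAtom.2 hS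
  obtain ⟨x, hx, hx0⟩ := Submodule.exists_mem_ne_zero_of_ne_bot hS.1
  refine ⟨Module.annihilator R S, IsSimpleModule.annihilator_isMaximal, x, hx0, fun r hr => ?_⟩
  exact congrArg Subtype.val (Module.mem_annihilator.1 hr ⟨x, hx⟩)

end fin
end LC

end

section
open CategoryTheory Abelian

namespace LC
set_option linter.unusedSectionVars false
set_option linter.unusedVariables false

section pprime
variable {R : Type} [CommRing R]
variable {X Y Z : Type} [AddCommGroup X] [Module R X] [AddCommGroup Y] [Module R Y]
  [AddCommGroup Z] [Module R Z]

lemma surj_desc (f : X →ₗ[R] Y) (hf : Function.Surjective f) (g : X →ₗ[R] Z)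
    (h : LinearMap.ker f ≤ LinearMap.ker g) : ∃ e : Y →ₗ[R] Z, ∀ x, e (f x) = g x := by
  refine ⟨(LinearMap.ker f).liftQ g h ∘ₗ (f.quotKerEquivOfSurjective hf).symm.toLinearMap, fun x => ?_⟩
  have h1 : (f.quotKerEquivOfSurjective hf).symm (f x) = Submodule.Quotient.mk x := by
    rw [LinearEquiv.symm_apply_eq]
    rfl
  rw [LinearMap.comp_apply, LinearEquiv.coe_coe, h1]
  rfl

variable [IsNoetherianRing R] (a : Ideal R)

lemma map_range_lsmul (c : ℕ) [Module.Finite R X] (hX : SD R (c+1) X) (r : R)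
    (x : HL a c (LinearMap.range (LinearMap.lsmul R X r))) :
    ∃ y : HL a c X, x = map a c (LinearMap.lsmul R X r).rangeRestrict y ∧
      map a c (LinearMap.range (LinearMap.lsmul R X r)).subtype x = r • y := by
  obtain ⟨y, rfl⟩ := map_surj a c hX (LinearMap.lsmul R X r).surjective_rangeRestrict x
  refine ⟨y, rfl, ?_⟩
  rw [← map_comp, ← map_lsmul]
  rfl

lemma ann_HL (c : ℕ) {r : R} (hr : r ∈ Module.annihilator R X) (h : HL a c X) : r • h = 0 := by
  rw [← map_lsmul]
  have : LinearMap.lsmul R X r = 0 := by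
    ext x
    exact Module.mem_annihilator.1 hr x
  rw [this, map_zero]

lemma pprime (c : ℕ) : ∀ (M V : Type) [AddCommGroup M] [Module R M] [Module.Finite R M] [AddCommGroup V]
    [Module R V] (g : HL a c M →ₗ[R] V), SD R (c+1) M → Function.Surjective g → ND R c V →
    Subsingleton V := by
  induction c with
  | zero =>
    intro M V _ _ _ _ _ g _ _ h
    exact h
  | succ c ih =>
    intro M V _ _ _ _ _ g hSD hg hV
    by_contra hsub
    obtain ⟨M', hM', hmax⟩ := set_has_maximal_iff_noetherian.2 (inferInstance : IsNoetherian R M)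
      {M' | ¬ Function.Surjective (g ∘ₗ map a (c+1) M'.subtype)} ⟨⊥, fun h => hsub (by
        have := HL_subs a (c+1) (X := (⊥ : Submodule R M)) (Submodule.subsingleton_iff_eq_bot.2 rfl)
        exact h.subsingleton)⟩
    have hmax' : ∀ X, M' < X → Function.Surjective (g ∘ₗ map a (c+1) X.subtype) := by
      intro X hX
      by_contra hh
      exact hmax X hh hX
    let W := LinearMap.range (g ∘ₗ map a (c+1) M'.subtype)
    have hW : W ≠ ⊤ := fun h => hM' (LinearMap.range_eq_top.1 h)
    have hV' : ND R (c+1) (V ⧸ W) := (serre_nd _).quot W hV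
    have hVn : Nontrivial (V ⧸ W) := Submodule.Quotient.nontrivial_iff.2 hW
    have hSDN : SD R (c+1+1) (M ⧸ M') := hSD.quot M'
    obtain ⟨g', hg'⟩ := surj_desc (map a (c+1) M'.mkQ) (map_surj a _ hSD M'.mkQ_surjective)
      (W.mkQ ∘ₗ g) (by
        intro x hx
        obtain ⟨y, rfl⟩ := (exact_mid a (c+1) M'.subtype_injective (LinearMap.exact_subtype_mkQ M')
          M'.mkQ_surjective x).1 hx
        rw [LinearMap.mem_ker, LinearMap.comp_apply, Submodule.mkQ_apply, Submodule.Quotient.mk_eq_zero]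
        exact ⟨y, rfl⟩)
    have hA : ∀ X : Submodule R (M ⧸ M'), X ≠ ⊥ → Function.Surjective (g' ∘ₗ map a (c+1) X.subtype) := by
      intro X hX v
      obtain ⟨v, rfl⟩ := W.mkQ_surjective v
      have hlt : M' < X.comap M'.mkQ := by
        refine lt_of_le_of_ne ?_ ?_
        · intro x hx
          have : M'.mkQ x = 0 := by rw [Submodule.mkQ_apply, Submodule.Quotient.mk_eq_zero]; exact hx
          rw [Submodule.mem_comap, this]
          exact zero_mem _
        · intro h
          apply hX
          rw [eq_bot_iff]
          intro x hx
          obtain ⟨x, rfl⟩ := M'.mkQ_surjective x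
          have : x ∈ M' := by rw [h]; exact hx
          rw [Submodule.mem_bot, Submodule.mkQ_apply, Submodule.Quotient.mk_eq_zero]
          exact this
      obtain ⟨h, rfl⟩ := hmax' _ hlt v
      let ρ : X.comap M'.mkQ →ₗ[R] X := M'.mkQ.restrict (fun x hx => hx)
      refine ⟨map a (c+1) ρ h, ?_⟩
      rw [LinearMap.comp_apply, ← map_comp]
      have : X.subtype ∘ₗ ρ = M'.mkQ ∘ₗ (X.comap M'.mkQ).subtype := rfl
      rw [this, map_comp, hg']
      rfl
    have hgs : Function.Surjective g' := by
      intro v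
      obtain ⟨v, rfl⟩ := W.mkQ_surjective v
      obtain ⟨h, rfl⟩ := hg v
      exact ⟨_, hg' h⟩
    have hB : ∀ r ∉ Module.annihilator R (M ⧸ M'), ∀ v : V ⧸ W, ∃ v', r • v' = v := by
      intro r hr v
      obtain ⟨x, rfl⟩ := hA (LinearMap.range (LinearMap.lsmul R (M ⧸ M') r)) (by
        intro h
        rw [LinearMap.range_eq_bot] at h
        exact hr (Module.mem_annihilator.2 fun x => LinearMap.congr_fun h x)) v
      obtain ⟨y, -, hy⟩ := map_range_lsmul a (c+1) hSDN r x
      refine ⟨g' y, ?_⟩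
      rw [LinearMap.comp_apply, hy, _root_.map_smul]
    have hprime : (Module.annihilator R (M ⧸ M')).IsPrime := by
      constructor
      · intro h
        obtain ⟨v, hv⟩ := exists_ne (0 : V ⧸ W)
        obtain ⟨x, rfl⟩ := hgs v
        apply hv
        have : (1 : R) • x = 0 := ann_HL a _ (by rw [h]; trivial) x
        rw [one_smul] at this
        rw [this, _root_.map_zero]
      · intro r s hrs
        by_contra hcon
        push Not at hcon
        obtain ⟨v, hv⟩ := exists_ne (0 : V ⧸ W)
        obtain ⟨v1, rfl⟩ := hB r hcon.1 v
        obtain ⟨v2, rfl⟩ := hB s hcon.2 v1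
        obtain ⟨x, rfl⟩ := hgs v2
        apply hv
        rw [smul_smul, ← _root_.map_smul, ann_HL a _ hrs, _root_.map_zero]
    have hVsub : ¬ Subsingleton (HL a (c+1) (M ⧸ M')) := fun h => by
      have := hgs.subsingleton
      exact not_nontrivial _ hVn
    have hale : ¬ a ≤ Module.annihilator R (M ⧸ M') := fun h =>
      hVsub (HL_of_tors c _ (tors_top_of_ann a h))
    obtain ⟨t, hta, htq⟩ := Set.not_subset.1 hale
    have htn : ∀ n, t ^ n ∉ Module.annihilator R (M ⧸ M') := fun n h => htq (hprime.mem_of_pow_mem n h)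
    have hinj : ∀ n, Function.Injective (LinearMap.lsmul R (M ⧸ M') (t ^ n)) := by
      intro n
      rw [← LinearMap.ker_eq_bot]
      by_contra hne
      have h1 := hA _ hne
      have hfin : Module.Finite R (LinearMap.ker (LinearMap.lsmul R (M ⧸ M') (t ^ n))) :=
        Module.IsNoetherian.finite R _
      have h2 : SD R (c+1) (LinearMap.ker (LinearMap.lsmul R (M ⧸ M') (t ^ n))) := by
        refine SD.drop hSDN hprime (htn n) ?_ ?_
        · exact LinearMap.annihilator_le_of_injective _ (Submodule.subtype_injective _)
        · rw [Module.mem_annihilator]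
          intro x
          exact Subtype.ext x.2
      have := vanish a (c+1) _ h2
      have := h1.subsingleton
      exact not_nontrivial _ hVn
    obtain ⟨v, hv⟩ := exists_ne (0 : V ⧸ W)
    obtain ⟨h, rfl⟩ := hgs v
    obtain ⟨n, hn⟩ := HL_pow_tors a hta h
    obtain ⟨u, hu⟩ := (tker a (hinj n) h).1 hn
    let φ := g' ∘ₗ (delta a c (hinj n) (LinearMap.exact_map_mkQ_range _) (Submodule.mkQ_surjective _))
    have hle : LinearMap.range φ ≤ LinearMap.ker (LinearMap.lsmul R (V ⧸ W) (t ^ n)) := by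
      rintro _ ⟨x, rfl⟩
      have h3 := (tker a (hinj n) _).2 ⟨x, rfl⟩
      rw [LinearMap.lsmul_apply] at h3
      rw [LinearMap.mem_ker, LinearMap.lsmul_apply, LinearMap.comp_apply, ← _root_.map_smul, h3, _root_.map_zero]
    have hND : ND R c (LinearMap.range φ) := (serre_nd c).le hle (nd_ker hV' _ (hB _ (htn n)))
    have hz := ih _ _ φ.rangeRestrict (SD.drop hSDN hprime (htn n) (ann_le_quot _) (t_ann_quot _))
      φ.surjective_rangeRestrict hND
    apply hv
    have : φ u = 0 := congrArg Subtype.val (Subsingleton.elim (φ.rangeRestrict u) 0)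
    rw [← this, ← hu]
    rfl

end pprime
end LC

end

section
open CategoryTheory Abelian

namespace LC
set_option linter.unusedSectionVars false
set_option linter.unusedVariables false

section a7
variable {R : Type} [CommRing R] [IsNoetherianRing R]

lemma sk_pow_noeth (a : Ideal R) {V : Type} [AddCommGroup V] [Module R V] (h : IsNoetherian R (sk (a : Set R) V))
    (n : ℕ) : IsNoetherian R (sk ((a ^ n : Ideal R) : Set R) V) := by
  obtain ⟨S, hS⟩ := (isNoetherianRing_iff_ideal_fg R).1 inferInstance a
  induction n with
  | zero =>
    have : Subsingleton (sk ((a ^ 0 : Ideal R) : Set R) V) := subsingleton_of_forall_eq 0 fun x =>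
      Subtype.ext (by simpa using x.2 1 (by simp))
    exact serre_noeth.zero _ this
  | succ n ih =>
    let g : sk ((a ^ (n+1) : Ideal R) : Set R) V →ₗ[R] (S → sk ((a ^ n : Ideal R) : Set R) V) :=
      LinearMap.pi fun s => (LinearMap.lsmul R V s.1).restrict (by
        intro x hx r hr
        rw [LinearMap.lsmul_apply, smul_smul]
        refine hx _ ?_
        rw [pow_succ]
        exact Ideal.mul_mem_mul hr (by rw [← hS]; exact Ideal.subset_span s.2))
    have hle : sk (a : Set R) V ≤ sk ((a ^ (n+1) : Ideal R) : Set R) V :=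
      sk_anti (Ideal.pow_le_self (by omega))
    refine serre_noeth.mid (X := sk (a : Set R) V) (Z := S → sk ((a ^ n : Ideal R) : Set R) V)
      (Submodule.inclusion hle) g ?_ h isNoetherian_pi
    intro x
    constructor
    · intro hx
      refine ⟨⟨x.1, ?_⟩, rfl⟩
      have h1 : x.1 ∈ sk (S : Set R) V := fun s hs => congrArg Subtype.val (congrFun hx ⟨s, hs⟩)
      rw [← sk_span] at h1
      have h2 : Ideal.span (S : Set R) = a := hS
      intro r hr
      exact h1 r (by rw [h2]; exact hr)
    · rintro ⟨z, rfl⟩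
      funext s
      exact Subtype.ext (z.2 s.1 (by rw [← hS]; exact Ideal.subset_span s.2))

lemma theta_A7 {m : Ideal R} (hm : m.IsMaximal) (c : ℕ) (X : Type) [AddCommGroup X] [Module R X]
    [Module.Finite R X] (hX : SD R (c+1) X) (T : Finset R) : ∀ (a : Ideal R) (ham : a ≤ m),
    a ⊔ Ideal.span (T : Set R) = m →
    (∀ x ∈ tors m (HL a c X), ∃ y, theta c X ham y = x) ∧
    (∀ (Q : Type) [AddCommGroup Q] [Module R Q] (f : LinearMap.ker (theta c X ham) →ₗ[R] Q),
      Function.Surjective f → Cof a Q → Subsingleton Q) := by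
  classical
  induction T using Finset.induction_on with
  | empty =>
    intro a ham h
    have : a = m := by simpa using h
    subst this
    refine ⟨fun x hx => ⟨x, theta_self _ x⟩, fun Q _ _ f hf _ => ?_⟩
    have : Subsingleton (LinearMap.ker (theta c X ham)) := subsingleton_of_forall_eq 0 fun x => by
      have := x.2
      rw [LinearMap.mem_ker, theta_self] at this
      exact Subtype.ext this
    exact hf.subsingleton
  | insert y T hyT ih =>
    intro a ham h
    have h' : (a ⊔ Ideal.span {y}) ⊔ Ideal.span (T : Set R) = m := by
      rw [← h, Finset.coe_insert, Ideal.span_insert, sup_assoc]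
    have ha'm : a ⊔ Ideal.span {y} ≤ m := by rw [← h']; exact le_sup_left
    have hym : y ∈ m := ha'm (Ideal.mem_sup_right (Ideal.mem_span_singleton_self y))
    obtain ⟨ih1, ih2⟩ := ih _ ha'm h'
    have hart : IsArtinian R (HL (a ⊔ Ideal.span {y}) c X) := (HL_cof _ c X hX).1
    have htt : ∀ z : HL m c X, theta c X (le_sup_left : a ≤ a ⊔ Ideal.span {y}) (theta c X ha'm z) =
      theta c X ham z := fun z => theta_theta _ _ z
    refine ⟨fun x hx => ?_, fun Q _ _ f hf hQ => ?_⟩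
    · obtain ⟨k, hk⟩ := hx
      obtain ⟨h1, hh1⟩ := theta_r a y c X x k (hk _ (Ideal.pow_mem_pow hym k))
      obtain ⟨u, w, huw, hu, s, hs, hsw⟩ := decomp hm h1
      obtain ⟨z, hz⟩ := ih1 u hu
      refine ⟨z, ?_⟩
      have hw : theta c X (le_sup_left : a ≤ a ⊔ Ideal.span {y}) w = 0 := by
        refine tors_zero hm (s := s) ?_ hs (by rw [← _root_.map_smul, hsw, _root_.map_zero])
        have : theta c X (le_sup_left : a ≤ a ⊔ Ideal.span {y}) w =
          x - theta c X (le_sup_left : a ≤ a ⊔ Ideal.span {y}) u := by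
          rw [← hh1, huw, _root_.map_add]; abel
        rw [this]
        exact sub_mem ⟨k, hk⟩ (tors_map _ hu)
      rw [← htt, hz, ← hh1, huw, _root_.map_add, hw, add_zero]
    · have hle : LinearMap.ker (theta c X ha'm) ≤ LinearMap.ker (theta c X ham) := by
        intro z hz
        rw [LinearMap.mem_ker] at hz ⊢
        rw [← htt, hz, _root_.map_zero]
      have hf0 : ∀ z (hz : z ∈ LinearMap.ker (theta c X ha'm)), f ⟨z, hle hz⟩ = 0 := by
        let φ := f ∘ₗ Submodule.inclusion hle
        have hc := (serre_cof a).sub (LinearMap.range φ) hQ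
        have hc' : Cof (a ⊔ Ideal.span {y}) (LinearMap.range φ) :=
          ⟨hc.1, serre_noeth.le (sk_anti (fun r hr => Ideal.mem_sup_left hr)) hc.2⟩
        have := ih2 _ φ.rangeRestrict φ.surjective_rangeRestrict hc'
        intro z hz
        exact congrArg Subtype.val (Subsingleton.elim (φ.rangeRestrict ⟨z, hz⟩) 0)
      refine subsingleton_of_forall_eq 0 fun q => ?_
      obtain ⟨x, rfl⟩ := hf q
      obtain ⟨K, hxK, hKle, ⟨n, hn⟩, hdiv⟩ := theta_k a y c X (theta c X ha'm x.1) (by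
        rw [htt]; exact x.2)
      let M1 : Submodule R (LinearMap.ker (theta c X ham)) :=
        K.comap (theta c X ha'm ∘ₗ (LinearMap.ker (theta c X ham)).subtype)
      let Q1 := M1.map f
      have hQ1 : Q1 ≤ sk ((a ^ n : Ideal R) : Set R) Q := by
        rintro _ ⟨x1, hx1, rfl⟩ r hr
        rw [← _root_.map_smul]
        refine hf0 _ ?_
        rw [LinearMap.mem_ker]
        change theta c X ha'm (r • x1.1) = 0
        rw [_root_.map_smul]
        exact hn r hr _ hx1
      have hQn : IsNoetherian R Q1 := serre_noeth.le hQ1 (sk_pow_noeth a hQ.2 n)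
      have hsurj : Function.Surjective (LinearMap.lsmul R Q1 y) := by
        rintro ⟨_, ⟨x1, hx1, rfl⟩⟩
        obtain ⟨k', hk', hyk⟩ := hdiv _ hx1
        obtain ⟨u, w, huw, hu, s, hs, hsw⟩ := decomp hm k'
        have hyk2 : y • u + y • w = theta c X ha'm x1.1 := by rw [← smul_add, ← huw]; exact hyk
        have hyw : y • w = 0 := by
          refine tors_zero hm (s := s) ?_ hs (by rw [smul_comm, hsw, smul_zero])
          have : y • w = theta c X ha'm x1.1 - y • u := by rw [← hyk2]; abel
          rw [this]
          refine sub_mem (tors_map _ ?_) (Submodule.smul_mem _ _ hu)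
          exact HL_torsion x1.1
        have huK : u ∈ K := by
          obtain ⟨α, hα⟩ := tors_unit hm hu hs
          have : u = α • s • k' := by
            rw [huw, smul_add, hsw, add_zero, smul_smul, hα]
          rw [this]
          exact K.smul_mem _ (K.smul_mem _ hk')
        obtain ⟨z, hz⟩ := ih1 u hu
        have hzk : z ∈ LinearMap.ker (theta c X ham) := by
          rw [LinearMap.mem_ker, ← htt, hz]
          exact hKle huK
        have hzM : (⟨z, hzk⟩ : LinearMap.ker (theta c X ham)) ∈ M1 := by
          change theta c X ha'm z ∈ K
          rw [hz]; exact huK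
        refine ⟨⟨f ⟨z, hzk⟩, ⟨_, hzM, rfl⟩⟩, Subtype.ext ?_⟩
        change y • f ⟨z, hzk⟩ = f x1
        have h4 := hf0 (x1.1 - y • z) (by
          rw [LinearMap.mem_ker, _root_.map_sub, _root_.map_smul, hz, ← hyk2, hyw]; abel)
        have h5 : f (x1 - y • ⟨z, hzk⟩) = 0 := h4
        rw [_root_.map_sub, _root_.map_smul, sub_eq_zero] at h5
        exact h5.symm
      have hinj := IsNoetherian.injective_of_surjective_endomorphism _ hsurj
      obtain ⟨k, hk⟩ := HL_pow_tors m hym x.1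
      have hq : (⟨f x, ⟨x, hxK, rfl⟩⟩ : Q1) = 0 := by
        refine eq_zero_of_tors (t := y) (n := k) ?_ ?_
        · intro v hv
          exact hinj (by rw [LinearMap.lsmul_apply, hv, _root_.map_zero])
        · apply Subtype.ext
          change y ^ k • f x = 0
          have : y ^ k • x = 0 := Subtype.ext hk
          rw [← _root_.map_smul, this, _root_.map_zero]
      exact congrArg Subtype.val hq

lemma theta_fin {m : Ideal R} (hm : m.IsMaximal) (c : ℕ) (X : Type) [AddCommGroup X] [Module R X]
    [Module.Finite R X] (hX : SD R (c+1) X) (a : Ideal R) (ham : a ≤ m) :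
    (∀ x ∈ tors m (HL a c X), ∃ y, theta c X ham y = x) ∧
    (∀ (Q : Type) [AddCommGroup Q] [Module R Q] (f : LinearMap.ker (theta c X ham) →ₗ[R] Q),
      Function.Surjective f → Cof a Q → Subsingleton Q) := by
  obtain ⟨S, hS⟩ := (isNoetherianRing_iff_ideal_fg R).1 inferInstance m
  exact theta_A7 hm c X hX S a ham (by
    have : Ideal.span (S : Set R) = m := hS
    rw [this]; exact sup_eq_right.2 ham)

end a7
end LC

end

section
open CategoryTheory Abelian

namespace LC
set_option linter.unusedSectionVars false
set_option linter.unusedVariables false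

section hull
variable {R : Type} [CommRing R] 

lemma zorn_sub {M : Type} [AddCommGroup M] [Module R M] (P : Submodule R M → Prop)
    (hP : ∀ (c : Set (Submodule R M)), c ⊆ {N | P N} → IsChain (· ≤ ·) c → c.Nonempty → P (sSup c))
    (N0 : Submodule R M) (h0 : P N0) :
    ∃ N, P N ∧ N0 ≤ N ∧ ∀ N', P N' → N ≤ N' → N' = N := by
  obtain ⟨N, hle, hN⟩ := zorn_le_nonempty₀ {N | P N} (fun c hc hchain y hy =>
    ⟨sSup c, hP c hc hchain ⟨y, hy⟩, fun z hz => le_sSup hz⟩) N0 h0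
  exact ⟨N, hN.1, hle, fun N' h' hl => le_antisymm (hN.2 h' hl) hl⟩

lemma mem_sSup_chain {M : Type} [AddCommGroup M] [Module R M] {c : Set (Submodule R M)}
    (hc : IsChain (· ≤ ·) c) (hne : c.Nonempty) {x : M} : x ∈ sSup c ↔ ∃ N ∈ c, x ∈ N :=
  Submodule.mem_sSup_of_directed hne hc.directedOn

variable [IsNoetherianRing R]

lemma soc_smul {m : Ideal R} (hm : m.IsMaximal) {M : Type} [AddCommGroup M] [Module R M] {x : M}
    (hx : x ∈ sk (m : Set R) M) {r : R} (hr : r • x ≠ 0) : ∃ s : R, s • r • x = x := by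
  have hrm : r ∉ m := fun h => hr (hx r h)
  obtain ⟨α, hα⟩ := tors_unit hm (x := x) ⟨1, fun r hr => hx r (by simpa using hr)⟩ hrm
  exact ⟨α, by rw [smul_smul, hα]⟩

lemma exists_soc {m : Ideal R} {M : Type} [AddCommGroup M] [Module R M] {x : M}
    (hx : x ∈ tors m M) (hx0 : x ≠ 0) : ∃ r : R, r • x ≠ 0 ∧ r • x ∈ sk (m : Set R) M := by
  classical
  obtain ⟨n, hn⟩ := hx
  have hex : ∃ n, ∀ r ∈ m ^ n, r • x = 0 := ⟨n, hn⟩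
  have h1 := Nat.find_spec hex
  have h2 : Nat.find hex ≠ 0 := by
    intro h
    rw [h] at h1
    exact hx0 (by simpa using h1 1 (by simp))
  obtain ⟨k, hk⟩ := Nat.exists_eq_succ_of_ne_zero h2
  have h3 := Nat.find_min hex (m := k) (by omega)
  push Not at h3
  obtain ⟨r, hr, hrx⟩ := h3
  refine ⟨r, hrx, fun s hs => ?_⟩
  rw [smul_smul]
  refine h1 _ ?_
  rw [hk, pow_succ']
  exact Ideal.mul_mem_mul hs hr

lemma inj_of_retract {E I : Type} [AddCommGroup E] [Module R E] [AddCommGroup I] [Module R I]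
    [hI : Module.Injective R I] (f : E →ₗ[R] I) (g : I →ₗ[R] E) (h : ∀ x, g (f x) = x) :
    Module.Injective R E := by
  refine ⟨fun X Y _ _ _ _ i hi φ => ?_⟩
  obtain ⟨e, he⟩ := hI.out i hi (f ∘ₗ φ)
  exact ⟨g ∘ₗ e, fun x => by rw [LinearMap.comp_apply, he, LinearMap.comp_apply, h]⟩

lemma exists_hull_aux {m : Ideal R} (hm : m.IsMaximal) {T : Type} [AddCommGroup T] [Module R T]
    [hTi : Module.Injective R T] (hT : tors m T = ⊤) (e : T) (he0 : e ≠ 0) (hem : ∀ r ∈ m, r • e = 0) :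
    ∃ (E : Submodule R T), Module.Injective R E ∧ e ∈ E ∧ 
      ∀ x ∈ E, x ∈ sk (m : Set R) T → ∃ r : R, x = r • e := by
  obtain ⟨E, hE, hle, hmax⟩ := zorn_sub (fun N : Submodule R T => ∀ x ∈ N, x ∈ sk (m : Set R) T → ∃ r : R, x = r • e)
    (by
      intro c hc hch hne x hx hxs
      rw [mem_sSup_chain hch hne] at hx
      obtain ⟨N, hN, hx⟩ := hx
      exact hc hN x hx hxs) (Submodule.span R {e}) (by
      intro x hx _
      obtain ⟨r, rfl⟩ := Submodule.mem_span_singleton.1 hx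
      exact ⟨r, rfl⟩)
  have heE : e ∈ E := hle (Submodule.mem_span_singleton_self e)
  refine ⟨E, ?_, heE, hE⟩
  obtain ⟨M0, hM0, -, hmax0⟩ := zorn_sub (fun N : Submodule R T => ∀ x ∈ N, x ∈ E → x = 0)
    (by
      intro c hc hch hne x hx hxs
      rw [mem_sSup_chain hch hne] at hx
      obtain ⟨N, hN, hx⟩ := hx
      exact hc hN x hx hxs) ⊥ (fun x hx _ => hx)
  -- essentiality
  have hess : ∀ t : T, t ∉ M0 → ∃ r : R, ∃ z ∈ M0, r • t + z ∈ E ∧ r • t + z ≠ 0 := by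
    intro t ht
    by_contra hcon
    push Not at hcon
    have := hmax0 (M0 ⊔ Submodule.span R {t}) (by
      intro x hx hxE
      obtain ⟨z, hz, w, hw, rfl⟩ := Submodule.mem_sup.1 hx
      obtain ⟨r, rfl⟩ := Submodule.mem_span_singleton.1 hw
      rw [add_comm] at hxE ⊢
      exact hcon r z hz hxE) le_sup_left
    apply ht
    rw [← this]
    exact Submodule.mem_sup_right (Submodule.mem_span_singleton_self t)
  obtain ⟨ψ, hψ⟩ := inj_ext (M0.mkQ ∘ₗ E.subtype) E.subtype (by
    intro x hx
    rw [LinearMap.mem_ker, LinearMap.comp_apply, Submodule.mkQ_apply, Submodule.Quotient.mk_eq_zero] at hx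
    exact hM0 _ hx x.2)
  let π := ψ ∘ₗ M0.mkQ
  have hπ : ∀ x ∈ E, π x = x := fun x hx => hψ ⟨x, hx⟩
  have hπ0 : ∀ x ∈ M0, π x = 0 := fun x hx => by
    have : M0.mkQ x = 0 := by rw [Submodule.mkQ_apply, Submodule.Quotient.mk_eq_zero]; exact hx
    rw [LinearMap.comp_apply, this, _root_.map_zero]
  have hr : LinearMap.range π = E := by
    refine hmax _ ?_ fun x hx => ⟨x, hπ x hx⟩
    rintro _ ⟨x, rfl⟩ hxs
    by_cases hx : π x = 0
    · exact ⟨0, by rw [hx, zero_smul]⟩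
    have hxM : x ∉ M0 := fun h => hx (hπ0 x h)
    obtain ⟨r, z, hz, hE1, hne⟩ := hess x hxM
    have h1 : r • π x = r • x + z := by
      have := hπ _ hE1
      rwa [_root_.map_add, _root_.map_smul, hπ0 z hz, add_zero] at this
    obtain ⟨s, hs⟩ := soc_smul hm hxs (r := r) (by rw [h1]; exact hne)
    refine hE _ ?_ hxs
    rw [← hs, h1]
    exact E.smul_mem _ hE1
  exact inj_of_retract E.subtype (π.codRestrict E (fun x => by rw [← hr]; exact ⟨x, rfl⟩))
    (fun x => Subtype.ext (hπ x.1 x.2))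

lemma exists_hull {m : Ideal R} (hm : m.IsMaximal) : ∃ (E : Type) (_ : AddCommGroup E) (_ : Module R E),
    Module.Injective R E ∧ tors m E = ⊤ ∧ ∃ e0 : E, e0 ≠ 0 ∧ (∀ r ∈ m, r • e0 = 0) ∧
      ∀ x ∈ sk (m : Set R) E, ∃ r : R, x = r • e0 := by
  obtain ⟨I, _, _, f, hI, hf⟩ := exists_inj (R := R) (R ⧸ m)
  have hE1 : Module.Injective R (tors m I) := inj_tors m
  have hone : ∀ r ∈ m, r • f (Submodule.Quotient.mk 1) = 0 := by
    intro r hr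
    rw [← _root_.map_smul, ← Submodule.Quotient.mk_smul, smul_eq_mul, mul_one,
      (Submodule.Quotient.mk_eq_zero m).2 hr, _root_.map_zero]
  have he1 : f (Submodule.Quotient.mk 1) ≠ 0 := by
    intro h
    rw [← _root_.map_zero f] at h
    have := (Submodule.Quotient.mk_eq_zero m).1 (hf h)
    exact hm.ne_top ((Ideal.eq_top_iff_one _).2 this)
  let e : tors m I := ⟨f (Submodule.Quotient.mk 1), ⟨1, fun r hr => hone r (by simpa using hr)⟩⟩
  have he0 : e ≠ 0 := fun h => he1 (congrArg Subtype.val h)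
  have hem : ∀ r ∈ m, r • e = 0 := fun r hr => Subtype.ext (hone r hr)
  have hT : tors m (tors m I) = ⊤ := by
    rw [eq_top_iff]
    rintro ⟨x, n, hx⟩ _
    exact ⟨n, fun r hr => Subtype.ext (hx r hr)⟩
  obtain ⟨E, hE, heE, hs⟩ := exists_hull_aux hm hT e he0 hem
  refine ⟨E, inferInstance, inferInstance, hE, ?_, ⟨e, heE⟩, fun h => he0 (congrArg Subtype.val h),
    fun r hr => Subtype.ext (hem r hr), ?_⟩
  · rw [eq_top_iff]
    rintro ⟨⟨x, n, hx⟩, _⟩ _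
    exact ⟨n, fun r hr => Subtype.ext (Subtype.ext (hx r hr))⟩
  · intro x hx
    obtain ⟨r, hr⟩ := hs x.1 x.2 (fun r hr => congrArg Subtype.val (hx r hr))
    exact ⟨r, Subtype.ext hr⟩


section endo
variable {E : Type} [AddCommGroup E] [Module R E] [Module.Injective R E] {m : Ideal R} {e0 : E}

lemma end_scalar (he : ∀ r ∈ m, r • e0 = 0)
    (hs : ∀ x ∈ sk (m : Set R) E, ∃ r : R, x = r • e0) (k : ℕ) : ∀ φ : Module.End R E,
    ∃ r : R, ∀ x ∈ sk ((m ^ k : Ideal R) : Set R) E, φ x = r • x := by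
  classical
  induction k with
  | zero =>
    intro φ
    refine ⟨0, fun x hx => ?_⟩
    have : x = 0 := by simpa using hx 1 (by simp)
    rw [this, _root_.map_zero, smul_zero]
  | succ k ih =>
    intro φ
    obtain ⟨r, hr⟩ := ih φ
    obtain ⟨S, hS⟩ := (isNoetherianRing_iff_ideal_fg R).1 inferInstance (m ^ k)
    have hS' : Ideal.span (S : Set R) = m ^ k := hS
    let F : sk ((m ^ (k+1) : Ideal R) : Set R) E →ₗ[R] (S → E) :=
      LinearMap.pi fun s => LinearMap.lsmul R E s.1 ∘ₗ Submodule.subtype _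
    obtain ⟨g, hg⟩ := inj_ext F ((φ - LinearMap.lsmul R E r) ∘ₗ Submodule.subtype _) (by
      intro x hx
      have h1 : x.1 ∈ sk (S : Set R) E := fun s hs => congrFun hx ⟨s, hs⟩
      rw [← sk_span, hS'] at h1
      change φ x.1 - r • x.1 = 0
      rw [hr _ h1, sub_self])
    have hρ : ∀ s : S, ∃ ρ : R, g (LinearMap.single R (fun _ : S => E) s e0) = ρ • e0 := by
      intro s
      refine hs _ fun r hr => ?_
      rw [← _root_.map_smul, ← _root_.map_smul, he r hr, _root_.map_zero, _root_.map_zero]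
    choose ρ hρ using hρ
    refine ⟨r + ∑ s : S, ρ s * s.1, fun x hx => ?_⟩
    have h2 := hg ⟨x, hx⟩
    change g (F ⟨x, hx⟩) = φ x - r • x at h2
    rw [add_smul, ← sub_eq_iff_eq_add', ← h2, Finset.sum_smul]
    have h3 : F ⟨x, hx⟩ = ∑ s : S, LinearMap.single R (fun _ : S => E) s (s.1 • x) := by
      exact (LinearMap.sum_single_apply (fun _ : S => E) (F ⟨x, hx⟩)).symm
    rw [h3, _root_.map_sum]
    refine Finset.sum_congr rfl fun s _ => ?_
    obtain ⟨q, hq⟩ := hs (s.1 • x) (by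
      intro r hr
      rw [smul_smul]
      refine hx _ ?_
      rw [pow_succ']
      exact Ideal.mul_mem_mul hr (by rw [← hS']; exact Ideal.subset_span s.2))
    rw [mul_smul, hq, _root_.map_smul, _root_.map_smul, hρ, smul_comm]

lemma end_comm (hT : tors m E = ⊤) (he : ∀ r ∈ m, r • e0 = 0)
    (hs : ∀ x ∈ sk (m : Set R) E, ∃ r : R, x = r • e0) (φ ψ : Module.End R E) : φ * ψ = ψ * φ := by
  ext x
  have hx : x ∈ tors m E := by rw [hT]; trivial
  obtain ⟨k, hk⟩ := hx
  have hk' : x ∈ sk ((m ^ k : Ideal R) : Set R) E := hk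
  obtain ⟨r, hr⟩ := end_scalar he hs k φ
  obtain ⟨s, hs⟩ := end_scalar he hs k ψ
  rw [Module.End.mul_apply, Module.End.mul_apply, hr x hk', hs x hk', _root_.map_smul, _root_.map_smul,
    hr x hk', hs x hk', smul_comm]

lemma exists_ring (hT : tors m E = ⊤) (he : ∀ r ∈ m, r • e0 = 0)
    (hs : ∀ x ∈ sk (m : Set R) E, ∃ r : R, x = r • e0) :
    ∃ (Λ : Type) (_ : CommRing Λ) (_ : Algebra R Λ) (_ : Module Λ E) (_ : IsScalarTower R Λ E),
      (∀ φ : Module.End R E, ∃ l : Λ, ∀ x, l • x = φ x) ∧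
      ∀ (l : Λ) (k : ℕ), ∃ r : R, ∀ x ∈ sk ((m ^ k : Ideal R) : Set R) E, l • x = r • x := by
  refine ⟨Subalgebra.center R (Module.End R E), inferInstance, inferInstance, inferInstance, inferInstance,
    fun φ => ⟨⟨φ, ?_⟩, fun x => rfl⟩, fun l k => ?_⟩
  · rw [Subalgebra.mem_center_iff]
    intro ψ
    exact end_comm hT he hs ψ φ
  · exact end_scalar he hs k l.1
end endo

end hull
end LC

end

section
open CategoryTheory Abelian

namespace LC
set_option linter.unusedSectionVars false
set_option linter.unusedVariables false

section action
variable {R : Type} [CommRing R] [IsNoetherianRing R]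

lemma det_kill {Λ E J : Type} [CommRing Λ] [AddCommGroup E] [Module Λ E] [Fintype J] [DecidableEq J]
    (B : Matrix J J Λ) (w : J → E) (h : ∀ j, ∑ l, B j l • w l = 0) (p : J) : B.det • w p = 0 := by
  have h1 : ∑ j, B.adjugate p j • ∑ l, B j l • w l = 0 := by
    simp [h]
  simp_rw [Finset.smul_sum, smul_smul] at h1
  rw [Finset.sum_comm] at h1
  simp_rw [← Finset.sum_smul, ← Matrix.mul_apply, Matrix.adjugate_mul, Matrix.smul_apply, Matrix.one_apply] at h1
  simpa using h1

lemma det_mod {Λ J : Type} [CommRing Λ] [Fintype J] [DecidableEq J] (I : Ideal Λ) (x : Λ) (A : Matrix J J Λ)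
    (hA : ∀ i j, A i j ∈ I) : (x • (1 : Matrix J J Λ) - A).det - x ^ Fintype.card J ∈ I := by
  rw [← Ideal.Quotient.eq_zero_iff_mem, _root_.map_sub, RingHom.map_det, sub_eq_zero]
  have : (Ideal.Quotient.mk I).mapMatrix (x • (1 : Matrix J J Λ) - A) =
      Ideal.Quotient.mk I x • (1 : Matrix J J (Λ ⧸ I)) := by
    ext i j
    have := Ideal.Quotient.eq_zero_iff_mem.2 (hA i j)
    by_cases hij : i = j
    · subst hij
      simp [this]
    · simp [this, hij]
  rw [this, Matrix.det_smul, Matrix.det_one, mul_one, _root_.map_pow]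

variable {E : Type} [AddCommGroup E] [Module R E] [Module.Injective R E] {m : Ideal R} {e0 : E}

lemma exists_embed (hm : m.IsMaximal) (h0 : e0 ≠ 0) (he : ∀ r ∈ m, r • e0 = 0) (W : Type) [AddCommGroup W] [Module R W]
    [IsArtinian R W] (hW : tors m W = ⊤) : ∃ (J : Type) (_ : Fintype J) (f : W →ₗ[R] (J → E)), Function.Injective f := by
  classical
  have hsep : ∀ x : W, x ≠ 0 → ∃ φ : W →ₗ[R] E, φ x ≠ 0 := by
    intro x hx
    obtain ⟨r, hr0, hr⟩ := exists_soc (m := m) (x := x) (by rw [hW]; trivial) hx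
    obtain ⟨φ, hφ⟩ := inj_ext (LinearMap.toSpanSingleton R W (r • x)) (LinearMap.toSpanSingleton R E e0) (by
      intro s hs
      rw [LinearMap.mem_ker, LinearMap.toSpanSingleton_apply] at hs ⊢
      apply he
      by_contra hsm
      exact hr0 (tors_zero hm (x := r • x) (by rw [hW]; trivial) hsm hs))
    refine ⟨φ, fun h => h0 ?_⟩
    have := hφ 1
    rw [LinearMap.toSpanSingleton_apply, LinearMap.toSpanSingleton_apply, one_smul, one_smul, _root_.map_smul, h,
      smul_zero] at this
    exact this.symm
  obtain ⟨_, ⟨S, rfl⟩, hmin⟩ := IsArtinian.set_has_minimal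
    (Set.range fun S : Finset (W →ₗ[R] E) => LinearMap.ker (LinearMap.pi fun φ : S => φ.1)) ⟨_, ⟨∅, rfl⟩⟩
  refine ⟨S, inferInstance, LinearMap.pi fun φ : S => φ.1, ?_⟩
  rw [injective_iff_map_eq_zero]
  intro x hx
  by_contra hx0
  obtain ⟨φ, hφ⟩ := hsep x hx0
  refine hmin _ ⟨insert φ S, rfl⟩ (lt_of_le_of_ne ?_ ?_)
  · intro y hy
    funext ψ
    exact congrFun hy ⟨ψ.1, Finset.mem_insert_of_mem ψ.2⟩
  · intro h
    have hx' : x ∈ LinearMap.ker (LinearMap.pi fun φ : S => φ.1) := hx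
    have h' : LinearMap.ker (LinearMap.pi fun ψ : (insert φ S : Finset _) => ψ.1) =
      LinearMap.ker (LinearMap.pi fun φ : S => φ.1) := h
    rw [← h'] at hx'
    exact hφ (congrFun hx' ⟨φ, Finset.mem_insert_self _ _⟩)

lemma exists_action (hm : m.IsMaximal) (W : Type) [AddCommGroup W] [Module R W] [IsArtinian R W]
    (hW : tors m W = ⊤) :
    ∃ (Λ : Type) (_ : CommRing Λ) (_ : Algebra R Λ) (_ : Module Λ W) (_ : IsScalarTower R Λ W),
    ∀ (a : Ideal R) (V : Submodule R W), IsNoetherian R (sk (a : Set R) V) → ∀ s ∈ m, ∃ (n : ℕ) (t : Λ),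
      t - algebraMap R Λ (s ^ n) ∈ a.map (algebraMap R Λ) ∧ ∀ v ∈ V, t • v = 0 := by
  classical
  obtain ⟨E, _, _, hE, hT, e0, h0, he, hs⟩ := exists_hull hm
  obtain ⟨Λ, _, _, _, _, hΛ, hΛs⟩ := exists_ring hT he hs
  obtain ⟨J, _, f, hf⟩ := exists_embed hm h0 he W hW
  have hsm : ∀ (l : Λ) (x : W), ∃ y, f y = l • f x := by
    intro l x
    have hx : x ∈ tors m W := by rw [hW]; trivial
    obtain ⟨k, hk⟩ := hx
    obtain ⟨r, hr⟩ := hΛs l k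
    refine ⟨r • x, ?_⟩
    rw [_root_.map_smul]
    funext j
    refine (hr (f x j) fun q hq => ?_).symm
    have : q • f x = 0 := by rw [← _root_.map_smul, hk q hq, _root_.map_zero]
    exact congrFun this j
  choose sm hsm using hsm
  let i1 : SMul Λ W := ⟨sm⟩
  let i2 : Module Λ W := Function.Injective.module Λ f.toAddMonoidHom hf hsm
  have hsm' : ∀ (l : Λ) (x : W), f (l • x) = l • f x := hsm
  have i3 : IsScalarTower R Λ W := ⟨fun r l x => hf (by
    rw [hsm', _root_.map_smul, hsm', smul_assoc])⟩
  refine ⟨Λ, inferInstance, inferInstance, i2, i3, fun a V hV s hsm => ?_⟩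
  obtain ⟨n0, hn0⟩ := tors_fg (a := m) (X := sk (a : Set R) V) (by
    rw [eq_top_iff]
    rintro ⟨⟨x, hx⟩, hx'⟩ _
    have hx : x ∈ tors m W := by rw [hW]; trivial
    obtain ⟨k, hk⟩ := hx
    exact ⟨k, fun r hr => Subtype.ext (Subtype.ext (hk r hr))⟩)
  obtain ⟨S, hS⟩ := (isNoetherianRing_iff_ideal_fg R).1 inferInstance a
  have hS' : Ideal.span (S : Set R) = a := hS
  let F : V →ₗ[R] (S → V) := LinearMap.pi fun b => LinearMap.lsmul R V b.1
  have h1 : ∀ j : J, ∃ A : J → Λ, (∀ l, A l ∈ a.map (algebraMap R Λ)) ∧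
      ∀ v ∈ V, s ^ n0 • f v j = ∑ l, A l • f v l := by
    intro j
    obtain ⟨ε, hε⟩ := inj_ext F ((s ^ n0) • (LinearMap.proj j ∘ₗ f ∘ₗ V.subtype)) (by
      intro v hv
      have h2 : v ∈ sk (S : Set R) V := fun b hb => congrFun hv ⟨b, hb⟩
      rw [← sk_span, hS'] at h2
      have h3 : (s ^ n0) • (⟨v, h2⟩ : sk (a : Set R) V) = 0 :=
        Module.mem_annihilator.1 (hn0 (Ideal.pow_mem_pow hsm n0)) _
      have h4 : (s ^ n0) • v.1 = 0 := congrArg Subtype.val (congrArg Subtype.val h3)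
      change s ^ n0 • f v.1 j = 0
      rw [← Pi.smul_apply, ← _root_.map_smul, h4, _root_.map_zero]
      rfl)
    have h5 : ∀ b : S, ∃ h : (J → E) →ₗ[R] E, ∀ v : V, h (f v.1) =
        ε (LinearMap.single R (fun _ : S => V) b v) := by
      intro b
      obtain ⟨h, hh⟩ := inj_ext (f ∘ₗ V.subtype) (ε ∘ₗ LinearMap.single R (fun _ : S => V) b) (by
        intro v hv
        have : v = 0 := Subtype.ext (hf (by change f v.1 = f 0; rw [_root_.map_zero]; exact hv))
        rw [this]
        exact zero_mem _)
      exact ⟨h, hh⟩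
    choose h hh using h5
    have h6 : ∀ (b : S) (l : J), ∃ c : Λ, ∀ x, c • x = h b (LinearMap.single R (fun _ : J => E) l x) :=
      fun b l => hΛ (h b ∘ₗ LinearMap.single R (fun _ : J => E) l)
    choose lam hlam using h6
    refine ⟨fun l => ∑ b : S, algebraMap R Λ b.1 * lam b l, fun l => ?_, fun v hv => ?_⟩
    · refine Ideal.sum_mem _ fun b _ => Ideal.mul_mem_right _ _ (Ideal.mem_map_of_mem _ ?_)
      rw [← hS']
      exact Ideal.subset_span b.2
    · have h7 : ε (F ⟨v, hv⟩) = s ^ n0 • f v j := hε ⟨v, hv⟩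
      have h8 : F ⟨v, hv⟩ = ∑ b : S, LinearMap.single R (fun _ : S => V) b (b.1 • ⟨v, hv⟩) :=
        (LinearMap.sum_single_apply (fun _ : S => V) (F ⟨v, hv⟩)).symm
      have h9 : f v = ∑ l : J, LinearMap.single R (fun _ : J => E) l (f v l) :=
        (LinearMap.sum_single_apply (fun _ : J => E) (f v)).symm
      rw [← h7, h8, _root_.map_sum]
      simp_rw [Finset.sum_smul]
      rw [Finset.sum_comm]
      refine Finset.sum_congr rfl fun b _ => ?_
      rw [_root_.map_smul, _root_.map_smul, ← hh]
      change b.1 • h b (f v) = _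
      conv_lhs => rw [h9]
      rw [_root_.map_sum, Finset.smul_sum]
      refine Finset.sum_congr rfl fun l _ => ?_
      rw [← hlam, mul_smul, algebraMap_smul]
  choose A hA hAv using h1
  refine ⟨n0 * Fintype.card J, (algebraMap R Λ (s ^ n0) • (1 : Matrix J J Λ) - Matrix.of A).det, ?_, ?_⟩
  · rw [pow_mul, _root_.map_pow (algebraMap R Λ) (s ^ n0)]
    exact det_mod _ _ _ hA
  · intro v hv
    apply hf
    rw [hsm', _root_.map_zero]
    funext p
    refine det_kill _ (f v) (fun j => ?_) p
    simp_rw [Matrix.sub_apply, sub_smul]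
    rw [Finset.sum_sub_distrib, sub_eq_zero]
    refine Eq.trans ?_ (hAv j v hv)
    simp [Matrix.one_apply, ite_smul, algebraMap_smul, ← _root_.map_pow]

end action
end LC

end

section
open CategoryTheory Abelian

namespace LC
set_option linter.unusedSectionVars false
set_option linter.unusedVariables false

section secondary
variable {A : Type} [CommRing A] {X : Type} [AddCommGroup X] [Module A X]

def Sec (U : Submodule A X) : Prop :=
  U ≠ ⊥ ∧ ∀ x : A, (∀ u ∈ U, ∃ v ∈ U, x • v = u) ∨ ∃ k : ℕ, ∀ u ∈ U, x ^ k • u = 0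

lemma Sec.pow {U : Submodule A X} {x : A} (h : ∀ u ∈ U, ∃ v ∈ U, x • v = u) (k : ℕ) :
    ∀ u ∈ U, ∃ v ∈ U, x ^ k • v = u := by
  induction k with
  | zero => intro u hu; exact ⟨u, hu, by simp⟩
  | succ k ih =>
    intro u hu
    obtain ⟨v, hv, rfl⟩ := ih u hu
    obtain ⟨w, hw, rfl⟩ := h v hv
    exact ⟨w, hw, by rw [pow_succ, mul_smul]⟩

lemma mem_rad {U : Submodule A X} {x : A} :
    x ∈ (Module.annihilator A U).radical ↔ ∃ k : ℕ, ∀ u ∈ U, x ^ k • u = 0 := by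
  constructor
  · rintro ⟨k, hk⟩
    exact ⟨k, fun u hu => congrArg Subtype.val (Module.mem_annihilator.1 hk ⟨u, hu⟩)⟩
  · rintro ⟨k, hk⟩
    exact ⟨k, Module.mem_annihilator.2 fun u => Subtype.ext (hk u.1 u.2)⟩

lemma Sec.prime {U : Submodule A X} (h : Sec U) : (Module.annihilator A U).radical.IsPrime := by
  constructor
  · rw [Ne, Ideal.eq_top_iff_one, mem_rad]
    rintro ⟨k, hk⟩
    exact h.1 (eq_bot_iff.2 fun u hu => by simpa using hk u hu)
  · intro x y hxy
    rcases h.2 x with h1 | h1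
    · right
      rw [mem_rad] at hxy ⊢
      obtain ⟨k, hk⟩ := hxy
      refine ⟨k, fun u hu => ?_⟩
      obtain ⟨v, hv, rfl⟩ := Sec.pow h1 k u hu
      rw [← mul_smul, mul_comm, ← mul_pow]
      exact hk v hv
    · left; exact mem_rad.2 h1

lemma exists_sec [IsArtinian A X] (U : Submodule A X) :
    ∃ S : Finset (Submodule A X), (∀ V ∈ S, Sec V) ∧ S.sup id = U := by
  classical
  by_contra hU
  obtain ⟨V, hV, hmin⟩ := IsArtinian.set_has_minimal (R := A) (M := X)
    {U | ¬ ∃ S : Finset (Submodule A X), (∀ V ∈ S, Sec V) ∧ S.sup id = U} ⟨U, hU⟩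
  have hmin' : ∀ W < V, ∃ S : Finset (Submodule A X), (∀ V ∈ S, Sec V) ∧ S.sup id = W := by
    intro W hW
    by_contra h
    exact hmin W h hW
  have hns : ¬ Sec V := fun h => hV ⟨{V}, by simpa using h, by simp⟩
  have hb : V ≠ ⊥ := fun h => hV ⟨∅, by simp, by simp [h]⟩
  unfold Sec at hns
  push Not at hns
  obtain ⟨x, ⟨u0, hu0, hx1⟩, hx2⟩ := hns hb
  obtain ⟨k, hk⟩ := fitting x V
  have l1 : ti x V < V := by
    refine lt_of_le_of_ne (ti_le x V) fun h => ?_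
    obtain ⟨v, hv, hv'⟩ := ti_div x V (h.symm ▸ hu0 : u0 ∈ ti x V)
    exact hx1 v (ti_le x V hv) hv'
  have l2 : V ⊓ LinearMap.ker (LinearMap.lsmul A X (x ^ k)) < V := by
    refine lt_of_le_of_ne inf_le_left fun h => ?_
    obtain ⟨u, hu, hu'⟩ := hx2 k
    rw [← h] at hu
    exact hu' hu.2
  obtain ⟨S, hS, hS'⟩ := hmin' _ l1
  obtain ⟨T, hT, hT'⟩ := hmin' _ l2
  refine hV ⟨S ∪ T, fun W hW => ?_, ?_⟩
  · rcases Finset.mem_union.1 hW with h | h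
    · exact hS W h
    · exact hT W h
  · rw [Finset.sup_union, hS', hT']
    refine le_antisymm (sup_le l1.le l2.le) fun u hu => ?_
    obtain ⟨v, hv, w, hw, h1, rfl⟩ := hk u hu
    exact Submodule.add_mem_sup hv ⟨hw, h1⟩

lemma exists_surj [IsArtinian A X] (I : Ideal A) (hI : I.FG) (h : I • (⊤ : Submodule A X) = ⊤) :
    ∃ x ∈ I, ∀ y : X, ∃ z, x • z = y := by
  classical
  obtain ⟨S, hS, hsup⟩ := exists_sec (⊤ : Submodule A X)
  let P : Submodule A X → Ideal A := fun U => (Module.annihilator A U).radical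
  let G := S.filter fun U => ¬ I ≤ P U
  have hpow : ∀ n : ℕ, I ^ n • (⊤ : Submodule A X) = ⊤ := by
    intro n
    induction n with
    | zero => simp
    | succ n ih => rw [pow_succ, Submodule.mul_smul, h, ih]
  have hN : ∃ N : ℕ, ∀ U ∈ S, I ≤ P U → ∀ k ≥ N, I ^ k ≤ Module.annihilator A U := by
    have : ∀ U ∈ S, ∃ N : ℕ, I ≤ P U → ∀ k ≥ N, I ^ k ≤ Module.annihilator A U := by
      intro U hU
      by_cases h1 : I ≤ P U
      · obtain ⟨n, hn⟩ := Ideal.exists_pow_le_of_le_radical_of_fg h1 hI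
        exact ⟨n, fun _ k hk => (Ideal.pow_le_pow_right hk).trans hn⟩
      · exact ⟨0, fun h => absurd h h1⟩
    choose! N hN using this
    exact ⟨S.sup N, fun U hU h1 k hk => hN U hU h1 k (le_trans (Finset.le_sup hU) hk)⟩
  obtain ⟨N, hN⟩ := hN
  have hG : G.sup id = ⊤ := by
    rw [eq_top_iff]
    conv_lhs => rw [← hpow N, ← hsup]
    rw [Submodule.smul_le]
    intro r hr u hu
    have : S.sup id ≤ (G.sup id).comap (LinearMap.lsmul A X r) := by
      refine Finset.sup_le fun U hU => ?_
      by_cases h1 : I ≤ P U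
      · intro u hu
        have : r • u = 0 := congrArg Subtype.val
          (Module.mem_annihilator.1 (hN U hU h1 N le_rfl hr) ⟨u, hu⟩)
        change r • u ∈ G.sup id
        rw [this]
        exact zero_mem _
      · intro u hu
        have : U ≤ G.sup id := Finset.le_sup (f := id) (Finset.mem_filter.2 ⟨hU, h1⟩)
        exact Submodule.smul_mem _ _ (this hu)
    exact this hu
  have hav : ¬ ((I : Set A) ⊆ ⋃ U ∈ (G : Set (Submodule A X)), (P U : Set A)) := by
    rw [Ideal.subset_union_prime ⊤ ⊤ fun U hU _ _ => (hS U (Finset.mem_filter.1 hU).1).prime]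
    rintro ⟨U, hU, h1⟩
    exact (Finset.mem_filter.1 hU).2 h1
  obtain ⟨x, hx, hx'⟩ := Set.not_subset.1 hav
  refine ⟨x, hx, fun y => ?_⟩
  have : G.sup id ≤ LinearMap.range (LinearMap.lsmul A X x) := by
    refine Finset.sup_le fun U hU u hu => ?_
    rcases (hS U (Finset.mem_filter.1 hU).1).2 x with h1 | h1
    · obtain ⟨v, _, hv⟩ := h1 u hu
      exact ⟨v, hv⟩
    · exact absurd (Set.mem_iUnion₂.2 ⟨U, hU, mem_rad.2 h1⟩) hx'
  rw [hG] at this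
  exact this (x := y) trivial

end secondary
end LC

end

section
open CategoryTheory Abelian

namespace LC
set_option linter.unusedSectionVars false
set_option linter.unusedVariables false

section propS
variable {R : Type} [CommRing R] [IsNoetherianRing R] {m : Ideal R}

lemma propS (hm : m.IsMaximal) (a : Ideal R) (c : ℕ) (Ω : Type) [AddCommGroup Ω] [Module R Ω]
    [IsArtinian R Ω] (hT : tors m Ω = ⊤) (hnd : ND R (c+1) Ω)
    (hQ : ∀ (Q : Type) [AddCommGroup Q] [Module R Q] (f : Ω →ₗ[R] Q), Function.Surjective f →
      Cof a Q → Subsingleton Q)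
    (V : Submodule R Ω) (hV : IsNoetherian R (sk (a : Set R) V)) : ND R c V := by
  classical
  obtain ⟨Λ, _, _, _, _, hΛ⟩ := exists_action hm Ω hT
  have hΛ' := hΛ a V hV
  choose! n t ht1 ht2 using hΛ'
  obtain ⟨S, hS⟩ := (isNoetherianRing_iff_ideal_fg R).1 inferInstance m
  have hS' : Ideal.span (S : Set R) = m := hS
  have hSm : ∀ s ∈ S, s ∈ m := fun s hs => hS' ▸ Ideal.subset_span hs
  let I : Ideal Λ := Ideal.span ((S.image t : Finset Λ) : Set Λ)
  have hI : I.FG := ⟨S.image t, rfl⟩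
  have hIV : ∀ x ∈ I, ∀ v ∈ V, x • v = 0 := by
    intro x hx v hv
    induction hx using Submodule.span_induction with
    | mem x hx =>
      obtain ⟨s, hs, rfl⟩ := Finset.mem_image.1 (Finset.mem_coe.1 hx)
      exact ht2 s (hSm s hs) v hv
    | zero => rw [zero_smul]
    | add x y _ _ h1 h2 => rw [add_smul, h1, h2, add_zero]
    | smul r x _ h => rw [smul_assoc, h, smul_zero]
  have htop : I • (⊤ : Submodule Λ Ω) = ⊤ := by
    let U : Submodule R Ω := (I • (⊤ : Submodule Λ Ω)).restrictScalars R
    have hart : IsArtinian R (Ω ⧸ U) := inferInstance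
    have key : ∀ s ∈ S, ∀ q ∈ sk (a : Set R) (Ω ⧸ U), s ^ n s • q = 0 := by
      intro s hs q hq
      obtain ⟨w, rfl⟩ := Submodule.Quotient.mk_surjective _ q
      have h1 : ∀ r ∈ a, algebraMap R Λ r • w ∈ I • (⊤ : Submodule Λ Ω) := by
        intro r hr
        have h2 := hq r hr
        rw [← Submodule.Quotient.mk_smul, Submodule.Quotient.mk_eq_zero] at h2
        rw [algebraMap_smul]
        exact h2
      have h3 : ∀ l ∈ a.map (algebraMap R Λ), l • w ∈ I • (⊤ : Submodule Λ Ω) := by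
        intro l hl
        induction hl using Submodule.span_induction with
        | mem x hx =>
          obtain ⟨r, hr, rfl⟩ := hx
          exact h1 r hr
        | zero => rw [zero_smul]; exact zero_mem _
        | add x y _ _ h1 h2 => rw [add_smul]; exact add_mem h1 h2
        | smul r x _ h => rw [smul_assoc]; exact Submodule.smul_mem _ _ h
      rw [← Submodule.Quotient.mk_smul, Submodule.Quotient.mk_eq_zero]
      change s ^ n s • w ∈ I • (⊤ : Submodule Λ Ω)
      have h4 : s ^ n s • w = t s • w - (t s - algebraMap R Λ (s ^ n s)) • w := by
        rw [sub_smul, algebraMap_smul]; abel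
      rw [h4]
      refine sub_mem (Submodule.smul_mem_smul (Ideal.subset_span ?_) trivial) (h3 _ (ht1 s (hSm s hs)))
      exact Finset.mem_coe.2 (Finset.mem_image_of_mem _ hs)
    have hrad : m ≤ (Module.annihilator R (sk (a : Set R) (Ω ⧸ U))).radical := by
      rw [← hS', Ideal.span_le]
      intro s hs
      exact ⟨n s, Module.mem_annihilator.2 fun q => Subtype.ext (key s hs q.1 q.2)⟩
    obtain ⟨K, hK⟩ := Ideal.exists_pow_le_of_le_radical_of_fg hrad ⟨S, hS⟩
    have hno : IsNoetherian R (sk (a : Set R) (Ω ⧸ U)) :=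
      noeth_of_art_pow hm K _ inferInstance fun r hr x => Module.mem_annihilator.1 (hK hr) x
    have hsub := hQ (Ω ⧸ U) U.mkQ U.mkQ_surjective ⟨hart, hno⟩
    have hU : U = ⊤ := Submodule.Quotient.subsingleton_iff.1 hsub
    rw [eq_top_iff]
    intro x _
    have : x ∈ U := by rw [hU]; trivial
    exact this
  have : IsArtinian Λ Ω := isArtinian_of_tower R inferInstance
  obtain ⟨x, hx, hxs⟩ := exists_surj I hI htop
  let φ : Module.End R Ω := (LinearMap.lsmul Λ Ω x).restrictScalars R
  exact (serre_nd c).le (U := V) (V := LinearMap.ker φ) (fun v hv => hIV x hx v hv) (nd_ker hnd φ hxs)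

end propS
end LC

end

section
open CategoryTheory Abelian

namespace LC
set_option linter.unusedSectionVars false
set_option linter.unusedVariables false

section core
variable {R : Type} [CommRing R] [IsNoetherianRing R]

lemma core (a : Ideal R) (c : ℕ) {X N : Type} [AddCommGroup X] [Module R X] [Module.Finite R X]
    [AddCommGroup N] [Module R N] [Module.Finite R N] (f : X →ₗ[R] N) (hf : Function.Injective f)
    (hN : SD R (c+1) N) (h0 : ∀ x, map a c f x = 0) : Subsingleton (HL a c X) := by
  cases c with
  | zero =>
    refine subsingleton_of_forall_eq 0 fun x => map0_inj (a := a) hf ?_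
    rw [h0, _root_.map_zero]
  | succ d =>
    by_contra hns
    rw [not_subsingleton_iff_nontrivial] at hns
    have hX : SD R (d+1+1) X := hN.inj f hf
    have hcof := HL_cof a (d+1) X hX
    have hart : IsArtinian R (HL a (d+1) X) := hcof.1
    obtain ⟨m, hm, x, hx0, hx⟩ := exists_max (R := R) (X := HL a (d+1) X)
    have ham : a ≤ m := by
      obtain ⟨n, hn⟩ := HL_torsion (a := a) x
      have : a ^ n ≤ m := by
        intro r hr
        by_contra hrm
        obtain ⟨y, i, hi, hyi⟩ := hm.exists_inv hrm
        apply hx0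
        have : (1 : R) • x = 0 := by
          rw [← hyi, add_smul, mul_smul, hn r hr, hx i hi, smul_zero, add_zero]
        simpa using this
      exact hm.isPrime.le_of_pow_le this
    let θX := theta (d+1) X ham
    let θN := theta (d+1) N ham
    let F := LinearMap.ker θN
    let fm := map m (d+1) f
    let fF : HL m (d+1) X →ₗ[R] F := fm.codRestrict F fun y => by
      change theta (d+1) N ham (map m (d+1) f y) = 0
      rw [theta_map, h0]
    let K : Submodule R F := (LinearMap.ker θX).map fF
    have hCN := HL_max hm (d+1) N
    have : IsArtinian R (HL m (d+1) N) := hCN.1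
    have aF : IsArtinian R F := inferInstance
    have aΩ : IsArtinian R (F ⧸ K) := inferInstance
    let g : HL m (d+1) X →ₗ[R] (F ⧸ K) := K.mkQ ∘ₗ fF
    have hnd : ND R (d+1+1) (F ⧸ K) := (serre_nd _).quot K ((serre_nd _).sub F hCN.2)
    have hT : tors m (F ⧸ K) = ⊤ := by
      rw [eq_top_iff]
      intro q _
      obtain ⟨w, rfl⟩ := Submodule.Quotient.mk_surjective _ q
      obtain ⟨n, hn⟩ := HL_torsion (a := m) w.1
      refine ⟨n, fun r hr => ?_⟩
      rw [← Submodule.Quotient.mk_smul]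
      have : r • w = 0 := Subtype.ext (hn r hr)
      rw [this]; rfl
    have hV : Cof a (LinearMap.range g) := by
      obtain ⟨e, he⟩ := surj_desc θX.rangeRestrict θX.surjective_rangeRestrict g.rangeRestrict (by
        rw [LinearMap.ker_rangeRestrict, LinearMap.ker_rangeRestrict]
        intro y hy
        change K.mkQ (fF y) = 0
        rw [Submodule.mkQ_apply, Submodule.Quotient.mk_eq_zero]
        exact ⟨y, hy, rfl⟩)
      refine (serre_cof a).surj (X := LinearMap.range θX) (Y := LinearMap.range g) e ?_
        ((serre_cof a).sub (LinearMap.range θX) hcof)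
      intro z
      obtain ⟨y, rfl⟩ := g.surjective_rangeRestrict z
      exact ⟨_, he y⟩
    have hV1 : ND R (d+1) (LinearMap.range g) := propS hm a (d+1) (F ⧸ K) hT hnd (by
      intro Q _ _ q hq hc
      exact (theta_fin hm (d+1) N hN a ham).2 Q (q ∘ₗ K.mkQ) (hq.comp K.mkQ_surjective) hc) _ hV.2
    have hV0 : Subsingleton (LinearMap.range g) :=
      pprime m (d+1) X _ g.rangeRestrict hX g.surjective_rangeRestrict hV1
    have hdec : ∀ y, ∃ k, θX k = 0 ∧ fm k = fm y := by
      intro y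
      have h1 : g y = 0 := congrArg Subtype.val (Subsingleton.elim (g.rangeRestrict y) 0)
      have h2 : fF y ∈ K := (Submodule.Quotient.mk_eq_zero _).1 h1
      obtain ⟨k, hk, hk'⟩ := h2
      exact ⟨k, hk, congrArg Subtype.val hk'⟩
    have hex : Function.Exact f (LinearMap.range f).mkQ := LinearMap.exact_map_mkQ_range f
    let δ := delta m d hf hex (LinearMap.range f).mkQ_surjective
    have hexl : Function.Exact δ fm := exact_left m d hf hex (LinearMap.range f).mkQ_surjective
    have hW : ND R (d+1) (LinearMap.range θX) := by
      refine (serre_nd (d+1)).surj (X := HL m d (N ⧸ LinearMap.range f)) (Y := LinearMap.range θX)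
        (θX.rangeRestrict ∘ₗ δ) ?_ (HL_max hm d _).2
      intro z
      obtain ⟨y, rfl⟩ := θX.surjective_rangeRestrict z
      obtain ⟨k, hk, hk'⟩ := hdec y
      obtain ⟨w, hw⟩ := (hexl (y - k)).1 (by rw [_root_.map_sub, hk', sub_self])
      refine ⟨w, Subtype.ext ?_⟩
      change θX (δ w) = θX y
      rw [hw, _root_.map_sub, hk, sub_zero]
    have hW0 : Subsingleton (LinearMap.range θX) :=
      pprime m (d+1) X _ θX.rangeRestrict hX θX.surjective_rangeRestrict hW
    obtain ⟨y, hy⟩ := (theta_fin hm (d+1) X hX a ham).1 x ⟨1, fun r hr => hx r (by simpa using hr)⟩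
    apply hx0
    rw [← hy]
    exact congrArg Subtype.val (Subsingleton.elim (θX.rangeRestrict y) 0)

end core
end LC

end

section
open CategoryTheory Abelian

namespace LC
set_option linter.unusedSectionVars false
set_option linter.unusedVariables false

section final
variable {R : Type} [CommRing R] [IsNoetherianRing R] (a : Ideal R) (c : ℕ)
variable {X : Type} [AddCommGroup X] [Module R X] [Module.Finite R X]

lemma ann_iff (hX : SD R (c+1) X) (r : R) : (∀ h : HL a c X, r • h = 0) ↔
    Subsingleton (HL a c (LinearMap.range (LinearMap.lsmul R X r))) := by
  constructor
  · intro h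
    refine core a c (LinearMap.range (LinearMap.lsmul R X r)).subtype (Submodule.subtype_injective _) hX ?_
    intro x
    obtain ⟨y, _, hy⟩ := map_range_lsmul a c hX r x
    rw [hy, h]
  · intro h x
    have h1 : LinearMap.lsmul R X r = (LinearMap.range (LinearMap.lsmul R X r)).subtype ∘ₗ
      (LinearMap.lsmul R X r).rangeRestrict := rfl
    rw [← map_lsmul, h1, map_comp, Subsingleton.elim (map a c (LinearMap.lsmul R X r).rangeRestrict x) 0,
      _root_.map_zero]

lemma coh_ge {p : PrimeSpectrum R} (h : Nontrivial (HL a c (R ⧸ p.asIdeal))) :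
    (c : ℕ∞) ≤ Order.coheight p := by
  by_contra hlt
  push Not at hlt
  have : SD R c (R ⧸ p.asIdeal) := by
    intro q hq
    rw [mem_supp_quot] at hq
    exact lt_of_le_of_lt (Order.coheight_anti hq) hlt
  exact not_subsingleton _ (vanish a c _ this)

lemma coh_eq {p q : PrimeSpectrum R} (hpq : p ≤ q) (hp : Order.coheight p < (c+1 : ℕ))
    (hq : (c : ℕ∞) ≤ Order.coheight q) : p = q := by
  by_contra hne
  have h1 := Order.coheight_add_one_le (lt_of_le_of_ne hpq hne)
  have h2 : ((c+1 : ℕ) : ℕ∞) ≤ Order.coheight q + 1 := by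
    push_cast
    gcongr
  exact absurd hp (not_lt.2 (h2.trans h1))

lemma p_min (hX : SD R (c+1) X) {p : PrimeSpectrum R} (hp : p ∈ Module.support R X)
    (h : Nontrivial (HL a c (R ⧸ p.asIdeal))) : p.asIdeal ∈ (Module.annihilator R X).minimalPrimes := by
  refine ⟨⟨p.2, Module.mem_support_iff_of_finite.1 hp⟩, fun q hq hle => ?_⟩
  have : (⟨q, hq.1⟩ : PrimeSpectrum R) = p := coh_eq c hle
    (hX _ (Module.mem_support_iff_of_finite.2 hq.2)) (coh_ge a c h)
  rw [← this]

lemma G (hX : SD R (c+1) X) {p : PrimeSpectrum R} (hp : p ∈ Module.support R X)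
    (h : Nontrivial (HL a c (R ⧸ p.asIdeal))) : Nontrivial (HL a c X) := by
  have h1 := Module.associatedPrimes.minimalPrimes_annihilator_subset_associatedPrimes R X
    (p_min a c hX hp h)
  obtain ⟨_, f, hf⟩ := (isAssociatedPrime_iff_exists_injective_linearMap _ _).1 h1
  rw [← not_subsingleton_iff_nontrivial]
  intro hs
  exact not_subsingleton _ (core a c f hf hX fun x => Subsingleton.elim _ _)

lemma exists_p (h : Nontrivial (HL a c X)) :
    ∃ p ∈ Module.support R X, Nontrivial (HL a c (R ⧸ p.asIdeal)) := by
  by_contra hn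
  push Not at hn
  exact not_subsingleton _ (HL_of_primes a c fun p hp => hn p hp)

lemma map_fsum {Y Z ι : Type} [AddCommGroup Y] [Module R Y] [AddCommGroup Z] [Module R Z]
    (T : Finset ι) (f : ι → Y →ₗ[R] Z) (h : HL a c Y) :
    map a c (∑ s ∈ T, f s) h = ∑ s ∈ T, map a c (f s) h := by
  classical
  induction T using Finset.induction_on with
  | empty => simp [map_zero]
  | insert s T hs ih => rw [Finset.sum_insert hs, Finset.sum_insert hs, map_add, ih]

lemma im_smul (hX : SD R (c+1) X) (I : Ideal R) (B : Submodule R (HL a c X))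
    (hB : ∀ r ∈ I, ∀ h : HL a c X, r • h ∈ B) (x : HL a c (I • (⊤ : Submodule R X) : Submodule R X)) :
    map a c (I • (⊤ : Submodule R X)).subtype x ∈ B := by
  classical
  obtain ⟨S, hS⟩ := (isNoetherianRing_iff_ideal_fg R).1 inferInstance I
  have hS' : Ideal.span (S : Set R) = I := hS
  have hSI : ∀ s : S, s.1 ∈ I := fun s => hS' ▸ Ideal.subset_span s.2
  let φ : (S → X) →ₗ[R] X := ∑ s : S, s.1 • LinearMap.proj s
  have hφ : ∀ y, φ y = ∑ s : S, s.1 • y s := fun y => by simp [φ]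
  let ψ : (S → X) →ₗ[R] (I • (⊤ : Submodule R X) : Submodule R X) := φ.codRestrict _ fun y => by
    rw [hφ]
    exact sum_mem fun s _ => Submodule.smul_mem_smul (hSI s) trivial
  have hψ : Function.Surjective ψ := by
    rintro ⟨y, hy⟩
    have hle : I • (⊤ : Submodule R X) ≤ LinearMap.range φ := by
      rw [← hS', Submodule.span_smul_eq, Submodule.set_smul_le_iff]
      intro s x hs _
      refine ⟨Pi.single ⟨s, hs⟩ x, ?_⟩
      rw [hφ, Finset.sum_eq_single ⟨s, hs⟩]
      · simp
      · intro b _ hb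
        rw [Pi.single_eq_of_ne hb, smul_zero]
      · simp
    obtain ⟨z, hz⟩ := hle hy
    exact ⟨z, Subtype.ext hz⟩
  have hSX : SD R (c+1) (S → X) := hX.of_ann (by
    intro r hr
    rw [Module.mem_annihilator] at hr ⊢
    intro y
    funext s
    exact hr (y s))
  obtain ⟨y, rfl⟩ := map_surj a c hSX hψ x
  rw [← map_comp]
  have : (I • (⊤ : Submodule R X)).subtype ∘ₗ ψ = φ := rfl
  rw [this, map_fsum]
  refine sum_mem fun s _ => ?_
  rw [map_smul]
  exact hB _ (hSI s) _

lemma att_sub (hX : SD R (c+1) X) (p : PrimeSpectrum R) (B : Submodule R (HL a c X))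
    (hB : p.asIdeal = Module.annihilator R (HL a c X ⧸ B)) :
    p ∈ Module.support R X ∧ Nontrivial (HL a c (R ⧸ p.asIdeal)) := by
  have hBp : ∀ r ∈ p.asIdeal, ∀ h : HL a c X, r • h ∈ B := by
    intro r hr h
    rw [hB] at hr
    have := Module.mem_annihilator.1 hr (Submodule.Quotient.mk h)
    rwa [← Submodule.Quotient.mk_smul, Submodule.Quotient.mk_eq_zero] at this
  have hp : p ∈ Module.support R X := by
    rw [Module.mem_support_iff_of_finite, hB]
    intro r hr
    rw [Module.mem_annihilator]
    intro q
    obtain ⟨w, rfl⟩ := Submodule.Quotient.mk_surjective _ q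
    rw [← Submodule.Quotient.mk_smul, ann_HL a c hr w]
    rfl
  refine ⟨hp, ?_⟩
  have hnt : Nontrivial (HL a c (X ⧸ p.asIdeal • (⊤ : Submodule R X))) := by
    rw [← not_subsingleton_iff_nontrivial]
    intro hs
    apply p.2.ne_top
    rw [hB, Ideal.eq_top_iff_one, Module.mem_annihilator]
    intro q
    obtain ⟨w, rfl⟩ := Submodule.Quotient.mk_surjective _ q
    rw [one_smul, Submodule.Quotient.mk_eq_zero]
    obtain ⟨v, rfl⟩ := (exact_mid a c (Submodule.subtype_injective _)
      (LinearMap.exact_subtype_mkQ (p.asIdeal • (⊤ : Submodule R X)))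
      (Submodule.mkQ_surjective _) w).1 (Subsingleton.elim _ _)
    exact im_smul a c hX _ B hBp v
  obtain ⟨q, hq, hq'⟩ := exists_p a c hnt
  rw [Module.support_quotient] at hq
  have : p = q := coh_eq c (by exact hq.2) (hX p hp) (coh_ge a c hq')
  rw [this]
  exact hq'

lemma att_sup (hX : SD R (c+1) X) (p : PrimeSpectrum R)
    (hp : p ∈ Module.support R X) (hn : Nontrivial (HL a c (R ⧸ p.asIdeal))) :
    ∃ B : Submodule R (HL a c X), p.asIdeal = Module.annihilator R (HL a c X ⧸ B) := by
  let Y := X ⧸ p.asIdeal • (⊤ : Submodule R X)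
  have hY : SD R (c+1) Y := hX.quot _
  have hpY : p ∈ Module.support R Y := by
    rw [Module.support_quotient]
    exact ⟨hp, le_refl p.asIdeal⟩
  let g := map a c (p.asIdeal • (⊤ : Submodule R X)).mkQ
  have hg : Function.Surjective g := map_surj a c hX (Submodule.mkQ_surjective _)
  refine ⟨LinearMap.ker g, ?_⟩
  rw [(g.quotKerEquivOfSurjective hg).annihilator_eq]
  apply le_antisymm
  · intro r hr
    rw [Module.mem_annihilator]
    refine ann_HL a c (Module.mem_annihilator.2 fun y => ?_)
    obtain ⟨w, rfl⟩ := Submodule.Quotient.mk_surjective _ y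
    rw [← Submodule.Quotient.mk_smul, Submodule.Quotient.mk_eq_zero]
    exact Submodule.smul_mem_smul hr trivial
  · intro r hr
    by_contra hrp
    rw [Module.mem_annihilator] at hr
    have h1 := (ann_iff a c hY r).1 hr
    have h2 : p ∈ Module.support R (LinearMap.range (LinearMap.lsmul R Y r)) := by
      rw [Module.mem_support_iff_of_finite] at hpY ⊢
      intro s hs
      rw [Module.mem_annihilator] at hs
      have : s * r ∈ p.asIdeal := hpY (Module.mem_annihilator.2 fun y => by
        rw [mul_smul]
        exact congrArg Subtype.val (hs ⟨r • y, y, rfl⟩))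
      exact (p.2.mem_or_mem this).resolve_right hrp
    have := G a c (hY.sub _) h2 hn
    exact not_subsingleton _ h1

lemma mem_ann_range {r s : R} :
    s ∈ Module.annihilator R (LinearMap.range (LinearMap.lsmul R X r)) ↔ s * r ∈ Module.annihilator R X := by
  simp_rw [Module.mem_annihilator]
  constructor
  · intro hs y
    rw [mul_smul]
    exact congrArg Subtype.val (hs ⟨r • y, y, rfl⟩)
  · rintro hs ⟨_, y, rfl⟩
    apply Subtype.ext
    change s • r • y = 0
    rw [← mul_smul]
    exact hs y

lemma main (hX : SD R (c+1) X) :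
    Module.annihilator R (HL a c X) = Module.annihilator R X ↔
      associatedPrimes R (R ⧸ Module.annihilator R X) = attachedPrimes R (HL a c X) := by
  have hatt : ∀ p : PrimeSpectrum R, p.asIdeal ∈ attachedPrimes R (HL a c X) ↔
      p ∈ Module.support R X ∧ Nontrivial (HL a c (R ⧸ p.asIdeal)) := fun p =>
    ⟨fun ⟨_, B, hB⟩ => att_sub a c hX p B hB, fun h => ⟨p.2, att_sup a c hX p h.1 h.2⟩⟩
  constructor
  · intro h
    ext p
    constructor
    · intro hp
      obtain ⟨hpp, x, hx⟩ := isAssociatedPrime_iff.1 hp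
      obtain ⟨r, rfl⟩ := Ideal.Quotient.mk_surjective x
      have hpr : ∀ s, s ∈ p ↔ s * r ∈ Module.annihilator R X := by
        intro s
        rw [hx, Submodule.mem_colon_singleton, Submodule.mem_bot, ← Ideal.Quotient.eq_zero_iff_mem]
        rfl
      have hpe : Module.annihilator R (LinearMap.range (LinearMap.lsmul R X r)) = p := by
        ext s
        rw [mem_ann_range, hpr]
      have hpX : (⟨p, hpp⟩ : PrimeSpectrum R) ∈ Module.support R X := by
        rw [Module.mem_support_iff_of_finite]
        intro s hs
        exact (hpr s).2 (Ideal.mul_mem_right _ _ hs)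
      have hnt : Nontrivial (HL a c (LinearMap.range (LinearMap.lsmul R X r))) := by
        rw [← not_subsingleton_iff_nontrivial, ← ann_iff a c hX, ← Module.mem_annihilator, h]
        intro hr
        exact hpp.ne_top ((Ideal.eq_top_iff_one _).2 ((hpr 1).2 (by simpa using hr)))
      obtain ⟨q, hq, hq'⟩ := exists_p a c hnt
      rw [Module.mem_support_iff_of_finite, hpe] at hq
      have : (⟨p, hpp⟩ : PrimeSpectrum R) = q := coh_eq c hq (hX _ hpX) (coh_ge a c hq')
      refine (hatt ⟨p, hpp⟩).2 ⟨hpX, ?_⟩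
      rw [this]
      exact hq'
    · intro hp
      obtain ⟨h1, h2⟩ := (hatt ⟨p, hp.1⟩).1 hp
      have h3 := p_min a c hX h1 h2
      refine Module.associatedPrimes.minimalPrimes_annihilator_subset_associatedPrimes R _ ?_
      rw [Ideal.annihilator_quotient]
      exact h3
  · intro h
    apply le_antisymm
    · intro r hr
      by_contra hrX
      let x : R ⧸ Module.annihilator R X := Ideal.Quotient.mk _ r
      have hx : x ≠ 0 := fun h => hrX (Ideal.Quotient.eq_zero_iff_mem.1 h)
      let U := Submodule.span R {x}
      have : Nontrivial U := Submodule.nontrivial_span_singleton hx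
      obtain ⟨p, hp⟩ := associatedPrimes.nonempty R U
      have hpA : p ∈ associatedPrimes R (R ⧸ Module.annihilator R X) :=
        associatedPrimes.subset_of_injective (f := U.subtype) U.subtype_injective hp
      obtain ⟨hpp, ⟨y, hy⟩, hyp⟩ := isAssociatedPrime_iff.1 hp
      obtain ⟨s, rfl⟩ := Submodule.mem_span_singleton.1 hy
      rw [h] at hpA
      obtain ⟨h1, h2⟩ := (hatt ⟨p, hpp⟩).1 hpA
      have hle : (⟨p, hpp⟩ : PrimeSpectrum R) ∈
          Module.support R (LinearMap.range (LinearMap.lsmul R X (s * r))) := by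
        rw [Module.mem_support_iff_of_finite]
        intro t ht
        rw [mem_ann_range] at ht
        change t ∈ p
        rw [hyp, Submodule.mem_colon_singleton, Submodule.mem_bot]
        exact Subtype.ext (Ideal.Quotient.eq_zero_iff_mem.2 ht)
      have h3 := G a c (hX.sub _) hle h2
      refine not_subsingleton _ ((ann_iff a c hX (s * r)).1 fun z => ?_)
      rw [mul_smul, Module.mem_annihilator.1 hr, smul_zero]
    · intro r hr
      rw [Module.mem_annihilator]
      exact ann_HL a c hr

lemma sd_of_dim (hdim : ringKrullDim (R ⧸ Module.annihilator R X) = (c : WithBot (WithTop ℕ))) :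
    SD R (c+1) X := by
  intro p hp
  rw [Module.mem_support_iff_of_finite] at hp
  rw [ringKrullDim_quotient] at hdim
  have h1 : (Order.coheight p : WithBot ℕ∞) ≤ (c : ℕ∞) := by
    rw [Order.coheight_eq_krullDim_Ici]
    refine le_trans (Order.krullDim_le_of_strictMono
      (β := PrimeSpectrum.zeroLocus (Module.annihilator R X : Set R))
      (fun q => ⟨q.1, fun r hr => q.2 (hp hr)⟩) fun q q' h => h) ?_
    rw [hdim]
    exact le_rfl
  have h2 : Order.coheight p ≤ (c : ℕ∞) := by exact_mod_cast h1
  exact lt_of_le_of_lt h2 (by exact_mod_cast Nat.lt_succ_self c)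

lemma att_equiv {A B : Type} [AddCommGroup A] [Module R A] [AddCommGroup B] [Module R B] (e : A ≃ₗ[R] B) :
    attachedPrimes R A ⊆ attachedPrimes R B := by
  rintro p ⟨hp, U, hU⟩
  refine ⟨hp, U.map e.toLinearMap, ?_⟩
  rw [hU]
  exact (Submodule.Quotient.equiv U (U.map e.toLinearMap) e rfl).annihilator_eq

end final
end LC

end

theorem stmt1 {R : Type} [CommRing R] [IsNoetherianRing R]
    (a : Ideal R) (M : ModuleCat R) [Module.Finite R M] (hM : Nontrivial M)
    (c : ℕ) (hdim : ringKrullDim (R ⧸ Module.annihilator R M) = (c : WithBot (WithTop ℕ)))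
    (hcd : HasCD a M c) :
    Module.annihilator R ((localCohomology a c).obj M) = Module.annihilator R M ↔
      associatedPrimes R (R ⧸ Module.annihilator R M) =
        attachedPrimes R ((localCohomology a c).obj M) := by
  have h := LC.main a c (LC.sd_of_dim (X := M) c hdim)
  let e := LC.lcEquiv a c M
  rw [e.annihilator_eq, Set.Subset.antisymm (LC.att_equiv e) (LC.att_equiv e.symm)] at h
  exact h
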